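/- arXiv:1605.00443 — 3 statements merged into one kernel-verified Lean document; each statement's English description precedes it below -/
import Mathlib

section
/- Let a_1, a_2, a_3 ∈ ℝ^3 be such that the matrix A with rows a_1, a_2, a_3 satisfies det(A) ≠ 0. Then there exists a non-zero integral vector x ∈ ℤ^3 \ {0} such that |a_1·x| + |a_2·x| + |a_3·x| + |a_1·x + a_2·x + a_3·x| ≤ 6·(2/7)^{2/3} · |det(A)|^{1/3}. -/
lemma ineq_two (y1 y2 y3 w1 w2 w3 t1 t2 t3 : ℝ)
    (hy1 : 0 ≤ y1)
    (hy2 : 0 ≤ y2)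
    (hy3 : 0 ≤ y3)
    (hw1 : 0 ≤ w1)
    (hw2 : 0 ≤ w2)
    (hw3 : 0 ≤ w3)
    (ht1 : 0 ≤ t1)
    (ht2 : 0 ≤ t2)
    (ht3 : 0 ≤ t3)
    (hsy : 0 ≤ 1 - y1 - y2 - y3)
    (hsw : 0 ≤ 1 - w1 - w2 - w3)
    (hst : 0 ≤ 1 - t1 - t2 - t3) :
    2 * (y1 * w2 * t3) ≤ (-((1-y1)*(1-w2)*(1-t3)) + (1-y1)*(1-w3)*(1-t2) + (1-w2)*(1-y3)*(1-t1) + (1-t3)*(1-y2)*(1-w1) + (1-y2)*(1-w3)*(1-t1) + (1-y3)*(1-w1)*(1-t2)) := by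
  linear_combination
    (2 : ℝ) * ((mul_nonneg (mul_nonneg hy1 hw1) (ht2))
      + (mul_nonneg (mul_nonneg hy1 hw1) (ht3))
      + (mul_nonneg (mul_nonneg hy1 hw1) (hst))
      + (mul_nonneg (mul_nonneg hy1 hw2) (ht1))
      + (mul_nonneg (mul_nonneg hy1 hw2) (ht2))
      + (mul_nonneg (mul_nonneg hy1 hw3) (ht1))
      + (mul_nonneg (mul_nonneg hy1 hw3) (ht2))
      + (mul_nonneg (mul_nonneg hy1 hw3) (ht3))
      + (mul_nonneg (mul_nonneg hy1 hsw) (ht1))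
      + (mul_nonneg (mul_nonneg hy2 hw1) (ht3))
      + (mul_nonneg (mul_nonneg hy2 hw2) (ht1))
      + (mul_nonneg (mul_nonneg hy2 hw2) (ht3))
      + (mul_nonneg (mul_nonneg hy2 hw2) (hst))
      + (mul_nonneg (mul_nonneg hy2 hw3) (ht3))
      + (mul_nonneg (mul_nonneg hy2 hsw) (hst))
      + (mul_nonneg (mul_nonneg hy3 hw1) (ht3))
      + (mul_nonneg (mul_nonneg hy3 hw2) (ht1))
      + (mul_nonneg (mul_nonneg hy3 hw2) (ht2))
      + (mul_nonneg (mul_nonneg hy3 hw2) (ht3))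
      + (mul_nonneg (mul_nonneg hy3 hsw) (ht3))
      + (mul_nonneg (mul_nonneg hy3 hsw) (hst))
      + (mul_nonneg (mul_nonneg hsy hw1) (hst))
      + (mul_nonneg (mul_nonneg hsy hw2) (ht2))
      + (mul_nonneg (mul_nonneg hsy hw3) (ht3))
      + (mul_nonneg (mul_nonneg hsy hw3) (hst))
      + (mul_nonneg (mul_nonneg hsy hsw) (ht1))
      + (mul_nonneg (mul_nonneg hsy hsw) (ht2)))
    + (3 : ℝ) * ((mul_nonneg (mul_nonneg hy1 hw2) (hst))
      + (mul_nonneg (mul_nonneg hy1 hw3) (hst))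
      + (mul_nonneg (mul_nonneg hy1 hsw) (ht2))
      + (mul_nonneg (mul_nonneg hy1 hsw) (ht3))
      + (mul_nonneg (mul_nonneg hy2 hsw) (ht3))
      + (mul_nonneg (mul_nonneg hy3 hw2) (hst))
      + (mul_nonneg (mul_nonneg hsy hw1) (ht3))
      + (mul_nonneg (mul_nonneg hsy hw2) (ht1))
      + (mul_nonneg (mul_nonneg hsy hw2) (ht3)))
    + (4 : ℝ) * ((mul_nonneg (mul_nonneg hy1 hsw) (hst))
      + (mul_nonneg (mul_nonneg hsy hw2) (hst))
      + (mul_nonneg (mul_nonneg hsy hsw) (ht3))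
      + (mul_nonneg (mul_nonneg hsy hsw) (hst)))
    + (1 : ℝ) * ((mul_nonneg (mul_nonneg hy2 hw1) (hst))
      + (mul_nonneg (mul_nonneg hy2 hw3) (hst))
      + (mul_nonneg (mul_nonneg hy2 hsw) (ht1))
      + (mul_nonneg (mul_nonneg hy3 hw1) (hst))
      + (mul_nonneg (mul_nonneg hy3 hsw) (ht1))
      + (mul_nonneg (mul_nonneg hy3 hsw) (ht2))
      + (mul_nonneg (mul_nonneg hsy hw1) (ht2))
      + (mul_nonneg (mul_nonneg hsy hw3) (ht1))
      + (mul_nonneg (mul_nonneg hsy hw3) (ht2)))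

lemma ineq_two_upper (y1 y2 y3 w1 w2 w3 t1 t2 t3 : ℝ)
    (hy1 : 0 ≤ y1)
    (hy2 : 0 ≤ y2)
    (hy3 : 0 ≤ y3)
    (hw1 : 0 ≤ w1)
    (hw2 : 0 ≤ w2)
    (hw3 : 0 ≤ w3)
    (ht1 : 0 ≤ t1)
    (ht2 : 0 ≤ t2)
    (ht3 : 0 ≤ t3)
    (hsy : 0 ≤ 1 - y1 - y2 - y3)
    (hsw : 0 ≤ 1 - w1 - w2 - w3)
    (hst : 0 ≤ 1 - t1 - t2 - t3) :
    (-((1-y1)*(1-w2)*(1-t3)) + (1-y1)*(1-w3)*(1-t2) + (1-w2)*(1-y3)*(1-t1) + (1-t3)*(1-y2)*(1-w1) + (1-y2)*(1-w3)*(1-t1) + (1-y3)*(1-w1)*(1-t2)) ≤ 4 := by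
  linear_combination
    (4 : ℝ) * ((mul_nonneg (mul_nonneg hy1 hw1) (ht1))
      + (mul_nonneg (mul_nonneg hy2 hw1) (ht1))
      + (mul_nonneg (mul_nonneg hy2 hw1) (ht2))
      + (mul_nonneg (mul_nonneg hy2 hw2) (ht2))
      + (mul_nonneg (mul_nonneg hy2 hw3) (ht1))
      + (mul_nonneg (mul_nonneg hy2 hw3) (ht2))
      + (mul_nonneg (mul_nonneg hy2 hsw) (ht2))
      + (mul_nonneg (mul_nonneg hy3 hw1) (ht1))
      + (mul_nonneg (mul_nonneg hy3 hw1) (ht2))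
      + (mul_nonneg (mul_nonneg hy3 hw3) (ht1))
      + (mul_nonneg (mul_nonneg hy3 hw3) (ht2))
      + (mul_nonneg (mul_nonneg hy3 hw3) (ht3))
      + (mul_nonneg (mul_nonneg hy3 hw3) (hst))
      + (mul_nonneg (mul_nonneg hsy hw1) (ht1)))
    + (2 : ℝ) * ((mul_nonneg (mul_nonneg hy1 hw1) (ht2))
      + (mul_nonneg (mul_nonneg hy1 hw1) (ht3))
      + (mul_nonneg (mul_nonneg hy1 hw1) (hst))
      + (mul_nonneg (mul_nonneg hy1 hw2) (ht1))
      + (mul_nonneg (mul_nonneg hy1 hw2) (ht2))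
      + (mul_nonneg (mul_nonneg hy1 hw2) (ht3))
      + (mul_nonneg (mul_nonneg hy1 hw3) (ht1))
      + (mul_nonneg (mul_nonneg hy1 hw3) (ht2))
      + (mul_nonneg (mul_nonneg hy1 hw3) (ht3))
      + (mul_nonneg (mul_nonneg hy1 hsw) (ht1))
      + (mul_nonneg (mul_nonneg hy2 hw1) (ht3))
      + (mul_nonneg (mul_nonneg hy2 hw2) (ht1))
      + (mul_nonneg (mul_nonneg hy2 hw2) (ht3))
      + (mul_nonneg (mul_nonneg hy2 hw2) (hst))
      + (mul_nonneg (mul_nonneg hy2 hw3) (ht3))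
      + (mul_nonneg (mul_nonneg hy2 hsw) (hst))
      + (mul_nonneg (mul_nonneg hy3 hw1) (ht3))
      + (mul_nonneg (mul_nonneg hy3 hw2) (ht1))
      + (mul_nonneg (mul_nonneg hy3 hw2) (ht2))
      + (mul_nonneg (mul_nonneg hy3 hw2) (ht3))
      + (mul_nonneg (mul_nonneg hy3 hsw) (ht3))
      + (mul_nonneg (mul_nonneg hy3 hsw) (hst))
      + (mul_nonneg (mul_nonneg hsy hw1) (hst))
      + (mul_nonneg (mul_nonneg hsy hw2) (ht2))
      + (mul_nonneg (mul_nonneg hsy hw3) (ht3))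
      + (mul_nonneg (mul_nonneg hsy hw3) (hst))
      + (mul_nonneg (mul_nonneg hsy hsw) (ht1))
      + (mul_nonneg (mul_nonneg hsy hsw) (ht2)))
    + (1 : ℝ) * ((mul_nonneg (mul_nonneg hy1 hw2) (hst))
      + (mul_nonneg (mul_nonneg hy1 hw3) (hst))
      + (mul_nonneg (mul_nonneg hy1 hsw) (ht2))
      + (mul_nonneg (mul_nonneg hy1 hsw) (ht3))
      + (mul_nonneg (mul_nonneg hy2 hsw) (ht3))
      + (mul_nonneg (mul_nonneg hy3 hw2) (hst))
      + (mul_nonneg (mul_nonneg hsy hw1) (ht3))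
      + (mul_nonneg (mul_nonneg hsy hw2) (ht1))
      + (mul_nonneg (mul_nonneg hsy hw2) (ht3)))
    + (3 : ℝ) * ((mul_nonneg (mul_nonneg hy2 hw1) (hst))
      + (mul_nonneg (mul_nonneg hy2 hw3) (hst))
      + (mul_nonneg (mul_nonneg hy2 hsw) (ht1))
      + (mul_nonneg (mul_nonneg hy3 hw1) (hst))
      + (mul_nonneg (mul_nonneg hy3 hsw) (ht1))
      + (mul_nonneg (mul_nonneg hy3 hsw) (ht2))
      + (mul_nonneg (mul_nonneg hsy hw1) (ht2))
      + (mul_nonneg (mul_nonneg hsy hw3) (ht1))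
      + (mul_nonneg (mul_nonneg hsy hw3) (ht2)))

lemma ineq_four (y1 y2 y3 w1 w2 w3 t1 t2 t3 : ℝ)
    (hy1 : 0 ≤ y1)
    (hy2 : 0 ≤ y2)
    (hy3 : 0 ≤ y3)
    (hw1 : 0 ≤ w1)
    (hw2 : 0 ≤ w2)
    (hw3 : 0 ≤ w3)
    (ht1 : 0 ≤ t1)
    (ht2 : 0 ≤ t2)
    (ht3 : 0 ≤ t3)
    (hr0 : 0 ≤ 1 - y1 - y2 - y3)
    (hr1 : 0 ≤ 1 - w1 - w2 - w3)
    (hr2 : 0 ≤ 1 - t1 - t2 - t3)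
    (hc0 : 0 ≤ 1 - y1 - w1 - t1)
    (hc1 : 0 ≤ 1 - y2 - w2 - t2)
    (hc2 : 0 ≤ 1 - y3 - w3 - t3)
    (hk : 0 ≤ y1 + w2 + t3 - (y2 + y3 + w1 + w3 + t1 + t2) - 1) :
    y1 * y2 * y3 + w1 * w2 * w3 + t1 * t2 * t3 ≤ 1 / 18 := by
  linear_combination
    (868129/325771728 : ℝ) * ((mul_nonneg (mul_nonneg hc0 ht2) (ht3))
      + (mul_nonneg (mul_nonneg hc0 hw2) (hw3))
      + (mul_nonneg (mul_nonneg hc1 ht1) (ht3))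
      + (mul_nonneg (mul_nonneg hc1 hy1) (hy3))
      + (mul_nonneg (mul_nonneg hc2 hw1) (hw2))
      + (mul_nonneg (mul_nonneg hc2 hy1) (hy2)))
    + (4124363/1628858640 : ℝ) * ((mul_nonneg (mul_nonneg hc0 hk) (hr0))
      + (mul_nonneg (mul_nonneg hc1 hk) (hr1))
      + (mul_nonneg (mul_nonneg hc2 hk) (hr2)))
    + (1129789/162885864 : ℝ) * ((mul_nonneg (mul_nonneg hr0 ht1) (hw1))
      + (mul_nonneg (mul_nonneg hr1 ht2) (hy2))
      + (mul_nonneg (mul_nonneg hr2 hw3) (hy3)))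
    + (22722941/1303086912 : ℝ) * ((mul_nonneg (mul_nonneg hc0 hy1) (hy1))
      + (mul_nonneg (mul_nonneg hc1 hw2) (hw2))
      + (mul_nonneg (mul_nonneg hc2 ht3) (ht3)))
    + (11863091/651543456 : ℝ) * ((mul_nonneg (mul_nonneg hr0 hr1) (hr2)))
    + (18110021/6515434560 : ℝ) * ((mul_nonneg (mul_nonneg hc0 hk) (ht1))
      + (mul_nonneg (mul_nonneg hc0 hk) (hw1))
      + (mul_nonneg (mul_nonneg hc1 hk) (ht2))
      + (mul_nonneg (mul_nonneg hc1 hk) (hy2))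
      + (mul_nonneg (mul_nonneg hc2 hk) (hw3))
      + (mul_nonneg (mul_nonneg hc2 hk) (hy3)))
    + (9915157/1303086912 : ℝ) * ((mul_nonneg ht1 (sq_nonneg (y2 + (-1)*y3 + w1 + (-1)*w3)))
      + (mul_nonneg ht2 (sq_nonneg (y2 + (-1)*y3 + w1 + (-1)*w3)))
      + (mul_nonneg hw1 (sq_nonneg (y2 + (-1)*y3 + (-1)*t1 + t2)))
      + (mul_nonneg hw3 (sq_nonneg (y2 + (-1)*y3 + (-1)*t1 + t2)))
      + (mul_nonneg hy2 (sq_nonneg (w1 + (-1)*w3 + t1 + (-1)*t2)))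
      + (mul_nonneg hy3 (sq_nonneg (w1 + (-1)*w3 + t1 + (-1)*t2))))
    + (4977643/3257717280 : ℝ) * ((mul_nonneg (mul_nonneg hk hr0) (hr1))
      + (mul_nonneg (mul_nonneg hk hr0) (hr2))
      + (mul_nonneg (mul_nonneg hk hr1) (hr2)))
    + (2072297/1085905760 : ℝ) * ((mul_nonneg hk hk))
    + (176991/13573822 : ℝ) * ((mul_nonneg hc0 hc1)
      + (mul_nonneg hc0 hc2)
      + (mul_nonneg hc1 hc2))
    + (884643/1085905760 : ℝ) * ((mul_nonneg hk (sq_nonneg (y2 + (-1)*y3 + (-1)*w1 + w3 + t1 + (-1)*t2))))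
    + (2253223/54295288 : ℝ) * ((mul_nonneg (mul_nonneg hc0 ht2) (hy1))
      + (mul_nonneg (mul_nonneg hc0 hw3) (hy1))
      + (mul_nonneg (mul_nonneg hc1 ht1) (hw2))
      + (mul_nonneg (mul_nonneg hc1 hw2) (hy3))
      + (mul_nonneg (mul_nonneg hc2 ht3) (hw1))
      + (mul_nonneg (mul_nonneg hc2 ht3) (hy2)))
    + (56598251/1628858640 : ℝ) * ((mul_nonneg (mul_nonneg hk ht1) (ht3))
      + (mul_nonneg (mul_nonneg hk ht2) (ht3))
      + (mul_nonneg (mul_nonneg hk hw1) (hw2))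
      + (mul_nonneg (mul_nonneg hk hw2) (hw3))
      + (mul_nonneg (mul_nonneg hk hy1) (hy2))
      + (mul_nonneg (mul_nonneg hk hy1) (hy3)))
    + (236699/325771728 : ℝ) * ((mul_nonneg (mul_nonneg hc0 hr0) (hr1))
      + (mul_nonneg (mul_nonneg hc0 hr0) (hr2))
      + (mul_nonneg (mul_nonneg hc1 hr0) (hr1))
      + (mul_nonneg (mul_nonneg hc1 hr1) (hr2))
      + (mul_nonneg (mul_nonneg hc2 hr0) (hr2))
      + (mul_nonneg (mul_nonneg hc2 hr1) (hr2)))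
    + (638993/54295288 : ℝ) * ((mul_nonneg (mul_nonneg hr0 hr1) (ht3))
      + (mul_nonneg (mul_nonneg hr0 hr2) (hw2))
      + (mul_nonneg (mul_nonneg hr1 hr2) (hy1)))
    + (1607689/325771728 : ℝ) * ((mul_nonneg (mul_nonneg hc0 ht1) (hw1))
      + (mul_nonneg (mul_nonneg hc1 ht2) (hy2))
      + (mul_nonneg (mul_nonneg hc2 hw3) (hy3)))
    + (11582929/1628858640 : ℝ) * ((mul_nonneg (mul_nonneg hk ht1) (hw1))
      + (mul_nonneg (mul_nonneg hk ht2) (hy2))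
      + (mul_nonneg (mul_nonneg hk hw3) (hy3)))
    + (21805/13573822 : ℝ) * ((mul_nonneg (mul_nonneg hc0 ht1) (hy2))
      + (mul_nonneg (mul_nonneg hc0 hw1) (hy3))
      + (mul_nonneg (mul_nonneg hc1 ht2) (hw1))
      + (mul_nonneg (mul_nonneg hc1 hw3) (hy2))
      + (mul_nonneg (mul_nonneg hc2 ht1) (hw3))
      + (mul_nonneg (mul_nonneg hc2 ht2) (hy3)))
    + (24961/162885864 : ℝ) * ((mul_nonneg (mul_nonneg hc0 hc1) (ht1))
      + (mul_nonneg (mul_nonneg hc0 hc1) (ht2))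
      + (mul_nonneg (mul_nonneg hc0 hc2) (hw1))
      + (mul_nonneg (mul_nonneg hc0 hc2) (hw3))
      + (mul_nonneg (mul_nonneg hc1 hc2) (hy2))
      + (mul_nonneg (mul_nonneg hc1 hc2) (hy3)))
    + (107393/217181152 : ℝ) * ((mul_nonneg (mul_nonneg hc0 hc0) (hc0))
      + (mul_nonneg (mul_nonneg hc1 hc1) (hc1))
      + (mul_nonneg (mul_nonneg hc2 hc2) (hc2)))
    + (452221/651543456 : ℝ) * ((mul_nonneg (mul_nonneg hc0 hc1) (hc2)))
    + (236699/434362304 : ℝ) * ((mul_nonneg ht1 (sq_nonneg (y2 + (-1)*y3 + w1 + (-1)*w3 + t1 + (-1)*t2)))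
      + (mul_nonneg ht2 (sq_nonneg (y2 + (-1)*y3 + w1 + (-1)*w3 + (-1)*t1 + t2)))
      + (mul_nonneg hw1 (sq_nonneg (y2 + (-1)*y3 + (-1)*w1 + w3 + (-1)*t1 + t2)))
      + (mul_nonneg hw3 (sq_nonneg (y2 + (-1)*y3 + w1 + (-1)*w3 + (-1)*t1 + t2)))
      + (mul_nonneg hy2 (sq_nonneg (y2 + (-1)*y3 + (-1)*w1 + w3 + (-1)*t1 + t2)))
      + (mul_nonneg hy3 (sq_nonneg (y2 + (-1)*y3 + w1 + (-1)*w3 + t1 + (-1)*t2))))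
    + (1940359/108590576 : ℝ) * ((mul_nonneg ht1 (sq_nonneg (w2 + (-1)*t3)))
      + (mul_nonneg ht2 (sq_nonneg (y1 + (-1)*t3)))
      + (mul_nonneg hw1 (sq_nonneg (w2 + (-1)*t3)))
      + (mul_nonneg hw3 (sq_nonneg (y1 + (-1)*w2)))
      + (mul_nonneg hy2 (sq_nonneg (y1 + (-1)*t3)))
      + (mul_nonneg hy3 (sq_nonneg (y1 + (-1)*w2))))
    + (206525357/977315184 : ℝ) * ((mul_nonneg (mul_nonneg hr0 hy2) (hy3))
      + (mul_nonneg (mul_nonneg hr1 hw1) (hw3))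
      + (mul_nonneg (mul_nonneg hr2 ht1) (ht2)))
    + (1053019/1303086912 : ℝ) * ((mul_nonneg ht1 (sq_nonneg (y1 + (-4)*t1)))
      + (mul_nonneg ht2 (sq_nonneg (w2 + (-4)*t2)))
      + (mul_nonneg hw1 (sq_nonneg (y1 + (-4)*w1)))
      + (mul_nonneg hw3 (sq_nonneg ((4)*w3 + (-1)*t3)))
      + (mul_nonneg hy2 (sq_nonneg ((4)*y2 + (-1)*w2)))
      + (mul_nonneg hy3 (sq_nonneg ((4)*y3 + (-1)*t3))))
    + (9623767/651543456 : ℝ) * ((mul_nonneg ht1 (sq_nonneg (y1 + (-1)*t3)))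
      + (mul_nonneg ht2 (sq_nonneg (w2 + (-1)*t3)))
      + (mul_nonneg hw1 (sq_nonneg (y1 + (-1)*w2)))
      + (mul_nonneg hw3 (sq_nonneg (w2 + (-1)*t3)))
      + (mul_nonneg hy2 (sq_nonneg (y1 + (-1)*w2)))
      + (mul_nonneg hy3 (sq_nonneg (y1 + (-1)*t3))))
    + (34340807/11727782208 : ℝ) * ((sq_nonneg (y2 + (-1)*y3 + (-1)*t1 + t2))
      + (sq_nonneg (y2 + (-1)*y3 + w1 + (-1)*w3))
      + (sq_nonneg (w1 + (-1)*w3 + t1 + (-1)*t2)))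
    + (6476791/651543456 : ℝ) * ((sq_nonneg (y2 + (-1)*y3 + (-1)*w3 + t2))
      + (sq_nonneg (y2 + (-1)*w1 + (-1)*t1 + t2))
      + (sq_nonneg (y3 + (-1)*w1 + w3 + (-1)*t1)))
    + (217591625/11727782208 : ℝ) * ((sq_nonneg (y2 + (-1)*y3 + (-1)*w1 + w3 + t1 + (-1)*t2)))
    + (27170365/488657592 : ℝ) * ((mul_nonneg (mul_nonneg hr0 hy1) (hy2))
      + (mul_nonneg (mul_nonneg hr0 hy1) (hy3))
      + (mul_nonneg (mul_nonneg hr1 hw1) (hw2))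
      + (mul_nonneg (mul_nonneg hr1 hw2) (hw3))
      + (mul_nonneg (mul_nonneg hr2 ht1) (ht3))
      + (mul_nonneg (mul_nonneg hr2 ht2) (ht3)))
    + (519937961/3909260736 : ℝ) * ((mul_nonneg ht3 (sq_nonneg (t1 + (-1)*t2)))
      + (mul_nonneg hw2 (sq_nonneg (w1 + (-1)*w3)))
      + (mul_nonneg hy1 (sq_nonneg (y2 + (-1)*y3))))
    + (6447133/325771728 : ℝ) * ((mul_nonneg (mul_nonneg hc0 hr0) (hy1))
      + (mul_nonneg (mul_nonneg hc1 hr1) (hw2))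
      + (mul_nonneg (mul_nonneg hc2 hr2) (ht3)))
    + (18023875/1303086912 : ℝ) * ((mul_nonneg (mul_nonneg hr0 hr0) (hr0))
      + (mul_nonneg (mul_nonneg hr1 hr1) (hr1))
      + (mul_nonneg (mul_nonneg hr2 hr2) (hr2)))
    + (61803263/3909260736 : ℝ) * ((mul_nonneg ht1 (sq_nonneg ((4)*t2 + (-1)*t3)))
      + (mul_nonneg ht2 (sq_nonneg ((4)*t1 + (-1)*t3)))
      + (mul_nonneg hw1 (sq_nonneg (w2 + (-4)*w3)))
      + (mul_nonneg hw3 (sq_nonneg ((4)*w1 + (-1)*w2)))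
      + (mul_nonneg hy2 (sq_nonneg (y1 + (-4)*y3)))
      + (mul_nonneg hy3 (sq_nonneg (y1 + (-4)*y2))))
    + (350060383/19546303680 : ℝ) * (hk)
    + (2071369/9773151840 : ℝ) * ((mul_nonneg hk (sq_nonneg ((3)*y1 + (-2))))
      + (mul_nonneg hk (sq_nonneg ((3)*w2 + (-2))))
      + (mul_nonneg hk (sq_nonneg ((3)*t3 + (-2)))))
    + (194886757/1954630368 : ℝ) * ((mul_nonneg hr0 hy2)
      + (mul_nonneg hr0 hy3)
      + (mul_nonneg hr1 hw1)
      + (mul_nonneg hr1 hw3)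
      + (mul_nonneg hr2 ht1)
      + (mul_nonneg hr2 ht2))
    + (10180601/325771728 : ℝ) * ((mul_nonneg (mul_nonneg hc0 hr0) (ht2))
      + (mul_nonneg (mul_nonneg hc0 hr0) (hw3))
      + (mul_nonneg (mul_nonneg hc1 hr1) (ht1))
      + (mul_nonneg (mul_nonneg hc1 hr1) (hy3))
      + (mul_nonneg (mul_nonneg hc2 hr2) (hw1))
      + (mul_nonneg (mul_nonneg hc2 hr2) (hy2)))
    + (18635327/2171811520 : ℝ) * ((mul_nonneg (mul_nonneg hc0 hk) (hy1))
      + (mul_nonneg (mul_nonneg hc1 hk) (hw2))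
      + (mul_nonneg (mul_nonneg hc2 hk) (ht3)))
    + (13004863/2171811520 : ℝ) * ((mul_nonneg hk hr0)
      + (mul_nonneg hk hr1)
      + (mul_nonneg hk hr2))
    + (1255037/1954630368 : ℝ) * ((mul_nonneg ht3 (sq_nonneg ((3)*t3 + (-2))))
      + (mul_nonneg hw2 (sq_nonneg ((3)*w2 + (-2))))
      + (mul_nonneg hy1 (sq_nonneg ((3)*y1 + (-2)))))
    + (7253003/6515434560 : ℝ) * ((mul_nonneg (mul_nonneg hk hk) (hk)))
    + (5007451/1085905760 : ℝ) * ((mul_nonneg hk (sq_nonneg (y1 + (-1)*w2)))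
      + (mul_nonneg hk (sq_nonneg (y1 + (-1)*t3)))
      + (mul_nonneg hk (sq_nonneg (w2 + (-1)*t3))))

lemma ineq_five (y1 y2 y3 w1 w2 w3 t1 t2 t3 : ℝ)
    (hy1 : 0 ≤ y1)
    (hy2 : 0 ≤ y2)
    (hy3 : 0 ≤ y3)
    (hw1 : 0 ≤ w1)
    (hw2 : 0 ≤ w2)
    (hw3 : 0 ≤ w3)
    (ht1 : 0 ≤ t1)
    (ht2 : 0 ≤ t2)
    (ht3 : 0 ≤ t3)
    (hx1 : 0 ≤ w1 + t1 - y1)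
    (hx2 : 0 ≤ y2 + t2 - w2)
    (hx3 : 0 ≤ y3 + w3 - t3)
    (hsx : 0 ≤ 1 - (w1 + t1 - y1) - (y2 + t2 - w2) - (y3 + w3 - t3))
    (hsy : 0 ≤ 1 - y1 - y2 - y3)
    (hsw : 0 ≤ 1 - w1 - w2 - w3)
    (hst : 0 ≤ 1 - t1 - t2 - t3)
    (hp1 : 0 ≤ 1 - w1 - t1)
    (hp2 : 0 ≤ 1 - y2 - t2)
    (hp3 : 0 ≤ 1 - y3 - w3) :
    1 ≤ (-((1-y1)*(1-w2)*(1-t3)) + (1-y1)*(1-w3)*(1-t2) + (1-w2)*(1-y3)*(1-t1) + (1-t3)*(1-y2)*(1-w1) + (1-y2)*(1-w3)*(1-t1) + (1-y3)*(1-w1)*(1-t2)) := by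
  linear_combination
    (1 : ℝ) * ((mul_nonneg (mul_nonneg hp1 hp2) (hp3)))
    + (1 : ℝ) * ((mul_nonneg (mul_nonneg ht1 hx2) (hy3))
      + (mul_nonneg (mul_nonneg ht2 hw3) (hx1))
      + (mul_nonneg (mul_nonneg ht3 hw2) (hy1))
      + (mul_nonneg (mul_nonneg hw1 hx3) (hy2)))
    + (1/16 : ℝ) * ((sq_nonneg (t2 + y1 - t1 - w2))
      + (sq_nonneg (t3 + (w1+t1-y1) - t1 - w3))
      + (sq_nonneg ((w1+t1-y1) + y3 - t1 - (y3+w3-t3)))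
      + (sq_nonneg ((y2+t2-w2) + y1 - t1 - y2))
      + (sq_nonneg (t3 + (y2+t2-w2) - t2 - y3))
      + (sq_nonneg (w2 + (w1+t1-y1) - t2 - w1))
      + (sq_nonneg (w3 + (y2+t2-w2) - t2 - (y3+w3-t3)))
      + (sq_nonneg (w3 + y1 - t3 - w1))
      + (sq_nonneg (w2 + y3 - t3 - y2))
      + (sq_nonneg ((w1+t1-y1) + y2 - w1 - (y2+t2-w2)))
      + (sq_nonneg ((y3+w3-t3) + y1 - w1 - y3))
      + (sq_nonneg (w3 + y2 - w2 - (y3+w3-t3))))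
    + (3/16 : ℝ) * ((mul_nonneg ht1 hst)
      + (mul_nonneg ht2 hst)
      + (mul_nonneg ht3 hst)
      + (mul_nonneg hw1 hsw)
      + (mul_nonneg hw2 hsw)
      + (mul_nonneg hw3 hsw)
      + (mul_nonneg hx1 hsx)
      + (mul_nonneg hx2 hsx)
      + (mul_nonneg hx3 hsx)
      + (mul_nonneg hy1 hsy)
      + (mul_nonneg hy2 hsy)
      + (mul_nonneg hy3 hsy))
    + (1/8 : ℝ) * ((mul_nonneg hst hsw)
      + (mul_nonneg hst hsx)
      + (mul_nonneg hst hsy)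
      + (mul_nonneg hsw hsx)
      + (mul_nonneg hsw hsy)
      + (mul_nonneg hsx hsy))
    + (5/16 : ℝ) * (hst
      + hsw
      + hsx
      + hsy)

lemma ineq_six (y1 y2 y3 w1 w2 w3 t1 t2 t3 : ℝ)
    (hy1 : 0 ≤ y1)
    (hy2 : 0 ≤ y2)
    (hy3 : 0 ≤ y3)
    (hw1 : 0 ≤ w1)
    (hw2 : 0 ≤ w2)
    (hw3 : 0 ≤ w3)
    (ht1 : 0 ≤ t1)
    (ht2 : 0 ≤ t2)
    (ht3 : 0 ≤ t3)
    (hsy : 0 ≤ 1 - y1 - y2 - y3)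
    (hsw : 0 ≤ 1 - w1 - w2 - w3)
    (hst : 0 ≤ 1 - t1 - t2 - t3)
    (hp2 : 0 ≤ 1 - y2 - t2)
    (hp3 : 0 ≤ 1 - y3 - w3)
    (hk : 0 ≤ y1 - w1 - t1) :
    49 / 54 + 1 / 100 + 20 * (y1 * y2 * y3 + w1 * w2 * w3 + t1 * t2 * t3 - 5 / 54)
      ≤ (-((1-y1)*(1-w2)*(1-t3)) + (1-y1)*(1-w3)*(1-t2) + (1-w2)*(1-y3)*(1-t1) + (1-t3)*(1-y2)*(1-w1) + (1-y2)*(1-w3)*(1-t1) + (1-y3)*(1-w1)*(1-t2)) := by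
  linear_combination
    (879383473014913/8882662354251350 : ℝ) * ((mul_nonneg (mul_nonneg hsy hw1) (hw2))
      + (mul_nonneg (mul_nonneg hsy ht1) (ht3)))
    + (114227613244737/1776532470850270 : ℝ) * ((mul_nonneg (mul_nonneg hsy hsw) (hst)))
    + (1479169134447299/17765324708502700 : ℝ) * ((mul_nonneg hk (sq_nonneg (y2+t2-y3-w3))))
    + (169138791546665039/106591948251016200 : ℝ) * ((mul_nonneg hw1 (sq_nonneg (w2-w3)))
      + (mul_nonneg ht1 (sq_nonneg (t3-t2))))
    + (92738664682228/13323993531377025 : ℝ) * ((mul_nonneg hy2 (sq_nonneg (3*w2-1)))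
      + (mul_nonneg hy3 (sq_nonneg (3*t3-1))))
    + (692941287747258/4441331177125675 : ℝ) * ((mul_nonneg (mul_nonneg hw2 hp2) (hp3))
      + (mul_nonneg (mul_nonneg ht3 hp3) (hp2)))
    + (36717399248363/2131838965020324 : ℝ) * ((mul_nonneg hw3 (sq_nonneg (3*y1-1)))
      + (mul_nonneg ht2 (sq_nonneg (3*y1-1))))
    + (74407730747979/4441331177125675 : ℝ) * ((mul_nonneg hst (sq_nonneg (5*w3-2)))
      + (mul_nonneg hsw (sq_nonneg (5*t2-2))))
    + (56675627940485/177653247085027 : ℝ) * ((mul_nonneg hw3 (sq_nonneg (y2-w2)))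
      + (mul_nonneg ht2 (sq_nonneg (y3-t3))))
    + (5488597003054598/13323993531377025 : ℝ) * ((mul_nonneg hy2 ht3)
      + (mul_nonneg hy3 hw2))
    + (198112173624142/177653247085027 : ℝ) * ((mul_nonneg hsw hst))
    + (167740680526927/3553064941700540 : ℝ) * ((mul_nonneg hsw (sq_nonneg (w3-2*w2)))
      + (mul_nonneg hst (sq_nonneg (t2-2*t3))))
    + (92661000160921/8882662354251350 : ℝ) * ((mul_nonneg (mul_nonneg hw2 hw3) (hp2))
      + (mul_nonneg (mul_nonneg ht3 ht2) (hp3)))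
    + (3099678573176897/8882662354251350 : ℝ) * ((mul_nonneg (mul_nonneg hsy hw1) (ht3))
      + (mul_nonneg (mul_nonneg hsy ht1) (hw2)))
    + (228506819672/634475882446525 : ℝ) * ((mul_nonneg hy3 (sq_nonneg (w1-w2)))
      + (mul_nonneg hy2 (sq_nonneg (t1-t3))))
    + (558989773027816/4441331177125675 : ℝ) * ((mul_nonneg ht2 (sq_nonneg (w1-w2)))
      + (mul_nonneg hw3 (sq_nonneg (t1-t3))))
    + (839450772613017/4441331177125675 : ℝ) * ((mul_nonneg hw2 (sq_nonneg (y2-t2-y3+w3)))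
      + (mul_nonneg ht3 (sq_nonneg (y3-w3-y2+t2))))
    + (56293047419537/8882662354251350 : ℝ) * ((mul_nonneg hy2 (sq_nonneg (5*w3-2)))
      + (mul_nonneg hy3 (sq_nonneg (5*t2-2))))
    + (41120762872026/177653247085027 : ℝ) * ((mul_nonneg (mul_nonneg hy2 hsy) (ht1))
      + (mul_nonneg (mul_nonneg hy3 hsy) (hw1)))
    + (3645731632385249/7613710589358300 : ℝ) * ((mul_nonneg (mul_nonneg hy2 hsy) (hp2))
      + (mul_nonneg (mul_nonneg hy3 hsy) (hp3)))
    + (173747289321199/8882662354251350 : ℝ) * ((mul_nonneg (mul_nonneg hw3 hp2) (hp3))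
      + (mul_nonneg (mul_nonneg ht2 hp3) (hp2)))
    + (1182488677215059/79943961188262150 : ℝ) * ((mul_nonneg hp3 (sq_nonneg (3*w3-1)))
      + (mul_nonneg hp2 (sq_nonneg (3*t2-1))))
    + (99056086812071/177653247085027 : ℝ) * ((mul_nonneg hw1 hk)
      + (mul_nonneg ht1 hk))
    + (1876201037361674/39971980594131075 : ℝ) * ((mul_nonneg hw2 (sq_nonneg (3*w3-1)))
      + (mul_nonneg ht3 (sq_nonneg (3*t2-1))))
    + (43154632112962453/26647987062754050 : ℝ) * ((mul_nonneg (mul_nonneg hw1 hw3) (hsw))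
      + (mul_nonneg (mul_nonneg ht1 ht2) (hst)))
    + (21832238784988318/39971980594131075 : ℝ) * ((mul_nonneg hy3 (sq_nonneg (3*y2-1)))
      + (mul_nonneg hy2 (sq_nonneg (3*y3-1))))
    + (235538961989365603/319775844753048600 : ℝ) * ((mul_nonneg hw1 (sq_nonneg (3*w2-1)))
      + (mul_nonneg ht1 (sq_nonneg (3*t3-1))))
    + (122811427456097/1268951764893050 : ℝ) * ((mul_nonneg (mul_nonneg hy2 ht1) (hp2))
      + (mul_nonneg (mul_nonneg hy3 hw1) (hp3)))
    + (170044255992614293/532959741255081000 : ℝ) * ((mul_nonneg hw2 (sq_nonneg (5*w1-1)))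
      + (mul_nonneg ht3 (sq_nonneg (5*t1-1))))
    + (3714502667766701/17765324708502700 : ℝ) * ((mul_nonneg hy1 (sq_nonneg (y2-t2-y3+w3))))
    + (25732831320402103/532959741255081000 : ℝ) * ((mul_nonneg hw2 (sq_nonneg (5*w3-2)))
      + (mul_nonneg ht3 (sq_nonneg (5*t2-2))))
    + (11186962201751731/10659194825101620 : ℝ) * ((mul_nonneg hy2 hsy)
      + (mul_nonneg hy3 hsy))
    + (144682966985237/35530649417005400 : ℝ) * ((mul_nonneg ht2 (sq_nonneg (6*w1-1)))
      + (mul_nonneg hw3 (sq_nonneg (6*t1-1))))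
    + (1577414908493469/3553064941700540 : ℝ) * ((mul_nonneg hsy hk))
    + (560487408587951/4441331177125675 : ℝ) * ((mul_nonneg (mul_nonneg hw2 hw2) (ht3))
      + (mul_nonneg (mul_nonneg ht3 ht3) (hw2)))
    + (513209762031473/79943961188262150 : ℝ) * ((mul_nonneg hy3 (sq_nonneg (6*w1-1)))
      + (mul_nonneg hy2 (sq_nonneg (6*t1-1))))
    + (477514920451129/35530649417005400 : ℝ) * ((mul_nonneg hy3 (sq_nonneg (2*w1-y1)))
      + (mul_nonneg hy2 (sq_nonneg (2*t1-y1))))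
    + (4033190546841881/15227421178716600 : ℝ) * ((mul_nonneg hw2 (sq_nonneg (w1-w3)))
      + (mul_nonneg ht3 (sq_nonneg (t1-t2))))
    + (1682016281741673/4441331177125675 : ℝ) * ((mul_nonneg (mul_nonneg hw2 hsw) (ht2))
      + (mul_nonneg (mul_nonneg ht3 hst) (hw3)))
    + (2533553064052429/35530649417005400 : ℝ) * ((mul_nonneg hp3 (sq_nonneg (2*w1-y1)))
      + (mul_nonneg hp2 (sq_nonneg (2*t1-y1))))
    + (58747058579647/3553064941700540 : ℝ) * ((mul_nonneg (mul_nonneg hy2 hsy) (hk))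
      + (mul_nonneg (mul_nonneg hy3 hsy) (hk)))
    + (62498026546/634475882446525 : ℝ) * ((mul_nonneg (mul_nonneg hw1 hsw) (ht2))
      + (mul_nonneg (mul_nonneg ht1 hst) (hw3)))
    + (36340433325446191/53295974125508100 : ℝ) * ((mul_nonneg hy1 (sq_nonneg (y2-y3))))
    + (1 : ℝ) * ((mul_nonneg (mul_nonneg hy2 hsw) (ht3))
      + (mul_nonneg (mul_nonneg hy3 hst) (hw2)))
    + (132266912632513/253790352978610 : ℝ) * ((mul_nonneg ht1 (sq_nonneg (y2-w3)))
      + (mul_nonneg hw1 (sq_nonneg (y3-t2))))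
    + (2419251276551121/35530649417005400 : ℝ) * ((mul_nonneg hp2 (sq_nonneg (2*w1-y1)))
      + (mul_nonneg hp3 (sq_nonneg (2*t1-y1))))
    + (21137216721641131/159887922376524300 : ℝ) * ((mul_nonneg hy1 (sq_nonneg (3*y1-1))))
    + (2101116384491469/8882662354251350 : ℝ) * ((mul_nonneg (mul_nonneg hy1 hw3) (hsw))
      + (mul_nonneg (mul_nonneg hy1 ht2) (hst)))
    + (12108120226780331/53295974125508100 : ℝ) * ((mul_nonneg (mul_nonneg hy2 hsy) (ht2))
      + (mul_nonneg (mul_nonneg hy3 hsy) (hw3)))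
    + (557213323874979/17765324708502700 : ℝ) * ((mul_nonneg ht1 (sq_nonneg (2*y2-w3)))
      + (mul_nonneg hw1 (sq_nonneg (2*y3-t2))))
    + (114227613244737/3553064941700540 : ℝ) * ((mul_nonneg (mul_nonneg hsy hsw) (hsw))
      + (mul_nonneg (mul_nonneg hsy hst) (hst)))
    + (821070767801029/1268951764893050 : ℝ) * ((mul_nonneg (mul_nonneg hw3 hp2) (hk))
      + (mul_nonneg (mul_nonneg ht2 hp3) (hk)))
    + (63287104557466009/319775844753048600 : ℝ) * (hsw
      + hst)
    + (157748663880777/355306494170054 : ℝ) * ((mul_nonneg hsw hp2)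
      + (mul_nonneg hst hp3))
    + (68952041072493/3553064941700540 : ℝ) * ((mul_nonneg hsy (sq_nonneg (3*w3-1)))
      + (mul_nonneg hsy (sq_nonneg (3*t2-1))))
    + (127423998148831/17765324708502700 : ℝ) * ((mul_nonneg hw2 (sq_nonneg (2*y2-w3)))
      + (mul_nonneg ht3 (sq_nonneg (2*y3-t2))))
    + (12691957027193/3553064941700540 : ℝ) * ((mul_nonneg hw1 (sq_nonneg (3*y1-1)))
      + (mul_nonneg ht1 (sq_nonneg (3*y1-1))))
    + (3225031117860607/17765324708502700 : ℝ) * ((mul_nonneg hsy (sq_nonneg (w2-t3))))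
    + (5443446764491/1776532470850270 : ℝ) * ((mul_nonneg hsy (sq_nonneg (w3-2*w2)))
      + (mul_nonneg hsy (sq_nonneg (t2-2*t3))))
    + (490360030805954/888266235425135 : ℝ) * ((mul_nonneg hy1 hsw)
      + (mul_nonneg hy1 hst))
    + (5075529130511974/2664798706275405 : ℝ) * ((mul_nonneg hw3 (sq_nonneg (w1-w2)))
      + (mul_nonneg ht2 (sq_nonneg (t1-t3))))
    + (757830574764533/1065919482510162 : ℝ) * ((mul_nonneg (mul_nonneg hy1 hy1) (hsy)))
    + (4258905872585353/1903427647339575 : ℝ) * ((mul_nonneg hy3 (sq_nonneg (y1-y2)))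
      + (mul_nonneg hy2 (sq_nonneg (y1-y3))))
    + (262201188528613/634475882446525 : ℝ) * ((mul_nonneg (mul_nonneg hsy hw2) (hst))
      + (mul_nonneg (mul_nonneg hsy ht3) (hsw)))
    + (725260769619299/4441331177125675 : ℝ) * ((mul_nonneg (mul_nonneg hsy hw2) (hsw))
      + (mul_nonneg (mul_nonneg hsy ht3) (hst)))
    + (1986814596990161/8882662354251350 : ℝ) * ((mul_nonneg (mul_nonneg hy1 hw3) (hst))
      + (mul_nonneg (mul_nonneg hy1 ht2) (hsw)))
    + (457013639344/634475882446525 : ℝ) * ((mul_nonneg (mul_nonneg hw2 hsw) (hp3))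
      + (mul_nonneg (mul_nonneg ht3 hst) (hp2)))
    + (278215994046684/4441331177125675 : ℝ) * ((mul_nonneg hy1 (sq_nonneg (w2+w3-t2-t3))))
    + (2800433313983127/4441331177125675 : ℝ) * ((mul_nonneg (mul_nonneg hw2 hsw) (hp2))
      + (mul_nonneg (mul_nonneg ht3 hst) (hp3)))
    + (20979536540069/1015161411914440 : ℝ) * ((mul_nonneg hw1 (sq_nonneg (2*y2-w3)))
      + (mul_nonneg ht1 (sq_nonneg (2*y3-t2))))
    + (2419251276551121/35530649417005400 : ℝ) * ((mul_nonneg hy2 (sq_nonneg (2*w1-y1)))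
      + (mul_nonneg hy3 (sq_nonneg (2*t1-y1))))
    + (16259766402348983/13323993531377025 : ℝ) * ((mul_nonneg hy1 hsy))
    + (3102188190092084/4441331177125675 : ℝ) * ((mul_nonneg (mul_nonneg hy2 hw3) (hk))
      + (mul_nonneg (mul_nonneg hy3 ht2) (hk)))
    + (2800433313983127/4441331177125675 : ℝ) * ((mul_nonneg (mul_nonneg hy2 hw2) (hsw))
      + (mul_nonneg (mul_nonneg hy3 ht3) (hst)))
    + (1792182683395813/8882662354251350 : ℝ) * ((mul_nonneg (mul_nonneg hy2 hw2) (hp2))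
      + (mul_nonneg (mul_nonneg hy3 ht3) (hp3)))
    + (109806701723870579/13323993531377025 : ℝ) * ((mul_nonneg (mul_nonneg hw1 hw2) (hsw))
      + (mul_nonneg (mul_nonneg ht1 ht3) (hst)))
    + (114227613244737/3553064941700540 : ℝ) * ((mul_nonneg (mul_nonneg hsy hw1) (hk))
      + (mul_nonneg (mul_nonneg hsy ht1) (hk)))
    + (2692214538896367/8882662354251350 : ℝ) * ((mul_nonneg (mul_nonneg hsy hp2) (hp3)))
    + (756164398872103/17765324708502700 : ℝ) * ((mul_nonneg hst (sq_nonneg (y2-w3)))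
      + (mul_nonneg hsw (sq_nonneg (y3-t2))))
    + (3645731632385249/7613710589358300 : ℝ) * ((mul_nonneg (mul_nonneg hsy hsy) (hsy)))
    + (341093096058259/5329597412550810 : ℝ) * ((mul_nonneg hsw hp3)
      + (mul_nonneg hst hp2))
    + (2899427344918339/17765324708502700 : ℝ) * ((mul_nonneg hsw (sq_nonneg (w3-t2)))
      + (mul_nonneg hst (sq_nonneg (t2-w3))))
    + (3193120909119429/8882662354251350 : ℝ) * ((mul_nonneg (mul_nonneg hw3 hsw) (hp3))
      + (mul_nonneg (mul_nonneg ht2 hst) (hp2)))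
    + (5548055466509/355306494170054 : ℝ) * ((mul_nonneg (mul_nonneg hy1 hp2) (hk))
      + (mul_nonneg (mul_nonneg hy1 hp3) (hk)))
    + (228757930100729/10659194825101620 : ℝ) * ((mul_nonneg hst (sq_nonneg (3*y2-1)))
      + (mul_nonneg hsw (sq_nonneg (3*y3-1))))
    + (534086224090949/90639411778075 : ℝ) * ((mul_nonneg (mul_nonneg hy2 hy3) (hsy)))
    + (167740680526927/888266235425135 : ℝ) * ((mul_nonneg hw2 (sq_nonneg (w2+w3-t2-t3)))
      + (mul_nonneg ht3 (sq_nonneg (t3+t2-w3-w2))))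
    + (46668818338535/177653247085027 : ℝ) * ((mul_nonneg (mul_nonneg hw3 hst) (hp3))
      + (mul_nonneg (mul_nonneg ht2 hsw) (hp2)))
    + (120627628478699/634475882446525 : ℝ) * ((mul_nonneg (mul_nonneg hy2 hy3) (hw2))
      + (mul_nonneg (mul_nonneg hy3 hy2) (ht3)))
    + (1686713012777216/4441331177125675 : ℝ) * ((sq_nonneg (w2+w3-t2-t3)))
    + (6876923366653031/26647987062754050 : ℝ) * (hk)
    + (812055686356491/8882662354251350 : ℝ) * ((mul_nonneg hk (sq_nonneg (w3-t2))))
    + (2853352242429253/53295974125508100 : ℝ) * ((mul_nonneg hw1 (sq_nonneg (w3-2*w2)))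
      + (mul_nonneg ht1 (sq_nonneg (t2-2*t3))))
    + (141566858127883/8882662354251350 : ℝ) * ((mul_nonneg hsw (sq_nonneg (y2+t2-y3-w3)))
      + (mul_nonneg hst (sq_nonneg (y3+w3-y2-t2))))
    + (8889978672588574/4441331177125675 : ℝ) * ((mul_nonneg (mul_nonneg hw3 ht2) (hk)))
    + (278215994046684/4441331177125675 : ℝ) * ((mul_nonneg ht3 (sq_nonneg (y2-w2)))
      + (mul_nonneg hw2 (sq_nonneg (y3-t3))))
    + (20458926539115/177653247085027 : ℝ) * ((mul_nonneg hw2 hst)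
      + (mul_nonneg ht3 hsw))
    + (68354337708393/4441331177125675 : ℝ) * ((mul_nonneg hy3 (sq_nonneg (w3-2*w2)))
      + (mul_nonneg hy2 (sq_nonneg (t2-2*t3))))
    + (34670135450330279/13323993531377025 : ℝ) * ((mul_nonneg (mul_nonneg hw2 hw3) (hsw))
      + (mul_nonneg (mul_nonneg ht3 ht2) (hst)))
    + (6583887646914969/8882662354251350 : ℝ) * ((mul_nonneg hw3 hsw)
      + (mul_nonneg ht2 hst))
    + (40024325420222867/31977584475304860 : ℝ) * (hsy)

open MeasureTheory in
lemma blich_aux (A : Matrix (Fin 3) (Fin 3) ℝ) (hA : A.det ≠ 0) (P : Fin 4 → Fin 3 → ℝ)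
    (hP : ∀ i j, |P i j| ≤ 1)
    (hc : ∀ x : Fin 3 → ℤ, x ≠ 0 → (∀ j, |A.mulVec (fun k => (x k : ℝ)) j| < 1) →
      ∃ i, A.mulVec (fun k => (x k : ℝ)) = P i ∨ -A.mulVec (fun k => (x k : ℝ)) = P i) :
    1 - ∑ i, ∏ j, (1 - |P i j|) ≤ |A.det| := by
  classical
  have hli : LinearIndependent ℝ (fun j => A.transpose j) := by
    have : A.transpose.det ≠ 0 := by rwa [Matrix.det_transpose]
    exact Matrix.linearIndependent_rows_of_det_ne_zero this
  set b := basisOfPiSpaceOfLinearIndependent hli with hb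
  have hbc : ⇑b = fun j => A.transpose j := coe_basisOfPiSpaceOfLinearIndependent hli
  have hvol : volume (ZSpan.fundamentalDomain b) = ENNReal.ofReal |A.det| := by
    rw [ZSpan.volume_fundamentalDomain, hbc, ← Matrix.det_transpose A]; rfl
  set S : Set (Fin 3 → ℝ) := Set.pi Set.univ fun _ => Set.Ioo (-1/2 : ℝ) (1/2) with hS
  have memS : ∀ x, x ∈ S ↔ ∀ j, -1/2 < x j ∧ x j < 1/2 := by intro x; simp [hS, Set.mem_pi]
  have hSv : volume S = 1 := by
    rw [hS, Real.volume_pi_Ioo]; norm_num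
  set B : Fin 4 → Set (Fin 3 → ℝ) := fun i => Set.pi Set.univ fun j =>
    Set.Ioo (max (-1/2 : ℝ) (P i j - 1/2)) (min (1/2) (P i j + 1/2)) with hB
  have memB : ∀ i x, x ∈ B i ↔ ∀ j, (-1/2 < x j ∧ P i j - 1/2 < x j) ∧ (x j < 1/2 ∧ x j < P i j + 1/2) := by
    intro i x; simp [hB, Set.mem_pi]
  have hBv : ∀ i, volume (B i) = ENNReal.ofReal (∏ j, (1 - |P i j|)) := by
    intro i
    rw [hB, Real.volume_pi_Ioo, ENNReal.ofReal_prod_of_nonneg]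
    · refine Finset.prod_congr rfl fun j _ => ?_
      congr 1
      rcases le_total 0 (P i j) with h | h
      · rw [abs_of_nonneg h, max_eq_right (by linarith), min_eq_left (by linarith)]; ring
      · rw [abs_of_nonpos h, max_eq_left (by linarith), min_eq_right (by linarith)]; ring
    · intro j _; linarith [hP i j]
  set E := S \ ⋃ i, B i with hE
  have mS : MeasurableSet S := MeasurableSet.univ_pi fun _ => measurableSet_Ioo
  have mB : ∀ i, MeasurableSet (B i) := fun i => MeasurableSet.univ_pi fun _ => measurableSet_Ioo
  have mE : MeasurableSet E := mS.diff (MeasurableSet.iUnion mB)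
  by_contra hlt
  push Not at hlt
  have hmain : volume (ZSpan.fundamentalDomain b) < volume E := by
    by_contra hle
    push Not at hle
    rw [hvol] at hle
    have h1 : volume S ≤ volume E + ∑ i, volume (B i) := by
      calc volume S ≤ volume (E ∪ ⋃ i, B i) := measure_mono (by
            intro x hx; by_cases h : x ∈ ⋃ i, B i
            · exact Or.inr h
            · exact Or.inl ⟨hx, h⟩)
        _ ≤ volume E + volume (⋃ i, B i) := measure_union_le _ _
        _ ≤ _ := by gcongr; exact measure_iUnion_fintype_le _ _
    have hn : ∀ i, 0 ≤ ∏ j, (1 - |P i j|) := fun i =>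
      Finset.prod_nonneg fun j _ => by linarith [hP i j]
    have h2 : (1 : ENNReal) ≤ ENNReal.ofReal (|A.det| + ∑ i, ∏ j, (1 - |P i j|)) := by
      rw [ENNReal.ofReal_add (abs_nonneg _) (Finset.sum_nonneg fun i _ => hn i),
        ENNReal.ofReal_sum_of_nonneg (fun i _ => hn i), ← hSv]
      refine h1.trans ?_
      simp only [hBv]
      gcongr
    rw [ENNReal.one_le_ofReal] at h2
    linarith
  have : Countable (Submodule.span ℤ (Set.range b)).toAddSubgroup :=
    inferInstanceAs (Countable (Submodule.span ℤ (Set.range b)))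
  obtain ⟨x, y, hxy, hd⟩ := exists_pair_mem_lattice_not_disjoint_vadd
    (ZSpan.isAddFundamentalDomain' b volume) mE.nullMeasurableSet hmain
  rw [Set.not_disjoint_iff] at hd
  obtain ⟨z, hz1, hz2⟩ := hd
  obtain ⟨e, he, rfl⟩ := hz1
  obtain ⟨f, hf, hef⟩ := hz2
  have hmem : (x : Fin 3 → ℝ) - y ∈ Submodule.span ℤ (Set.range b) :=
    sub_mem (S := Submodule ℤ (Fin 3 → ℝ)) x.2 y.2
  have hne : (x : Fin 3 → ℝ) - y ≠ 0 := fun h => hxy (Subtype.ext (sub_eq_zero.mp h))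
  rw [Submodule.mem_span_range_iff_exists_fun] at hmem
  obtain ⟨c, hcv⟩ := hmem
  have hcA : A.mulVec (fun k => (c k : ℝ)) = (x : Fin 3 → ℝ) - y := by
    rw [← hcv, hbc]; ext j
    simp [Matrix.mulVec, dotProduct, mul_comm]
  have hdiff : (x : Fin 3 → ℝ) - y = f - e := by
    have : (y : Fin 3 → ℝ) + f = x + e := hef
    rw [sub_eq_sub_iff_add_eq_add, ← this, add_comm]
  have hc0 : c ≠ 0 := by
    rintro rfl; apply hne; rw [← hcA]; ext j; simp [Matrix.mulVec, dotProduct]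
  rw [hdiff] at hcA
  have heS := (memS e).1 he.1
  have hfS := (memS f).1 hf.1
  obtain ⟨i, hi⟩ := hc c hc0 (by
    intro j; rw [hcA, abs_lt, Pi.sub_apply]
    have := heS j; have := hfS j
    constructor <;> linarith)
  rw [hcA] at hi
  rcases hi with hi | hi
  · apply hf.2
    refine Set.mem_iUnion.2 ⟨i, (memB i f).2 fun j => ?_⟩
    have := congrFun hi j; rw [Pi.sub_apply] at this
    have := heS j; have := hfS j
    refine ⟨⟨?_, ?_⟩, ?_, ?_⟩ <;> linarith
  · apply he.2
    refine Set.mem_iUnion.2 ⟨i, (memB i e).2 fun j => ?_⟩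
    have := congrFun hi j; rw [Pi.neg_apply, Pi.sub_apply] at this
    have := heS j; have := hfS j
    refine ⟨⟨?_, ?_⟩, ?_, ?_⟩ <;> linarith

/-- The lattice `A ℤ³`, written with triples. -/
def latA (A : Matrix (Fin 3) (Fin 3) ℝ) : AddSubgroup (ℝ × ℝ × ℝ) where
  carrier := {v | ∃ x : Fin 3 → ℤ, A.mulVec (fun k => (x k : ℝ)) = ![v.1, v.2.1, v.2.2]}
  zero_mem' := ⟨0, by ext i; fin_cases i <;> simp [Matrix.mulVec, dotProduct]⟩
  add_mem' := by
    rintro ⟨a1, a2, a3⟩ ⟨b1, b2, b3⟩ ⟨x, hx⟩ ⟨y, hy⟩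
    refine ⟨x + y, ?_⟩
    have : (fun k => ((x + y) k : ℝ)) = (fun k => (x k : ℝ)) + fun k => (y k : ℝ) := by
      ext k; simp
    rw [this, Matrix.mulVec_add, hx, hy]
    ext i; fin_cases i <;> simp
  neg_mem' := by
    rintro ⟨a1, a2, a3⟩ ⟨x, hx⟩
    refine ⟨-x, ?_⟩
    have : (fun k => ((-x) k : ℝ)) = -(fun k => (x k : ℝ)) := by
      ext k; simp
    rw [this, Matrix.mulVec_neg, hx]
    ext i; fin_cases i <;> simp

/-- The facts about an admissible lattice that the combinatorial part uses. -/
structure AdmLat (Λ : AddSubgroup (ℝ × ℝ × ℝ)) (d : ℝ) : Prop where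
  pos : 0 < d
  bad : ∀ a b c : ℝ, (a, b, c) ∈ Λ → |a| < 1 → |b| < 1 → |c| < 1 → |a| + |b| + |c| ≤ 2 →
    a = 0 ∧ b = 0 ∧ c = 0
  blich : ∀ P1 P2 P3 : Fin 4 → ℝ, (∀ i, |P1 i| ≤ 1) → (∀ i, |P2 i| ≤ 1) → (∀ i, |P3 i| ≤ 1) →
    (∀ a b c : ℝ, (a, b, c) ∈ Λ → |a| < 1 → |b| < 1 → |c| < 1 → ¬(a = 0 ∧ b = 0 ∧ c = 0) →
      ∃ i, (a = P1 i ∧ b = P2 i ∧ c = P3 i) ∨ (-a = P1 i ∧ -b = P2 i ∧ -c = P3 i)) →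
    1 - ∑ i, (1 - |P1 i|) * (1 - |P2 i|) * (1 - |P3 i|) ≤ d
  index : ∀ u1 u2 u3 v1 v2 v3 w1 w2 w3 : ℝ, (u1, u2, u3) ∈ Λ → (v1, v2, v3) ∈ Λ →
    (w1, w2, w3) ∈ Λ → ∃ n : ℤ,
      u1 * (v2 * w3 - v3 * w2) - u2 * (v1 * w3 - v3 * w1) + u3 * (v1 * w2 - v2 * w1) = n * d ∧
      ∀ p : ℕ, p.Prime → (p : ℤ) ∣ n → ∃ a b c : ℤ, ¬(a = 0 ∧ b = 0 ∧ c = 0) ∧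
        (-p < 2 * a ∧ 2 * a ≤ p) ∧ (-p < 2 * b ∧ 2 * b ≤ p) ∧ (-p < 2 * c ∧ 2 * c ≤ p) ∧
        ((a * u1 + b * v1 + c * w1) / p, (a * u2 + b * v2 + c * w2) / p,
          (a * u3 + b * v3 + c * w3) / p) ∈ Λ

lemma index_int (M : Matrix (Fin 3) (Fin 3) ℤ) (p : ℕ) (hp : p.Prime) (h : (p : ℤ) ∣ M.det) :
    ∃ a e : Fin 3 → ℤ, a ≠ 0 ∧ (∀ i, -(p : ℤ) < 2 * a i ∧ 2 * a i ≤ p) ∧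
      M.mulVec a = fun i => (p : ℤ) * e i := by
  have : Fact p.Prime := ⟨hp⟩
  have h0 : (M.map (Int.castRingHom (ZMod p))).det = 0 := by
    rw [← RingHom.mapMatrix_apply, ← RingHom.map_det]
    simpa using (ZMod.intCast_zmod_eq_zero_iff_dvd M.det p).2 h
  obtain ⟨c, hc, hM⟩ := Matrix.exists_mulVec_eq_zero_iff.2 h0
  have hdiv : ∀ i, (p : ℤ) ∣ M.mulVec (fun k => (c k).valMinAbs) i := by
    intro i
    rw [← ZMod.intCast_zmod_eq_zero_iff_dvd]
    have := congrFun hM i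
    simpa [Matrix.mulVec, dotProduct] using this
  choose e he using hdiv
  refine ⟨fun k => (c k).valMinAbs, e, ?_, ?_, funext he⟩
  · intro h; apply hc; ext k
    have := congrFun h k
    simpa using this
  · intro i
    have := (ZMod.valMinAbs_mem_Ioc (c i))
    rw [Set.mem_Ioc] at this
    constructor <;> linarith [this.1, this.2]

lemma lat_of (A : Matrix (Fin 3) (Fin 3) ℝ) (hA : A.det ≠ 0)
    (H : ∀ a b c : ℝ, (a, b, c) ∈ latA A → |a| < 1 → |b| < 1 → |c| < 1 → |a| + |b| + |c| ≤ 2 →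
      a = 0 ∧ b = 0 ∧ c = 0) : AdmLat (latA A) |A.det| where
  pos := abs_pos.2 hA
  bad := H
  blich := by
    intro P1 P2 P3 h1 h2 h3 hc
    have := blich_aux A hA (fun i => ![P1 i, P2 i, P3 i])
      (by intro i j; fin_cases j <;> simp [h1, h2, h3]) (by
        intro x hx hlt
        set v := A.mulVec (fun k => (x k : ℝ)) with hv
        have hvm : (v 0, v 1, v 2) ∈ latA A := ⟨x, by rw [← hv]; ext i; fin_cases i <;> rfl⟩
        obtain ⟨i, hi⟩ := hc _ _ _ hvm (hlt 0) (hlt 1) (hlt 2) (by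
          rintro ⟨e0, e1, e2⟩
          have hv0 : v = 0 := by ext i; fin_cases i <;> assumption
          have hinj := Matrix.mulVec_injective_iff_isUnit.2
            ((Matrix.isUnit_iff_isUnit_det A).2 (isUnit_iff_ne_zero.2 hA))
          have hz : (fun k => (x k : ℝ)) = 0 := hinj (by rw [← hv, hv0, Matrix.mulVec_zero])
          apply hx; ext k
          have := congrFun hz k
          simpa using this)
        refine ⟨i, ?_⟩
        rcases hi with ⟨e1, e2, e3⟩ | ⟨e1, e2, e3⟩
        · left; ext j; fin_cases j <;> simp [e1, e2, e3]
        · right; ext j; fin_cases j <;> simp [← e1, ← e2, ← e3])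
    simpa [Fin.prod_univ_three] using this
  index := by
    rintro u1 u2 u3 v1 v2 v3 w1 w2 w3 ⟨x, hx⟩ ⟨y, hy⟩ ⟨z, hz⟩
    set M : Matrix (Fin 3) (Fin 3) ℤ := (Matrix.of ![x, y, z]).transpose with hM
    set N : Matrix (Fin 3) (Fin 3) ℝ := !![u1, v1, w1; u2, v2, w2; u3, v3, w3] with hN
    have hAM : A * M.map (Int.castRingHom ℝ) = N := by
      ext i j
      have hx' := congrFun hx i
      have hy' := congrFun hy i
      have hz' := congrFun hz i
      simp only [Matrix.mulVec, dotProduct] at hx' hy' hz'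
      rw [Matrix.mul_apply]
      fin_cases j
      · simp [hM]; rw [hx']; fin_cases i <;> simp [hN]
      · simp [hM]; rw [hy']; fin_cases i <;> simp [hN]
      · simp [hM]; rw [hz']; fin_cases i <;> simp [hN]
    have hdet : N.det = A.det * (M.det : ℝ) := by
      rw [← hAM, Matrix.det_mul]
      congr 1
      rw [← RingHom.mapMatrix_apply, ← RingHom.map_det]; rfl
    have hNd : u1 * (v2 * w3 - v3 * w2) - u2 * (v1 * w3 - v3 * w1) + u3 * (v1 * w2 - v2 * w1)
        = N.det := by
      rw [hN, Matrix.det_fin_three]; simp; ring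
    have key : ∀ p : ℕ, p.Prime → (p : ℤ) ∣ M.det → ∃ a b c : ℤ, ¬(a = 0 ∧ b = 0 ∧ c = 0) ∧
        (-(p : ℤ) < 2 * a ∧ 2 * a ≤ p) ∧ (-(p : ℤ) < 2 * b ∧ 2 * b ≤ p) ∧
        (-(p : ℤ) < 2 * c ∧ 2 * c ≤ p) ∧
        ((a * u1 + b * v1 + c * w1) / p, (a * u2 + b * v2 + c * w2) / p,
          (a * u3 + b * v3 + c * w3) / p) ∈ latA A := by
      intro p hp hd
      obtain ⟨a, e, ha, hab, hMa⟩ := index_int M p hp hd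
      refine ⟨a 0, a 1, a 2, ?_, hab 0, hab 1, hab 2, e, ?_⟩
      · rintro ⟨h0, h1, h2⟩; apply ha; ext k; fin_cases k <;> assumption
      · have hpp : (p : ℝ) ≠ 0 := by exact_mod_cast hp.ne_zero
        have hMr : (M.map (Int.castRingHom ℝ)).mulVec (fun k => (a k : ℝ))
            = (p : ℝ) • fun k => (e k : ℝ) := by
          ext i
          have := congrFun hMa i
          have h2 := congrArg (Int.cast : ℤ → ℝ) this
          simpa [Matrix.mulVec, dotProduct] using h2
        have h3 : N.mulVec (fun k => (a k : ℝ)) = (p : ℝ) • A.mulVec (fun k => (e k : ℝ)) := by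
          rw [← hAM, ← Matrix.mulVec_mulVec, hMr, Matrix.mulVec_smul]
        ext i
        have h4 := congrFun h3 i
        have h5 : A.mulVec (fun k => (e k : ℝ)) i = N.mulVec (fun k => (a k : ℝ)) i / p := by
          rw [h4, Pi.smul_apply, smul_eq_mul]; field_simp
        rw [h5]
        fin_cases i <;> simp [hN, Matrix.mulVec, dotProduct, Fin.sum_univ_three] <;> ring
    rw [hNd, hdet]
    rcases lt_or_gt_of_ne hA with h | h
    · refine ⟨-M.det, ?_, fun p hp hd => key p hp (by simpa using hd)⟩
      rw [abs_of_neg h]; push_cast; ring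
    · refine ⟨M.det, ?_, fun p hp hd => key p hp hd⟩
      rw [abs_of_pos h]; ring

lemma amgm27 (a b c : ℝ) (ha : 0 < a) (hb : 0 < b) (hc : 0 < c) (h : a + b + c < 1) :
    a * b * c < 1 / 27 := by
  have h1 : 27 * (a * b * c) ≤ (a + b + c) ^ 3 := by
    nlinarith [mul_nonneg ha.le (sq_nonneg (b - c)), mul_nonneg hb.le (sq_nonneg (a - c)),
      mul_nonneg hc.le (sq_nonneg (a - b)), mul_nonneg ha.le (sq_nonneg (a - b)),
      mul_nonneg ha.le (sq_nonneg (a - c)), mul_nonneg hb.le (sq_nonneg (b - a)),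
      mul_nonneg hb.le (sq_nonneg (b - c)), mul_nonneg hc.le (sq_nonneg (c - a)),
      mul_nonneg hc.le (sq_nonneg (c - b))]
  have h2 : (a + b + c) ^ 3 < 1 := pow_lt_one₀ (by positivity) h (by norm_num)
  linarith

lemma amgm_row (a b c : ℝ) (ha : 0 < a) (hb : 0 < b) (hc : 0 < c) (h : a + b + c < 1) :
    a * b * c ≤ (b + c) / 16 := by
  have h1 : 4 * (b * c) ≤ (b + c) ^ 2 := by nlinarith [sq_nonneg (b - c)]
  have h2 : a * (b + c) ≤ 1 / 4 := by nlinarith [sq_nonneg (2 * (b + c) - 1)]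
  have h3 : a * (4 * (b * c)) ≤ a * (b + c) ^ 2 := mul_le_mul_of_nonneg_left h1 ha.le
  have h4 : a * (b + c) * (b + c) ≤ 1 / 4 * (b + c) :=
    mul_le_mul_of_nonneg_right h2 (by positivity)
  nlinarith

lemma three_poly (a b c d e f g h i : ℝ) (ha : 0 < a) (hb : 0 < b) (hc : 0 < c) (hd : 0 < d)
    (he : 0 < e) (hf : 0 < f) (hg : 0 < g) (hh : 0 < h) (hi : 0 < i) (h1 : a + b + c < 1)
    (h2 : d + e + f < 1) (h3 : g + h + i < 1)
    (hk : 1 < a + d - (b + c + e + f) - (g + h + i)) :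
    a * b * c + d * e * f + g * h * i ≤ 1 / 27 := by
  have k1 := amgm_row a b c ha hb hc h1
  have k2 := amgm_row d e f hd he hf h2
  have k3 : g * h * i ≤ (g + h + i) / 27 := by
    have hs : 0 < g + h + i := by positivity
    have h1 : 27 * (g * h * i) ≤ (g + h + i) ^ 3 := by
      nlinarith [mul_nonneg hg.le (sq_nonneg (h - i)), mul_nonneg hh.le (sq_nonneg (g - i)),
        mul_nonneg hi.le (sq_nonneg (g - h)), mul_nonneg hg.le (sq_nonneg (g - h)),
        mul_nonneg hg.le (sq_nonneg (g - i)), mul_nonneg hh.le (sq_nonneg (h - g)),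
        mul_nonneg hh.le (sq_nonneg (h - i)), mul_nonneg hi.le (sq_nonneg (i - g)),
        mul_nonneg hi.le (sq_nonneg (i - h))]
    have h2 : (g + h + i) ^ 3 ≤ (g + h + i) ^ 1 :=
      pow_le_pow_of_le_one hs.le h3.le (by norm_num)
    linarith
  linarith

lemma crit (x1 x2 x3 y1 y2 y3 w1 w2 w3 t1 t2 t3 : ℝ)
    (hx1 : 0 < x1) (hx2 : 0 < x2) (hx3 : 0 < x3)
    (hy1 : 0 < y1) (hy2 : 0 < y2) (hy3 : 0 < y3) (hw1 : 0 < w1) (hw2 : 0 < w2) (hw3 : 0 < w3)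
    (ht1 : 0 < t1) (ht2 : 0 < t2) (ht3 : 0 < t3)
    (hx : x1 + x2 + x3 < 1) (hy : y1 + y2 + y3 < 1) (hw : w1 + w2 + w3 < 1)
    (ht : t1 + t2 + t3 < 1)
    (e1 : 2 * x1 = 1 - y1 + w1 + t1) (e2 : 2 * x2 = 1 - w2 + y2 + t2)
    (e3 : 2 * x3 = 1 - t3 + y3 + w3)
    (p1 : x1 + y1 ≤ 1) (p2 : x2 + w2 ≤ 1) (p3 : x3 + t3 ≤ 1) :
    x1 * x2 * x3 + y1 * y2 * y3 + w1 * w2 * w3 + t1 * t2 * t3 < 5 / 54 := by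
  have h1 := amgm27 x1 x2 x3 hx1 hx2 hx3 hx
  have h2 := ineq_four y1 y2 y3 w1 w2 w3 t1 t2 t3 hy1.le hy2.le hy3.le hw1.le hw2.le hw3.le
    ht1.le ht2.le ht3.le (by linarith) (by linarith) (by linarith) (by linarith) (by linarith)
    (by linarith) (by linarith)
  linarith

/-- A lattice vector with `|v_i| < 1` in the corner with signs `e`; the `x_i` are the
complements `1 - |v_i|`. -/
structure Cor (Λ : AddSubgroup (ℝ × ℝ × ℝ)) (e1 e2 e3 x1 x2 x3 : ℝ) : Prop where
  mem : (e1 * (1 - x1), e2 * (1 - x2), e3 * (1 - x3)) ∈ Λ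
  h1 : 0 < x1
  h2 : 0 < x2
  h3 : 0 < x3
  hs : x1 + x2 + x3 < 1

lemma mem_congr {Λ : AddSubgroup (ℝ × ℝ × ℝ)} {a b c a' b' c' : ℝ} (h : (a, b, c) ∈ Λ)
    (ha : a = a') (hb : b = b') (hc : c = c') : (a', b', c') ∈ Λ := by
  subst ha hb hc; exact h

lemma abs_sub_le_add (a b : ℝ) (ha : 0 < a) (hb : 0 < b) : |a - b| ≤ a + b := by
  rw [abs_le]; constructor <;> linarith

lemma cor_unique {Λ : AddSubgroup (ℝ × ℝ × ℝ)} {d : ℝ} (H : AdmLat Λ d)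
    {e1 e2 e3 x1 x2 x3 y1 y2 y3 : ℝ} (he1 : |e1| = 1) (he2 : |e2| = 1) (he3 : |e3| = 1)
    (hx : Cor Λ e1 e2 e3 x1 x2 x3) (hy : Cor Λ e1 e2 e3 y1 y2 y3) :
    x1 = y1 ∧ x2 = y2 ∧ x3 = y3 := by
  obtain ⟨m, a1, a2, a3, a4⟩ := hx
  obtain ⟨m', b1, b2, b3, b4⟩ := hy
  have hm : (e1 * (y1 - x1), e2 * (y2 - x2), e3 * (y3 - x3)) ∈ Λ :=
    mem_congr (a := e1 * (1 - x1) - e1 * (1 - y1)) (b := e2 * (1 - x2) - e2 * (1 - y2))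
      (c := e3 * (1 - x3) - e3 * (1 - y3)) (Λ.sub_mem m m') (by ring) (by ring) (by ring)
  have k1 := abs_sub_le_add y1 x1 b1 a1
  have k2 := abs_sub_le_add y2 x2 b2 a2
  have k3 := abs_sub_le_add y3 x3 b3 a3
  have n1 : e1 ≠ 0 := by rintro rfl; simp at he1
  have n2 : e2 ≠ 0 := by rintro rfl; simp at he2
  have n3 : e3 ≠ 0 := by rintro rfl; simp at he3
  obtain ⟨z1, z2, z3⟩ := H.bad _ _ _ hm
    (by rw [abs_mul, he1, one_mul, abs_lt]; constructor <;> linarith)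
    (by rw [abs_mul, he2, one_mul, abs_lt]; constructor <;> linarith)
    (by rw [abs_mul, he3, one_mul, abs_lt]; constructor <;> linarith)
    (by rw [abs_mul, he1, one_mul, abs_mul, he2, one_mul, abs_mul, he3, one_mul]; linarith)
  have z1 := (mul_eq_zero.1 z1).resolve_left n1
  have z2 := (mul_eq_zero.1 z2).resolve_left n2
  have z3 := (mul_eq_zero.1 z3).resolve_left n3
  refine ⟨?_, ?_, ?_⟩ <;> linarith

lemma pair_num (x1 x2 x3 y1 y2 y3 : ℝ) (a1 : 0 < x1) (a2 : 0 < x2) (a3 : 0 < x3)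
    (a4 : x1 + x2 + x3 < 1) (b1 : 0 < y1) (b2 : 0 < y2) (b3 : 0 < y3) (b4 : y1 + y2 + y3 < 1)
    (h : 1 < x1 + y1) : |2 - x1 - y1| < 1 ∧ |x2 - y2| < 1 ∧ |x3 - y3| < 1 ∧
      |2 - x1 - y1| + |x2 - y2| + |x3 - y3| ≤ 2 ∧ 2 - x1 - y1 ≠ 0 := by
  have k2 := abs_sub_le_add x2 y2 a2 b2
  have k3 := abs_sub_le_add x3 y3 a3 b3
  rw [abs_of_pos (show 0 < 2 - x1 - y1 by linarith)]
  refine ⟨by linarith, by linarith, by linarith, by linarith, by linarith⟩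

lemma pair1 {Λ : AddSubgroup (ℝ × ℝ × ℝ)} {d : ℝ} (H : AdmLat Λ d)
    {x1 x2 x3 y1 y2 y3 : ℝ} {e1 e2 e3 f1 f2 f3 : ℝ}
    (hx : Cor Λ e1 e2 e3 x1 x2 x3) (hy : Cor Λ f1 f2 f3 y1 y2 y3) (b c : ℝ)
    (hb : |b| = |x2 - y2|) (hc : |c| = |x3 - y3|) (hm : (2 - x1 - y1, b, c) ∈ Λ) :
    x1 + y1 ≤ 1 := by
  by_contra h
  push Not at h
  obtain ⟨k1, k2, k3, k4, k5⟩ := pair_num x1 x2 x3 y1 y2 y3 hx.h1 hx.h2 hx.h3 hx.hs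
    hy.h1 hy.h2 hy.h3 hy.hs h
  exact k5 (H.bad _ _ _ hm k1 (by rwa [hb]) (by rwa [hc]) (by rw [hb, hc]; linarith)).1

lemma pair2 {Λ : AddSubgroup (ℝ × ℝ × ℝ)} {d : ℝ} (H : AdmLat Λ d)
    {x1 x2 x3 y1 y2 y3 : ℝ} {e1 e2 e3 f1 f2 f3 : ℝ}
    (hx : Cor Λ e1 e2 e3 x1 x2 x3) (hy : Cor Λ f1 f2 f3 y1 y2 y3) (b c : ℝ)
    (hb : |b| = |x1 - y1|) (hc : |c| = |x3 - y3|) (hm : (b, 2 - x2 - y2, c) ∈ Λ) :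
    x2 + y2 ≤ 1 := by
  by_contra h
  push Not at h
  obtain ⟨k1, k2, k3, k4, k5⟩ := pair_num x2 x1 x3 y2 y1 y3 hx.h2 hx.h1 hx.h3
    (by linarith [hx.hs]) hy.h2 hy.h1 hy.h3 (by linarith [hy.hs]) h
  exact k5 (H.bad _ _ _ hm (by rwa [hb]) k1 (by rwa [hc]) (by rw [hb, hc]; linarith)).2.1

lemma pair3 {Λ : AddSubgroup (ℝ × ℝ × ℝ)} {d : ℝ} (H : AdmLat Λ d)
    {x1 x2 x3 y1 y2 y3 : ℝ} {e1 e2 e3 f1 f2 f3 : ℝ}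
    (hx : Cor Λ e1 e2 e3 x1 x2 x3) (hy : Cor Λ f1 f2 f3 y1 y2 y3) (b c : ℝ)
    (hb : |b| = |x1 - y1|) (hc : |c| = |x2 - y2|) (hm : (b, c, 2 - x3 - y3) ∈ Λ) :
    x3 + y3 ≤ 1 := by
  by_contra h
  push Not at h
  obtain ⟨k1, k2, k3, k4, k5⟩ := pair_num x3 x1 x2 y3 y1 y2 hx.h3 hx.h1 hx.h2
    (by linarith [hx.hs]) hy.h3 hy.h1 hy.h2 (by linarith [hy.hs]) h
  exact k5 (H.bad _ _ _ hm (by rwa [hb]) (by rwa [hc]) k1 (by rw [hb, hc]; linarith)).2.2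

lemma classify {Λ : AddSubgroup (ℝ × ℝ × ℝ)} {d : ℝ} (H : AdmLat Λ d) (a b c : ℝ)
    (hm : (a, b, c) ∈ Λ) (ha : |a| < 1) (hb : |b| < 1) (hc : |c| < 1)
    (h0 : ¬(a = 0 ∧ b = 0 ∧ c = 0)) :
    ∃ σ : ℝ, (σ = 1 ∨ σ = -1) ∧ (Cor Λ 1 1 1 (1 - σ * a) (1 - σ * b) (1 - σ * c) ∨
      Cor Λ (-1) 1 1 (1 + σ * a) (1 - σ * b) (1 - σ * c) ∨
      Cor Λ 1 (-1) 1 (1 - σ * a) (1 + σ * b) (1 - σ * c) ∨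
      Cor Λ 1 1 (-1) (1 - σ * a) (1 - σ * b) (1 + σ * c)) := by
  have hl : 2 < |a| + |b| + |c| := by
    by_contra h; push Not at h; exact h0 (H.bad a b c hm ha hb hc h)
  have hm' : (-a, -b, -c) ∈ Λ := Λ.neg_mem hm
  rw [abs_lt] at ha hb hc
  rcases abs_cases a with ⟨ea, sa⟩ | ⟨ea, sa⟩ <;> rcases abs_cases b with ⟨eb, sb⟩ | ⟨eb, sb⟩ <;>
    rcases abs_cases c with ⟨ec, sc⟩ | ⟨ec, sc⟩ <;> rw [ea, eb, ec] at hl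
  · refine ⟨1, Or.inl rfl, Or.inl ⟨mem_congr hm ?_ ?_ ?_, ?_, ?_, ?_, ?_⟩⟩ <;> linarith
  · refine ⟨1, Or.inl rfl, Or.inr (Or.inr (Or.inr ⟨mem_congr hm ?_ ?_ ?_, ?_, ?_, ?_, ?_⟩))⟩ <;> linarith
  · refine ⟨1, Or.inl rfl, Or.inr (Or.inr (Or.inl ⟨mem_congr hm ?_ ?_ ?_, ?_, ?_, ?_, ?_⟩))⟩ <;> linarith
  · refine ⟨-1, Or.inr rfl, Or.inr (Or.inl ⟨mem_congr hm' ?_ ?_ ?_, ?_, ?_, ?_, ?_⟩)⟩ <;> linarith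
  · refine ⟨1, Or.inl rfl, Or.inr (Or.inl ⟨mem_congr hm ?_ ?_ ?_, ?_, ?_, ?_, ?_⟩)⟩ <;> linarith
  · refine ⟨-1, Or.inr rfl, Or.inr (Or.inr (Or.inl ⟨mem_congr hm' ?_ ?_ ?_, ?_, ?_, ?_, ?_⟩))⟩ <;> linarith
  · refine ⟨-1, Or.inr rfl, Or.inr (Or.inr (Or.inr ⟨mem_congr hm' ?_ ?_ ?_, ?_, ?_, ?_, ?_⟩))⟩ <;> linarith
  · refine ⟨-1, Or.inr rfl, Or.inl ⟨mem_congr hm' ?_ ?_ ?_, ?_, ?_, ?_, ?_⟩⟩ <;> linarith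

/-- Either no corner vector and `o = 0`, or `o` is the overlap of the corner vector. -/
def OCor (Λ : AddSubgroup (ℝ × ℝ × ℝ)) (e1 e2 e3 o : ℝ) : Prop :=
  ((∀ x1 x2 x3, ¬ Cor Λ e1 e2 e3 x1 x2 x3) ∧ o = 0) ∨
    ∃ x1 x2 x3, Cor Λ e1 e2 e3 x1 x2 x3 ∧ o = x1 * x2 * x3

lemma pick {Λ : AddSubgroup (ℝ × ℝ × ℝ)} {d : ℝ} (H : AdmLat Λ d)
    {e1 e2 e3 : ℝ} (he1 : |e1| = 1) (he2 : |e2| = 1) (he3 : |e3| = 1) :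
    ∃ P1 P2 P3 o : ℝ, |P1| ≤ 1 ∧ |P2| ≤ 1 ∧ |P3| ≤ 1 ∧
      o = (1 - |P1|) * (1 - |P2|) * (1 - |P3|) ∧ OCor Λ e1 e2 e3 o ∧
      ∀ x1 x2 x3, Cor Λ e1 e2 e3 x1 x2 x3 →
        P1 = e1 * (1 - x1) ∧ P2 = e2 * (1 - x2) ∧ P3 = e3 * (1 - x3) := by
  by_cases h : ∃ x1 x2 x3, Cor Λ e1 e2 e3 x1 x2 x3
  · obtain ⟨x1, x2, x3, hx⟩ := h
    have a1 : |e1 * (1 - x1)| = 1 - x1 := by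
      rw [abs_mul, he1, one_mul, abs_of_pos]; linarith [hx.h2, hx.h3, hx.hs]
    have a2 : |e2 * (1 - x2)| = 1 - x2 := by
      rw [abs_mul, he2, one_mul, abs_of_pos]; linarith [hx.h1, hx.h3, hx.hs]
    have a3 : |e3 * (1 - x3)| = 1 - x3 := by
      rw [abs_mul, he3, one_mul, abs_of_pos]; linarith [hx.h1, hx.h2, hx.hs]
    refine ⟨e1 * (1 - x1), e2 * (1 - x2), e3 * (1 - x3), x1 * x2 * x3, ?_, ?_, ?_, ?_,
      Or.inr ⟨x1, x2, x3, hx, rfl⟩, ?_⟩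
    · rw [a1]; linarith [hx.h1]
    · rw [a2]; linarith [hx.h2]
    · rw [a3]; linarith [hx.h3]
    · rw [a1, a2, a3]; ring
    · intro y1 y2 y3 hy
      obtain ⟨rfl, rfl, rfl⟩ := cor_unique H he1 he2 he3 hx hy
      exact ⟨rfl, rfl, rfl⟩
  · push Not at h
    refine ⟨1, 1, 1, 0, by simp, by simp, by simp, by simp, Or.inl ⟨h, rfl⟩, ?_⟩
    intro x1 x2 x3 hx; exact absurd hx (h x1 x2 x3)

lemma blich4 {Λ : AddSubgroup (ℝ × ℝ × ℝ)} {d : ℝ} (H : AdmLat Λ d) :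
    ∃ o0 o1 o2 o3 : ℝ, 1 - (o0 + o1 + o2 + o3) ≤ d ∧ OCor Λ 1 1 1 o0 ∧ OCor Λ (-1) 1 1 o1 ∧
      OCor Λ 1 (-1) 1 o2 ∧ OCor Λ 1 1 (-1) o3 := by
  have u1 : |(1 : ℝ)| = 1 := by simp
  have um : |(-1 : ℝ)| = 1 := by simp
  obtain ⟨P1, P2, P3, o0, p1, p2, p3, p4, p5, p6⟩ := pick H u1 u1 u1
  obtain ⟨Q1, Q2, Q3, o1, q1, q2, q3, q4, q5, q6⟩ := pick H um u1 u1
  obtain ⟨R1, R2, R3, o2, r1, r2, r3, r4, r5, r6⟩ := pick H u1 um u1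
  obtain ⟨S1, S2, S3, o3, s1, s2, s3, s4, s5, s6⟩ := pick H u1 u1 um
  refine ⟨o0, o1, o2, o3, ?_, p5, q5, r5, s5⟩
  have := H.blich ![P1, Q1, R1, S1] ![P2, Q2, R2, S2] ![P3, Q3, R3, S3]
    (by intro i; fin_cases i <;> simp [p1, q1, r1, s1])
    (by intro i; fin_cases i <;> simp [p2, q2, r2, s2])
    (by intro i; fin_cases i <;> simp [p3, q3, r3, s3])
    (by
      intro a b c hm ha hb hc h0
      obtain ⟨σ, hσ, h⟩ := classify H a b c hm ha hb hc h0
      rcases h with h | h | h | h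
      · obtain ⟨k1, k2, k3⟩ := p6 _ _ _ h
        refine ⟨0, ?_⟩
        rcases hσ with rfl | rfl
        · left; simp [k1, k2, k3]
        · right; simp [k1, k2, k3]
      · obtain ⟨k1, k2, k3⟩ := q6 _ _ _ h
        refine ⟨1, ?_⟩
        rcases hσ with rfl | rfl
        · left; simp [k1, k2, k3]
        · right; simp [k1, k2, k3]
      · obtain ⟨k1, k2, k3⟩ := r6 _ _ _ h
        refine ⟨2, ?_⟩
        rcases hσ with rfl | rfl
        · left; simp [k1, k2, k3]
        · right; simp [k1, k2, k3]
      · obtain ⟨k1, k2, k3⟩ := s6 _ _ _ h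
        refine ⟨3, ?_⟩
        rcases hσ with rfl | rfl
        · left; simp [k1, k2, k3]
        · right; simp [k1, k2, k3])
  simp [Fin.sum_univ_four] at this
  linarith

lemma ocor_lt {Λ : AddSubgroup (ℝ × ℝ × ℝ)} {e1 e2 e3 o : ℝ} (h : OCor Λ e1 e2 e3 o) :
    o < 1 / 27 := by
  rcases h with ⟨_, rfl⟩ | ⟨x1, x2, x3, hx, rfl⟩
  · norm_num
  · exact amgm27 _ _ _ hx.h1 hx.h2 hx.h3 hx.hs

lemma ocor_eq {Λ : AddSubgroup (ℝ × ℝ × ℝ)} {d : ℝ} (H : AdmLat Λ d) {e1 e2 e3 o : ℝ}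
    (he1 : |e1| = 1) (he2 : |e2| = 1) (he3 : |e3| = 1) {x1 x2 x3 : ℝ}
    (hx : Cor Λ e1 e2 e3 x1 x2 x3) (h : OCor Λ e1 e2 e3 o) : o = x1 * x2 * x3 := by
  rcases h with ⟨h, _⟩ | ⟨y1, y2, y3, hy, rfl⟩
  · exact absurd hx (h _ _ _)
  · obtain ⟨rfl, rfl, rfl⟩ := cor_unique H he1 he2 he3 hx hy
    rfl

section main
variable {Λ : AddSubgroup (ℝ × ℝ × ℝ)} {d : ℝ}

lemma pair_q_r (H : AdmLat Λ d) {y1 y2 y3 w1 w2 w3 : ℝ} (Q : Cor Λ (-1) 1 1 y1 y2 y3)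
    (R : Cor Λ 1 (-1) 1 w1 w2 w3) : y3 + w3 ≤ 1 :=
  pair3 H Q R (y1 - w1) (w2 - y2) rfl (abs_sub_comm _ _)
    (mem_congr (Λ.add_mem Q.mem R.mem) (by ring) (by ring) (by ring))

lemma pair_q_s (H : AdmLat Λ d) {y1 y2 y3 t1 t2 t3 : ℝ} (Q : Cor Λ (-1) 1 1 y1 y2 y3)
    (S : Cor Λ 1 1 (-1) t1 t2 t3) : y2 + t2 ≤ 1 :=
  pair2 H Q S (y1 - t1) (t3 - y3) rfl (abs_sub_comm _ _)
    (mem_congr (Λ.add_mem Q.mem S.mem) (by ring) (by ring) (by ring))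

lemma pair_r_s (H : AdmLat Λ d) {w1 w2 w3 t1 t2 t3 : ℝ} (R : Cor Λ 1 (-1) 1 w1 w2 w3)
    (S : Cor Λ 1 1 (-1) t1 t2 t3) : w1 + t1 ≤ 1 :=
  pair1 H R S (w2 - t2) (t3 - w3) rfl (abs_sub_comm _ _)
    (mem_congr (Λ.add_mem R.mem S.mem) (by ring) (by ring) (by ring))

lemma pair_p_q (H : AdmLat Λ d) {x1 x2 x3 y1 y2 y3 : ℝ} (P : Cor Λ 1 1 1 x1 x2 x3)
    (Q : Cor Λ (-1) 1 1 y1 y2 y3) : x1 + y1 ≤ 1 :=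
  pair1 H P Q (y2 - x2) (y3 - x3) (abs_sub_comm _ _) (abs_sub_comm _ _)
    (mem_congr (Λ.sub_mem P.mem Q.mem) (by ring) (by ring) (by ring))

lemma pair_p_r (H : AdmLat Λ d) {x1 x2 x3 w1 w2 w3 : ℝ} (P : Cor Λ 1 1 1 x1 x2 x3)
    (R : Cor Λ 1 (-1) 1 w1 w2 w3) : x2 + w2 ≤ 1 :=
  pair2 H P R (w1 - x1) (w3 - x3) (abs_sub_comm _ _) (abs_sub_comm _ _)
    (mem_congr (Λ.sub_mem P.mem R.mem) (by ring) (by ring) (by ring))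

lemma pair_p_s (H : AdmLat Λ d) {x1 x2 x3 t1 t2 t3 : ℝ} (P : Cor Λ 1 1 1 x1 x2 x3)
    (S : Cor Λ 1 1 (-1) t1 t2 t3) : x3 + t3 ≤ 1 :=
  pair3 H P S (t1 - x1) (t2 - x2) (abs_sub_comm _ _) (abs_sub_comm _ _)
    (mem_congr (Λ.sub_mem P.mem S.mem) (by ring) (by ring) (by ring))

lemma even_case (H : AdmLat Λ d) {y1 y2 y3 w1 w2 w3 t1 t2 t3 : ℝ}
    (Q : Cor Λ (-1) 1 1 y1 y2 y3) (R : Cor Λ 1 (-1) 1 w1 w2 w3) (S : Cor Λ 1 1 (-1) t1 t2 t3)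
    (a b c : ℤ) (h0 : ¬(a = 0 ∧ b = 0 ∧ c = 0))
    (ha : a = 0 ∨ a = 1) (hb : b = 0 ∨ b = 1) (hc : c = 0 ∨ c = 1)
    (hm : ((a * (-1 * (1 - y1)) + b * (1 * (1 - w1)) + c * (1 * (1 - t1))) / 2,
      (a * (1 * (1 - y2)) + b * (-1 * (1 - w2)) + c * (1 * (1 - t2))) / 2,
      (a * (1 * (1 - y3)) + b * (1 * (1 - w3)) + c * (-1 * (1 - t3))) / 2) ∈ Λ) :
    Cor Λ 1 1 1 ((1 - y1 + w1 + t1) / 2) ((1 - w2 + y2 + t2) / 2) ((1 - t3 + y3 + w3) / 2) := by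
  have qr := pair_q_r H Q R
  have qs := pair_q_s H Q S
  have rs := pair_r_s H R S
  obtain ⟨-, a1, a2, a3, a4⟩ := Q
  obtain ⟨-, b1, b2, b3, b4⟩ := R
  obtain ⟨-, c1, c2, c3, c4⟩ := S
  have key : ∀ u v w : ℝ, (u, v, w) ∈ Λ → -1 < u → u < 1 → -1 < v → v < 1 → -1 < w → w < 1 →
      |u| + |v| + |w| ≤ 2 → u = 0 ∧ v = 0 ∧ w = 0 := fun u v w hm h1 h2 h3 h4 h5 h6 h7 =>
    H.bad u v w hm (abs_lt.2 ⟨h1, h2⟩) (abs_lt.2 ⟨h3, h4⟩) (abs_lt.2 ⟨h5, h6⟩) h7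
  rcases ha with rfl | rfl <;> rcases hb with rfl | rfl <;> rcases hc with rfl | rfl <;>
    simp only [Int.cast_zero, Int.cast_one] at hm
  · simp at h0
  · exfalso
    have := key _ _ _ hm (by linarith) (by linarith) (by linarith) (by linarith) (by linarith)
      (by linarith) (by
        rw [abs_of_pos (by linarith), abs_of_pos (by linarith), abs_of_neg (by linarith)]
        linarith)
    linarith [this.1]
  · exfalso
    have := key _ _ _ hm (by linarith) (by linarith) (by linarith) (by linarith) (by linarith)
      (by linarith) (by
        rw [abs_of_pos (by linarith), abs_of_neg (by linarith), abs_of_pos (by linarith)]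
        linarith)
    linarith [this.1]
  · exfalso
    have := key _ _ _ hm (by linarith) (by linarith) (by linarith) (by linarith) (by linarith)
      (by linarith) (by
        rcases abs_cases ((0 * (1 * (1 - y2)) + 1 * (-1 * (1 - w2)) + 1 * (1 * (1 - t2))) / 2)
          with ⟨e, -⟩ | ⟨e, -⟩ <;>
        rcases abs_cases ((0 * (1 * (1 - y3)) + 1 * (1 * (1 - w3)) + 1 * (-1 * (1 - t3))) / 2)
          with ⟨f, -⟩ | ⟨f, -⟩ <;>
        rw [abs_of_pos (by linarith), e, f] <;> linarith)
    linarith [this.1]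
  · exfalso
    have := key _ _ _ hm (by linarith) (by linarith) (by linarith) (by linarith) (by linarith)
      (by linarith) (by
        rw [abs_of_neg (by linarith), abs_of_pos (by linarith), abs_of_pos (by linarith)]
        linarith)
    linarith [this.1]
  · exfalso
    have := key _ _ _ hm (by linarith) (by linarith) (by linarith) (by linarith) (by linarith)
      (by linarith) (by
        rcases abs_cases ((1 * (-1 * (1 - y1)) + 0 * (1 * (1 - w1)) + 1 * (1 * (1 - t1))) / 2)
          with ⟨e, -⟩ | ⟨e, -⟩ <;>
        rcases abs_cases ((1 * (1 * (1 - y3)) + 0 * (1 * (1 - w3)) + 1 * (-1 * (1 - t3))) / 2)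
          with ⟨f, -⟩ | ⟨f, -⟩ <;>
        rw [abs_of_pos (a := (1 * (1 * (1 - y2)) + 0 * (-1 * (1 - w2)) + 1 * (1 * (1 - t2))) / 2)
          (by linarith), e, f] <;> linarith)
    linarith [this.2.1]
  · exfalso
    have := key _ _ _ hm (by linarith) (by linarith) (by linarith) (by linarith) (by linarith)
      (by linarith) (by
        rcases abs_cases ((1 * (-1 * (1 - y1)) + 1 * (1 * (1 - w1)) + 0 * (1 * (1 - t1))) / 2)
          with ⟨e, -⟩ | ⟨e, -⟩ <;>
        rcases abs_cases ((1 * (1 * (1 - y2)) + 1 * (-1 * (1 - w2)) + 0 * (1 * (1 - t2))) / 2)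
          with ⟨f, -⟩ | ⟨f, -⟩ <;>
        rw [abs_of_pos (a := (1 * (1 * (1 - y3)) + 1 * (1 * (1 - w3)) + 0 * (-1 * (1 - t3))) / 2)
          (by linarith), e, f] <;> linarith)
    linarith [this.2.2]
  · refine ⟨mem_congr hm (by ring) (by ring) (by ring), by linarith, by linarith, by linarith, ?_⟩
    by_contra h
    push Not at h
    have := key _ _ _ hm (by linarith) (by linarith) (by linarith) (by linarith) (by linarith)
      (by linarith) (by
        rw [abs_of_pos (by linarith), abs_of_pos (by linarith), abs_of_pos (by linarith)]
        linarith)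
    linarith [this.1]

set_option maxHeartbeats 4000000 in
lemma three_case (H : AdmLat Λ d) {y1 y2 y3 w1 w2 w3 t1 t2 t3 : ℝ}
    (Q : Cor Λ (-1) 1 1 y1 y2 y3) (R : Cor Λ 1 (-1) 1 w1 w2 w3) (S : Cor Λ 1 1 (-1) t1 t2 t3)
    (a b c : ℤ) (h0 : ¬(a = 0 ∧ b = 0 ∧ c = 0))
    (ha : a = 0 ∨ a = 1 ∨ a = -1) (hb : b = 0 ∨ b = 1 ∨ b = -1) (hc : c = 0 ∨ c = 1 ∨ c = -1)
    (hm : ((a * (-1 * (1 - y1)) + b * (1 * (1 - w1)) + c * (1 * (1 - t1))) / 3,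
      (a * (1 * (1 - y2)) + b * (-1 * (1 - w2)) + c * (1 * (1 - t2))) / 3,
      (a * (1 * (1 - y3)) + b * (1 * (1 - w3)) + c * (-1 * (1 - t3))) / 3) ∈ Λ) :
    y1 * y2 * y3 + w1 * w2 * w3 + t1 * t2 * t3 ≤ 1 / 27 := by
  have qr := pair_q_r H Q R
  have qs := pair_q_s H Q S
  have rs := pair_r_s H R S
  obtain ⟨-, a1, a2, a3, a4⟩ := Q
  obtain ⟨-, b1, b2, b3, b4⟩ := R
  obtain ⟨-, c1, c2, c3, c4⟩ := S
  have key : ∀ u v w : ℝ, (u, v, w) ∈ Λ → -1 < u → u < 1 → -1 < v → v < 1 → -1 < w → w < 1 →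
      ¬(u = 0 ∧ v = 0 ∧ w = 0) → 2 < |u| + |v| + |w| := fun u v w hm h1 h2 h3 h4 h5 h6 h7 => by
    by_contra h
    push Not at h
    exact h7 (H.bad u v w hm (abs_lt.2 ⟨h1, h2⟩) (abs_lt.2 ⟨h3, h4⟩) (abs_lt.2 ⟨h5, h6⟩) h)
  have P1 : 1 < y2 + w1 - (y1 + y3 + w2 + w3) - (t1 + t2 + t3) →
      y1 * y2 * y3 + w1 * w2 * w3 + t1 * t2 * t3 ≤ 1 / 27 := fun h => by
    have := three_poly y2 y1 y3 w1 w2 w3 t1 t2 t3 a2 a1 a3 b1 b2 b3 c1 c2 c3 (by linarith) b4 c4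
      (by linarith)
    linarith
  have P2 : 1 < y3 + t1 - (y1 + y2 + t2 + t3) - (w1 + w2 + w3) →
      y1 * y2 * y3 + w1 * w2 * w3 + t1 * t2 * t3 ≤ 1 / 27 := fun h => by
    have := three_poly y3 y1 y2 t1 t2 t3 w1 w2 w3 a3 a1 a2 c1 c2 c3 b1 b2 b3 (by linarith) c4 b4
      (by linarith)
    linarith
  have P3 : 1 < w3 + t2 - (w1 + w2 + t1 + t3) - (y1 + y2 + y3) →
      y1 * y2 * y3 + w1 * w2 * w3 + t1 * t2 * t3 ≤ 1 / 27 := fun h => by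
    have := three_poly w3 w1 w2 t2 t1 t3 y1 y2 y3 b3 b1 b2 c2 c1 c3 a1 a2 a3 (by linarith)
      (by linarith) a4 (by linarith)
    linarith
  have hne : ¬((a * (-1 * (1 - y1)) + b * (1 * (1 - w1)) + c * (1 * (1 - t1))) / 3 = 0 ∧
      (a * (1 * (1 - y2)) + b * (-1 * (1 - w2)) + c * (1 * (1 - t2))) / 3 = 0 ∧
      (a * (1 * (1 - y3)) + b * (1 * (1 - w3)) + c * (-1 * (1 - t3))) / 3 = 0) := by
    rintro ⟨z1, z2, z3⟩
    rcases ha with rfl | rfl | rfl <;> rcases hb with rfl | rfl | rfl <;>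
      rcases hc with rfl | rfl | rfl <;>
      simp only [Int.cast_zero, Int.cast_one, Int.cast_neg] at z1 z2 z3 <;>
      first
      | (exact h0 ⟨rfl, rfl, rfl⟩)
      | linarith
  have bd : (-1 < (a * (-1 * (1 - y1)) + b * (1 * (1 - w1)) + c * (1 * (1 - t1))) / 3 ∧
      (a * (-1 * (1 - y1)) + b * (1 * (1 - w1)) + c * (1 * (1 - t1))) / 3 < 1) ∧
      (-1 < (a * (1 * (1 - y2)) + b * (-1 * (1 - w2)) + c * (1 * (1 - t2))) / 3 ∧
      (a * (1 * (1 - y2)) + b * (-1 * (1 - w2)) + c * (1 * (1 - t2))) / 3 < 1) ∧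
      (-1 < (a * (1 * (1 - y3)) + b * (1 * (1 - w3)) + c * (-1 * (1 - t3))) / 3 ∧
      (a * (1 * (1 - y3)) + b * (1 * (1 - w3)) + c * (-1 * (1 - t3))) / 3 < 1) := by
    rcases ha with rfl | rfl | rfl <;> rcases hb with rfl | rfl | rfl <;>
      rcases hc with rfl | rfl | rfl <;>
      simp only [Int.cast_zero, Int.cast_one, Int.cast_neg] <;>
      refine ⟨⟨?_, ?_⟩, ⟨?_, ?_⟩, ?_, ?_⟩ <;> linarith
  have hl := key _ _ _ hm bd.1.1 bd.1.2 bd.2.1.1 bd.2.1.2 bd.2.2.1 bd.2.2.2 hne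
  clear hm hne bd key
  rcases abs_cases ((a * (-1 * (1 - y1)) + b * (1 * (1 - w1)) + c * (1 * (1 - t1))) / 3)
    with ⟨e, k1⟩ | ⟨e, k1⟩ <;>
  rcases abs_cases ((a * (1 * (1 - y2)) + b * (-1 * (1 - w2)) + c * (1 * (1 - t2))) / 3)
    with ⟨f, k2⟩ | ⟨f, k2⟩ <;>
  rcases abs_cases ((a * (1 * (1 - y3)) + b * (1 * (1 - w3)) + c * (-1 * (1 - t3))) / 3)
    with ⟨g, k3⟩ | ⟨g, k3⟩ <;>
  rw [e, f, g] at hl <;> clear e f g <;>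
  rcases ha with rfl | rfl | rfl <;> rcases hb with rfl | rfl | rfl <;>
    rcases hc with rfl | rfl | rfl <;>
    simp only [Int.cast_zero, Int.cast_one, Int.cast_neg] at hl k1 k2 k3 <;>
    first
    | (exfalso; linarith)
    | (exact P1 (by linarith))
    | (exact P2 (by linarith))
    | (exact P3 (by linarith))

end main

set_option maxHeartbeats 4000000 in
lemma main_qrs {Λ : AddSubgroup (ℝ × ℝ × ℝ)} {d : ℝ} (H : AdmLat Λ d)
    {y1 y2 y3 w1 w2 w3 t1 t2 t3 : ℝ}
    (Q : Cor Λ (-1) 1 1 y1 y2 y3) (R : Cor Λ 1 (-1) 1 w1 w2 w3) (S : Cor Λ 1 1 (-1) t1 t2 t3) :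
    49 / 54 < d := by
  have u1 : |(1 : ℝ)| = 1 := by simp
  have um : |(-1 : ℝ)| = 1 := by simp
  have qr := pair_q_r H Q R
  have qs := pair_q_s H Q S
  have rs := pair_r_s H R S
  obtain ⟨o0, o1, o2, o3, hO, O0, O1, O2, O3⟩ := blich4 H
  have l0 := ocor_lt O0
  have l1 := ocor_lt O1
  have l2 := ocor_lt O2
  have l3 := ocor_lt O3
  have E1 := ocor_eq H um u1 u1 Q O1
  have E2 := ocor_eq H u1 um u1 R O2
  have E3 := ocor_eq H u1 u1 um S O3
  obtain ⟨n, hn, hp⟩ := H.index _ _ _ _ _ _ _ _ _ Q.mem R.mem S.mem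
  obtain ⟨-, a1, a2, a3, a4⟩ := id Q
  obtain ⟨-, b1, b2, b3, b4⟩ := id R
  obtain ⟨-, c1, c2, c3, c4⟩ := id S
  have hD1 := ineq_two y1 y2 y3 w1 w2 w3 t1 t2 t3 a1.le a2.le a3.le b1.le b2.le b3.le c1.le c2.le
    c3.le (by linarith) (by linarith) (by linarith)
  have hD2 := ineq_two_upper y1 y2 y3 w1 w2 w3 t1 t2 t3 a1.le a2.le a3.le b1.le b2.le b3.le
    c1.le c2.le c3.le (by linarith) (by linarith) (by linarith)
  set D := (-((1-y1)*(1-w2)*(1-t3)) + (1-y1)*(1-w3)*(1-t2) + (1-w2)*(1-y3)*(1-t1)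
    + (1-t3)*(1-y2)*(1-w1) + (1-y2)*(1-w3)*(1-t1) + (1-y3)*(1-w1)*(1-t2)) with hD
  have hDn : D = n * d := by rw [← hn, hD]; ring
  have hDpos : 0 < D := lt_of_lt_of_le (by positivity) hD1
  have hd := H.pos
  have hd2 : 23 / 27 < d := by linarith
  have hn0 : 0 < n := by
    by_contra h
    push Not at h
    have : (n : ℝ) ≤ 0 := by exact_mod_cast h
    nlinarith
  have hn4 : n ≤ 4 := by
    by_contra h
    push Not at h
    have : (5 : ℝ) ≤ n := by exact_mod_cast h
    nlinarith
  have hfin : ∀ {x1 x2 x3 : ℝ}, Cor Λ 1 1 1 x1 x2 x3 →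
      x1 * x2 * x3 + y1 * y2 * y3 + w1 * w2 * w3 + t1 * t2 * t3 < 5 / 54 → 49 / 54 < d := by
    intro x1 x2 x3 P h
    have E0 := ocor_eq H u1 u1 u1 P O0
    linarith
  have heven : (2 : ℤ) ∣ n → 49 / 54 < d := by
    intro h2
    obtain ⟨a, b, c, h0, ha, hb, hc, hm⟩ := hp 2 Nat.prime_two (by exact_mod_cast h2)
    have P := even_case H Q R S a b c h0 (by push_cast at ha; omega) (by push_cast at hb; omega)
      (by push_cast at hc; omega) (by exact_mod_cast hm)
    exact hfin P (crit _ _ _ y1 y2 y3 w1 w2 w3 t1 t2 t3 P.h1 P.h2 P.h3 a1 a2 a3 b1 b2 b3 c1 c2 c3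
      P.hs a4 b4 c4 (by ring) (by ring) (by ring) (pair_p_q H P Q) (pair_p_r H P R)
      (pair_p_s H P S))
  have hv : (1 + y1 - w1 - t1, 1 + w2 - y2 - t2, 1 + t3 - y3 - w3) ∈ Λ :=
    mem_congr (Λ.add_mem (show (y1 - w1, w2 - y2, 2 - y3 - w3) ∈ Λ from
      mem_congr (Λ.add_mem Q.mem R.mem) (by ring) (by ring) (by ring)) S.mem)
      (by ring) (by ring) (by ring)
  have hcases : n = 1 ∨ (2 : ℤ) ∣ n ∨ n = 3 := by omega
  rcases hcases with rfl | h2 | rfl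
  · rw [Int.cast_one, one_mul] at hDn
    by_cases hP : ∃ x1 x2 x3, Cor Λ 1 1 1 x1 x2 x3
    · obtain ⟨x1, x2, x3, P⟩ := hP
      have pq := pair_p_q H P Q
      have pr := pair_p_r H P R
      have ps := pair_p_s H P S
      obtain ⟨-, d1, d2, d3, d4⟩ := id P
      have hz : (x1 + y1 - w1 - t1, x2 + w2 - y2 - t2, x3 + t3 - y3 - w3) ∈ Λ :=
        mem_congr (Λ.sub_mem hv P.mem)
          (by ring) (by ring) (by ring)
      by_cases h0 : x1 + y1 - w1 - t1 = 0 ∧ x2 + w2 - y2 - t2 = 0 ∧ x3 + t3 - y3 - w3 = 0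
      · obtain ⟨z1, z2, z3⟩ := h0
        have := ineq_five y1 y2 y3 w1 w2 w3 t1 t2 t3 a1.le a2.le a3.le b1.le b2.le b3.le
          c1.le c2.le c3.le (by linarith) (by linarith) (by linarith) (by linarith) (by linarith)
          (by linarith) (by linarith) (by linarith) (by linarith) (by linarith)
        rw [← hD] at this
        linarith
      · obtain ⟨σ, hσ, h⟩ := classify H _ _ _ hz
          (by rw [abs_lt]; constructor <;> linarith) (by rw [abs_lt]; constructor <;> linarith)
          (by rw [abs_lt]; constructor <;> linarith) h0
        rcases h with h | h | h | h
        · obtain ⟨k1, k2, k3⟩ := cor_unique H u1 u1 u1 P h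
          rcases hσ with rfl | rfl
          · refine hfin P (crit x1 x2 x3 y1 y2 y3 w1 w2 w3 t1 t2 t3 d1 d2 d3 a1 a2 a3 b1 b2 b3
              c1 c2 c3 d4 a4 b4 c4 ?_ ?_ ?_ pq pr ps) <;> linarith
          · exfalso; linarith
        · obtain ⟨k1, k2, k3⟩ := cor_unique H um u1 u1 Q h
          rcases hσ with rfl | rfl
          · exfalso; linarith
          · have := crit y1 y2 y3 x1 x2 x3 t1 t2 t3 w1 w2 w3 a1 a2 a3 d1 d2 d3 c1 c2 c3 b1 b2 b3
              a4 d4 c4 b4 (by linarith) (by linarith) (by linarith) (by linarith) (by linarith)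
              (by linarith)
            exact hfin P (by linarith)
        · obtain ⟨k1, k2, k3⟩ := cor_unique H u1 um u1 R h
          rcases hσ with rfl | rfl
          · exfalso; linarith
          · have := crit w1 w2 w3 t1 t2 t3 x1 x2 x3 y1 y2 y3 b1 b2 b3 c1 c2 c3 d1 d2 d3 a1 a2 a3
              b4 c4 d4 a4 (by linarith) (by linarith) (by linarith) (by linarith) (by linarith)
              (by linarith)
            exact hfin P (by linarith)
        · obtain ⟨k1, k2, k3⟩ := cor_unique H u1 u1 um S h
          rcases hσ with rfl | rfl
          · exfalso; linarith
          · have := crit t1 t2 t3 w1 w2 w3 y1 y2 y3 x1 x2 x3 c1 c2 c3 b1 b2 b3 a1 a2 a3 d1 d2 d3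
              c4 b4 a4 d4 (by linarith) (by linarith) (by linarith) (by linarith) (by linarith)
              (by linarith)
            exact hfin P (by linarith)
    · push Not at hP
      have E0 : o0 = 0 := by
        rcases O0 with h | ⟨x1, x2, x3, h, _⟩
        · exact h.2
        · exact absurd h (hP _ _ _)
      by_contra hcon
      push Not at hcon
      by_cases g1 : w1 + t1 ≤ y1
      · have := ineq_six y1 y2 y3 w1 w2 w3 t1 t2 t3 a1.le a2.le a3.le b1.le b2.le b3.le
          c1.le c2.le c3.le (by linarith) (by linarith) (by linarith) (by linarith) (by linarith)
          (by linarith)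
        rw [← hD] at this
        linarith
      by_cases g2 : y2 + t2 ≤ w2
      · have := ineq_six w2 w1 w3 y2 y1 y3 t2 t1 t3 b2.le b1.le b3.le a2.le a1.le a3.le
          c2.le c1.le c3.le (by linarith) (by linarith) (by linarith) (by linarith) (by linarith)
          (by linarith)
        nlinarith [this, hD]
      by_cases g3 : y3 + w3 ≤ t3
      · have := ineq_six t3 t2 t1 w3 w2 w1 y3 y2 y1 c3.le c2.le c1.le b3.le b2.le b1.le
          a3.le a2.le a1.le (by linarith) (by linarith) (by linarith) (by linarith) (by linarith)
          (by linarith)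
        nlinarith [this, hD]
      push Not at g1 g2 g3
      by_cases hl : 2 < (1 + y1 - w1 - t1) + (1 + w2 - y2 - t2) + (1 + t3 - y3 - w3)
      · exact hP (w1 + t1 - y1) (y2 + t2 - w2) (y3 + w3 - t3)
          ⟨mem_congr hv (by ring) (by ring) (by ring), by linarith, by linarith, by linarith,
            by linarith⟩
      · have := (H.bad _ _ _ hv (by rw [abs_lt]; constructor <;> linarith)
          (by rw [abs_lt]; constructor <;> linarith) (by rw [abs_lt]; constructor <;> linarith)
          (by rw [abs_of_pos (by linarith), abs_of_pos (by linarith), abs_of_pos (by linarith)]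
              linarith)).1
        linarith
  · exact heven h2
  · obtain ⟨a, b, c, h0, ha, hb, hc, hm⟩ := hp 3 Nat.prime_three (by norm_num)
    have := three_case H Q R S a b c h0 (by push_cast at ha; omega) (by push_cast at hb; omega)
      (by push_cast at hc; omega) (by exact_mod_cast hm)
    linarith

/-- The core theorem for admissible lattices. -/
lemma core (A : Matrix (Fin 3) (Fin 3) ℝ) (hA : A.det ≠ 0)
    (H : ∀ a b c : ℝ, (a, b, c) ∈ latA A → |a| < 1 → |b| < 1 → |c| < 1 → |a| + |b| + |c| ≤ 2 →
      a = 0 ∧ b = 0 ∧ c = 0) : 49 / 54 < |A.det| := by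
  have L := lat_of A hA H
  -- sign changes
  have flip : ∀ e1 e2 e3 : ℝ, |e1| = 1 → |e2| = 1 → |e3| = 1 →
      ∃ Λ : AddSubgroup (ℝ × ℝ × ℝ), AdmLat Λ |A.det| ∧
        ∀ a b c, (a, b, c) ∈ latA A → (e1 * a, e2 * b, e3 * c) ∈ Λ := by
    intro e1 e2 e3 h1 h2 h3
    have hs : ∀ e : ℝ, |e| = 1 → e * e = 1 := fun e h => by
      rw [← abs_mul_abs_self, h, one_mul]
    have n1 : e1 ≠ 0 := by rintro rfl; simp at h1
    have n2 : e2 ≠ 0 := by rintro rfl; simp at h2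
    have n3 : e3 ≠ 0 := by rintro rfl; simp at h3
    set A' := Matrix.diagonal ![e1, e2, e3] * A with hA'
    have hmem : ∀ a b c, (a, b, c) ∈ latA A → (e1 * a, e2 * b, e3 * c) ∈ latA A' := by
      rintro a b c ⟨x, hx⟩
      refine ⟨x, ?_⟩
      rw [hA', ← Matrix.mulVec_mulVec, hx]
      ext i; fin_cases i <;> simp [Matrix.mulVec_diagonal]
    have hmem' : ∀ a b c, (a, b, c) ∈ latA A' → (e1 * a, e2 * b, e3 * c) ∈ latA A := by
      rintro a b c ⟨x, hx⟩
      refine ⟨x, ?_⟩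
      rw [hA', ← Matrix.mulVec_mulVec] at hx
      ext i
      have := congrFun hx i
      rw [Matrix.mulVec_diagonal] at this
      fin_cases i
      · simp at this ⊢; rw [← this, ← mul_assoc, hs e1 h1, one_mul]
      · simp at this ⊢; rw [← this, ← mul_assoc, hs e2 h2, one_mul]
      · simp at this ⊢; rw [← this, ← mul_assoc, hs e3 h3, one_mul]
    have hdet : |A'.det| = |A.det| := by
      rw [hA', Matrix.det_mul, Matrix.det_diagonal, abs_mul]
      simp [Fin.prod_univ_three, abs_mul, h1, h2, h3]
    refine ⟨latA A', ?_, hmem⟩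
    rw [← hdet]
    refine lat_of A' ?_ ?_
    · rw [← abs_ne_zero, hdet]; exact abs_ne_zero.2 hA
    · intro a b c hm ha hb hc hl
      obtain ⟨z1, z2, z3⟩ := H _ _ _ (hmem' a b c hm) (by rwa [abs_mul, h1, one_mul])
        (by rwa [abs_mul, h2, one_mul]) (by rwa [abs_mul, h3, one_mul])
        (by rw [abs_mul, h1, abs_mul, h2, abs_mul, h3]; linarith)
      exact ⟨(mul_eq_zero.1 z1).resolve_left n1, (mul_eq_zero.1 z2).resolve_left n2,
        (mul_eq_zero.1 z3).resolve_left n3⟩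
  have u1 : |(1 : ℝ)| = 1 := by simp
  have um : |(-1 : ℝ)| = 1 := by simp
  obtain ⟨o0, o1, o2, o3, hO, O0, O1, O2, O3⟩ := blich4 L
  have l0 := ocor_lt O0
  have l1 := ocor_lt O1
  have l2 := ocor_lt O2
  have l3 := ocor_lt O3
  have neg : ∀ {a b c : ℝ}, (a, b, c) ∈ latA A → (-a, -b, -c) ∈ latA A :=
    fun h => (latA A).neg_mem h
  rcases O0 with ⟨-, z0⟩ | ⟨x1, x2, x3, P, -⟩ <;> rcases O1 with ⟨-, z1⟩ | ⟨y1, y2, y3, Q, -⟩ <;>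
    rcases O2 with ⟨-, z2⟩ | ⟨w1, w2, w3, R, -⟩ <;> rcases O3 with ⟨-, z3⟩ | ⟨t1, t2, t3, S, -⟩ <;>
    first
    | linarith
    | exact main_qrs L Q R S
    | (obtain ⟨Λ, HΛ, hm⟩ := flip (-1) 1 1 um u1 u1
       exact main_qrs HΛ (y1 := x1) (y2 := x2) (y3 := x3) (w1 := t1) (w2 := t2) (w3 := t3)
         (t1 := w1) (t2 := w2) (t3 := w3)
         ⟨mem_congr (hm _ _ _ P.mem) (by ring) (by ring) (by ring), P.h1, P.h2, P.h3, P.hs⟩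
         ⟨mem_congr (hm _ _ _ (neg S.mem)) (by ring) (by ring) (by ring), S.h1, S.h2, S.h3, S.hs⟩
         ⟨mem_congr (hm _ _ _ (neg R.mem)) (by ring) (by ring) (by ring), R.h1, R.h2, R.h3, R.hs⟩)
    | (obtain ⟨Λ, HΛ, hm⟩ := flip 1 (-1) 1 u1 um u1
       exact main_qrs HΛ (y1 := t1) (y2 := t2) (y3 := t3) (w1 := x1) (w2 := x2) (w3 := x3)
         (t1 := y1) (t2 := y2) (t3 := y3)
         ⟨mem_congr (hm _ _ _ (neg S.mem)) (by ring) (by ring) (by ring), S.h1, S.h2, S.h3, S.hs⟩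
         ⟨mem_congr (hm _ _ _ P.mem) (by ring) (by ring) (by ring), P.h1, P.h2, P.h3, P.hs⟩
         ⟨mem_congr (hm _ _ _ (neg Q.mem)) (by ring) (by ring) (by ring), Q.h1, Q.h2, Q.h3, Q.hs⟩)
    | (obtain ⟨Λ, HΛ, hm⟩ := flip 1 1 (-1) u1 u1 um
       exact main_qrs HΛ (y1 := w1) (y2 := w2) (y3 := w3) (w1 := y1) (w2 := y2) (w3 := y3)
         (t1 := x1) (t2 := x2) (t3 := x3)
         ⟨mem_congr (hm _ _ _ (neg R.mem)) (by ring) (by ring) (by ring), R.h1, R.h2, R.h3, R.hs⟩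
         ⟨mem_congr (hm _ _ _ (neg Q.mem)) (by ring) (by ring) (by ring), Q.h1, Q.h2, Q.h3, Q.hs⟩
         ⟨mem_congr (hm _ _ _ P.mem) (by ring) (by ring) (by ring), P.h1, P.h2, P.h3, P.hs⟩)

lemma abs_form {y1 y2 y3 m a b c : ℝ} (hm : 0 < m) (ha : m * a = y2 + y3) (hb : m * b = y1 + y3)
    (hc : m * c = y1 + y2) (h1 : |a| < 1) (h2 : |b| < 1) (h3 : |c| < 1)
    (hs : |a| + |b| + |c| ≤ 2) : |y1| + |y2| + |y3| + |y1 + y2 + y3| ≤ 2 * m := by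
  have k1 : |y2 + y3| < m := by rw [← ha, abs_mul, abs_of_pos hm]; nlinarith
  have k2 : |y1 + y3| < m := by rw [← hb, abs_mul, abs_of_pos hm]; nlinarith
  have k3 : |y1 + y2| < m := by rw [← hc, abs_mul, abs_of_pos hm]; nlinarith
  have ks : |y2 + y3| + |y1 + y3| + |y1 + y2| ≤ 2 * m := by
    rw [← ha, ← hb, ← hc, abs_mul, abs_mul, abs_mul, abs_of_pos hm]; nlinarith
  clear ha hb hc h1 h2 h3 hs
  rw [abs_lt] at k1 k2 k3
  obtain ⟨k1, k1'⟩ := k1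
  obtain ⟨k2, k2'⟩ := k2
  obtain ⟨k3, k3'⟩ := k3
  have r1 := le_abs_self (y2 + y3)
  have r2 := le_abs_self (y1 + y3)
  have r3 := le_abs_self (y1 + y2)
  have r4 := neg_le_abs (y2 + y3)
  have r5 := neg_le_abs (y1 + y3)
  have r6 := neg_le_abs (y1 + y2)
  rcases abs_cases y1 with ⟨e1, -⟩ | ⟨e1, -⟩ <;> rcases abs_cases y2 with ⟨e2, -⟩ | ⟨e2, -⟩ <;>
    rcases abs_cases y3 with ⟨e3, -⟩ | ⟨e3, -⟩ <;>
    rcases abs_cases (y1 + y2 + y3) with ⟨e4, -⟩ | ⟨e4, -⟩ <;> rw [e1, e2, e3, e4] <;> linarith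

/-- **Sharp linear form theorem in dimension three.** -/
theorem linear_forms_dim_three (A : Matrix (Fin 3) (Fin 3) ℝ) (hA : A.det ≠ 0) :
    ∃ x : Fin 3 → ℤ, x ≠ 0 ∧
      |∑ j, A 0 j * (x j : ℝ)| + |∑ j, A 1 j * (x j : ℝ)| + |∑ j, A 2 j * (x j : ℝ)| +
        |(∑ j, A 0 j * (x j : ℝ)) + (∑ j, A 1 j * (x j : ℝ)) + ∑ j, A 2 j * (x j : ℝ)| ≤
        6 * (2 / 7 : ℝ) ^ ((2 : ℝ) / 3) * |A.det| ^ ((1 : ℝ) / 3) := by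
  by_contra hcon
  push Not at hcon
  have hd : 0 < |A.det| := abs_pos.2 hA
  obtain ⟨m, hm⟩ : ∃ m, m = 3 * (2 / 7 : ℝ) ^ ((2 : ℝ) / 3) * |A.det| ^ ((1 : ℝ) / 3) := ⟨_, rfl⟩
  have hmpos : 0 < m := by rw [hm]; positivity
  have hm3 : m ^ 3 = 108 / 49 * |A.det| := by
    have e1 : ((2 / 7 : ℝ) ^ ((2 : ℝ) / 3)) ^ 3 = 4 / 49 := by
      rw [← Real.rpow_natCast, ← Real.rpow_mul (by norm_num)]
      norm_num
    have e2 : (|A.det| ^ ((1 : ℝ) / 3)) ^ 3 = |A.det| := by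
      rw [← Real.rpow_natCast, ← Real.rpow_mul hd.le]
      norm_num
    rw [hm, mul_pow, mul_pow, e1, e2]; ring
  obtain ⟨U, hU⟩ : ∃ U : Matrix (Fin 3) (Fin 3) ℝ, U = !![0, 1, 1; 1, 0, 1; 1, 1, 0] := ⟨_, rfl⟩
  have hUdet : U.det = 2 := by rw [hU, Matrix.det_fin_three]; simp; norm_num
  have hdet : |((1 / m) • (U * A)).det| = 49 / 54 := by
    rw [Matrix.det_smul, Matrix.det_mul, hUdet, Fintype.card_fin, abs_mul, abs_mul,
      abs_of_pos (by positivity), abs_of_pos (by norm_num : (0 : ℝ) < 2), div_pow, hm3]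
    field_simp
    norm_num
  have key := core ((1 / m) • (U * A))
    (by rw [← abs_ne_zero, hdet]; norm_num) ?_
  · rw [hdet] at key; exact lt_irrefl _ key
  · rintro a b c ⟨x, hx⟩ ha hb hc hs
    rw [Matrix.smul_mulVec, ← Matrix.mulVec_mulVec] at hx
    have x0 := congrFun hx 0
    have x1 := congrFun hx 1
    have x2 := congrFun hx 2
    simp only [hU, Matrix.mulVec, dotProduct, Fin.sum_univ_three, Pi.smul_apply, smul_eq_mul,
      Matrix.of_apply, Matrix.cons_val] at x0 x1 x2
    by_cases hx0 : x = 0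
    · subst hx0
      simp at x0 x1 x2
      exact ⟨x0.symm, x1.symm, x2.symm⟩
    · exfalso
      have h1 := hcon x hx0
      have h2 := abs_form (y1 := ∑ j, A 0 j * (x j : ℝ)) (y2 := ∑ j, A 1 j * (x j : ℝ))
        (y3 := ∑ j, A 2 j * (x j : ℝ)) hmpos
        (by rw [← x0, Fin.sum_univ_three, Fin.sum_univ_three]; field_simp; ring)
        (by rw [← x1, Fin.sum_univ_three, Fin.sum_univ_three]; field_simp; ring)
        (by rw [← x2, Fin.sum_univ_three, Fin.sum_univ_three]; field_simp; ring) ha hb hc hs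
      linarith
end

section
/- Let K be an o-symmetric convex body in ℝ^n, let i ∈ {1, …, n}, and suppose F > 0 is a constant such that μ_n(K) ≤ F · μ_1(K). Then μ_i(K)^n · vol(K) ≥ (i!/n!) · F^{-(n-i)}. -/
open MeasureTheory Pointwise

/-- The integer lattice `ℤⁿ` viewed as a subset of `ℝⁿ`. -/
def intLattice (n : ℕ) : Set (EuclideanSpace ℝ (Fin n)) :=
  {x | ∀ j, ∃ m : ℤ, x j = (m : ℝ)}

/-- The `i`-th covering minimum `μ_i(K, ℤⁿ)` of a convex body `K ⊆ ℝⁿ`: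
the least `μ > 0` such that `μK + ℤⁿ` meets every `(n-i)`-dimensional affine subspace. -/
noncomputable def covMin (n i : ℕ) (K : Set (EuclideanSpace ℝ (Fin n))) : ℝ :=
  sInf {μ : ℝ | 0 < μ ∧ ∀ L : AffineSubspace ℝ (EuclideanSpace ℝ (Fin n)),
    (L : Set (EuclideanSpace ℝ (Fin n))).Nonempty →
    Module.finrank ℝ L.direction = n - i →
    ((μ • K + intLattice n) ∩ (L : Set (EuclideanSpace ℝ (Fin n)))).Nonempty}


theorem gauge_smul_le_abs {E : Type*} [AddCommGroup E] [Module ℝ E] (K : Set E)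
    (hs : ∀ x ∈ K, -x ∈ K) (r : ℝ) (x : E) : gauge K (r • x) ≤ |r| * gauge K x := by
  rcases le_total 0 r with hr | hr
  · rw [gauge_smul_of_nonneg hr, abs_of_nonneg hr, smul_eq_mul]
  · have : r • x = -((-r) • x) := by simp
    rw [this, gauge_neg hs, gauge_smul_of_nonneg (by linarith), abs_of_nonpos hr, smul_eq_mul]

open Module in
theorem lintegral_exp_gauge {E : Type*} [NormedAddCommGroup E] [NormedSpace ℝ E]
    [FiniteDimensional ℝ E] [Nontrivial E] [MeasurableSpace E] [BorelSpace E]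
    (μ : Measure E) [μ.IsAddHaarMeasure] (K : Set E) (hc : IsCompact K) (hconv : Convex ℝ K)
    (h0 : K ∈ nhds (0 : E)) (hs : ∀ x ∈ K, -x ∈ K) :
    ∫⁻ x, ENNReal.ofReal (Real.exp (- gauge K x)) ∂μ = (finrank ℝ E).factorial * μ K := by
  have habs : Absorbent ℝ K := absorbent_nhds_zero h0
  have hb : Bornology.IsVonNBounded ℝ K := hc.isVonNBounded ℝ
  have h5 := gauge_smul_le_abs K hs
  have e1 := measure_lt_one_eq_integral_div_gamma μ (g := gauge K) gauge_zero (gauge_neg hs)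
    (gauge_add_le hconv habs) (fun h => (gauge_eq_zero habs hb).1 h) h5 one_pos
  have e2 := measure_le_eq_lt μ (g := gauge K) gauge_zero (gauge_neg hs)
    (gauge_add_le hconv habs) (fun h => (gauge_eq_zero habs hb).1 h) h5 1
  have e3 : {x | gauge K x ≤ 1} = K := by
    ext x
    simp [gauge_le_one_iff_mem_closure hconv h0, hc.isClosed.closure_eq]
  rw [e3, e1] at e2
  simp only [Real.rpow_one, div_one, Real.Gamma_nat_eq_factorial] at e2
  have hpos : 0 < μ K := Measure.measure_pos_of_mem_nhds μ h0
  have hint : Integrable (fun x => Real.exp (- gauge K x)) μ := by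
    by_contra h
    rw [integral_undef h] at e2
    simp [e2] at hpos
  rw [← ofReal_integral_eq_lintegral_ofReal hint (Filter.Eventually.of_forall fun x => (Real.exp_pos _).le)]
  rw [e2, ← ENNReal.ofReal_natCast, ← ENNReal.ofReal_mul (by positivity)]
  congr 1
  field_simp

theorem lintegral_exp_l1 (m : ℕ) (c : ℝ) (hc : 0 < c) :
    ∫⁻ z : Fin m → ℝ, ENNReal.ofReal (Real.exp (- (2 * c * ∑ j, |z j|)))
      = ENNReal.ofReal ((c⁻¹) ^ m) := by
  have h1 : ∀ z : Fin m → ℝ, Real.exp (- (2 * c * ∑ j, |z j|)) =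
      ∏ j, Real.exp (-(2 * c) * |z j|) := by
    intro z
    rw [← Real.exp_sum, ← Finset.mul_sum, neg_mul]
  simp_rw [h1]
  have hi0 : IntegrableOn (fun x : ℝ => Real.exp (-(2 * c) * x)) (Set.Ioi 0) :=
    integrableOn_exp_mul_Ioi (by linarith) 0
  have hI : ∫ x : ℝ, Real.exp (-(2 * c) * |x|) = c⁻¹ := by
    rw [integral_comp_abs (f := fun x => Real.exp (-(2 * c) * x)),
      integral_exp_mul_Ioi (by linarith)]
    simp
    field_simp
  have hi : Integrable (fun x : ℝ => Real.exp (-(2 * c) * |x|)) := by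
    by_contra h
    rw [integral_undef h] at hI
    exact (inv_pos.2 hc).ne hI
  have hp : Integrable (fun z : Fin m → ℝ => ∏ j, Real.exp (-(2 * c) * |z j|)) :=
    Integrable.fintype_prod (f := fun _ x => Real.exp (-(2 * c) * |x|)) (fun _ => hi)
  rw [← ofReal_integral_eq_lintegral_ofReal hp
    (Filter.Eventually.of_forall fun x => Finset.prod_nonneg fun _ _ => (Real.exp_pos _).le)]
  rw [integral_fintype_prod_volume_eq_pow (fun x : ℝ => Real.exp (-(2 * c) * |x|)), hI]
  simp

theorem one_le_volume_of_cover (n : ℕ) (S : Set (EuclideanSpace ℝ (Fin n)))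
    (h : ∀ x, ∃ z ∈ intLattice n, x - z ∈ S) : 1 ≤ volume S := by
  let Q : Set (EuclideanSpace ℝ (Fin n)) := {x | ∀ j, x j ∈ Set.Ico (0:ℝ) 1}
  have hQ' : Q = (WithLp.ofLp) ⁻¹' (Set.pi Set.univ fun _ : Fin n => Set.Ico (0:ℝ) 1) := by
    ext x; simp [Q]
  have hQm : MeasurableSet Q := by
    rw [hQ']
    exact (PiLp.volume_preserving_ofLp (Fin n)).measurable
      (MeasurableSet.univ_pi fun _ => measurableSet_Ico)
  have hQ : volume Q = 1 := by
    rw [hQ', (PiLp.volume_preserving_ofLp (Fin n)).measure_preimage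
      (MeasurableSet.univ_pi fun _ => measurableSet_Ico).nullMeasurableSet, volume_pi_pi]
    simp
  let t : (Fin n → ℤ) → EuclideanSpace ℝ (Fin n) := fun k => WithLp.toLp 2 (fun j => (k j : ℝ))
  let R : (Fin n → ℤ) → Set (EuclideanSpace ℝ (Fin n)) := fun k => (fun x => x + t k) ⁻¹' Q
  have hRm : ∀ k, MeasurableSet (R k) := fun k => hQm.preimage (measurable_add_const _)
  have hdisj : Pairwise (Function.onFun Disjoint R) := by
    intro k l hkl
    rw [Function.onFun, Set.disjoint_left]
    intro x hx hy
    apply hkl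
    ext j
    have h1 := hx j
    have h2 := hy j
    simp only [t, PiLp.add_apply, Set.mem_Ico] at h1 h2
    have a : ((k j : ℝ)) < l j + 1 := by linarith
    have b : ((l j : ℝ)) < k j + 1 := by linarith
    norm_cast at a b
    omega
  have hsub : Q ⊆ ⋃ k, (fun x => x + (- t k)) ⁻¹' (R k ∩ S) := by
    intro x hx
    obtain ⟨z, hz, hxz⟩ := h x
    choose k hk using hz
    have hzk : z = t k := by ext j; simp [t, hk]
    refine Set.mem_iUnion.2 ⟨k, ?_, ?_⟩
    · simpa [R] using hx
    · simpa [← hzk, ← sub_eq_add_neg] using hxz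
  calc (1 : ENNReal) = volume Q := hQ.symm
    _ ≤ ∑' k, volume ((fun x => x + (- t k)) ⁻¹' (R k ∩ S)) :=
        (measure_mono hsub).trans (measure_iUnion_le _)
    _ = ∑' k, volume.restrict S (R k) := by
        congr 1; ext k
        rw [measure_preimage_add_right, Measure.restrict_apply (hRm k)]
    _ = volume.restrict S (⋃ k, R k) := (measure_iUnion hdisj hRm).symm
    _ ≤ volume S := by
        refine (measure_mono (Set.subset_univ _)).trans ?_
        simp

theorem span_lattice (n : ℕ) (K : Set (EuclideanSpace ℝ (Fin n))) (hc : IsCompact K)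
    (hconv : Convex ℝ K) (hs : ∀ x ∈ K, -x ∈ K) (hne : K.Nonempty) (μ : ℝ)
    (h : ∀ x, x ∈ μ • K + intLattice n) :
    (⊤ : Submodule ℝ (EuclideanSpace ℝ (Fin n))) ≤
      Submodule.span ℝ (intLattice n ∩ (2 * μ) • K) := by
  set V := Submodule.span ℝ (intLattice n ∩ (2 * μ) • K) with hV
  have hclosed : ∀ A ⊆ intLattice n, IsClosed (μ • K + A) := by
    intro A hA
    have : IsClosed A := by
      refine Metric.isClosed_of_pairwise_le_dist one_pos ?_
      intro x hx y hy hxy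
      obtain ⟨j, hj⟩ : ∃ j, x j ≠ y j := by
        by_contra! hh; exact hxy (by ext j; exact hh j)
      obtain ⟨a, ha⟩ := hA hx j
      obtain ⟨b, hb⟩ := hA hy j
      have h1 : |x j - y j| ≤ dist x y := by
        have := PiLp.norm_apply_le (x - y) j
        rwa [dist_eq_norm]
      refine le_trans ?_ h1
      rw [ha, hb] at hj ⊢
      have : a - b ≠ 0 := by
        intro h; apply hj; rw [sub_eq_zero.1 h]
      have h3 := Int.one_le_abs this
      have h4 : ((1 : ℤ) : ℝ) ≤ ((|a - b| : ℤ) : ℝ) := Int.cast_le.2 h3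
      simpa using h4
    exact this.add_left_of_isCompact (hc.smul μ)
  have hsub0 : ∀ x y, x ∈ intLattice n → y ∈ intLattice n → x - y ∈ intLattice n := by
    intro x y hx hy j
    obtain ⟨a, ha⟩ := hx j
    obtain ⟨b, hb⟩ := hy j
    exact ⟨a - b, by simp [ha, hb]⟩
  have hdiff : ∀ k ∈ K, ∀ k' ∈ K, μ • k - μ • k' ∈ (2 * μ) • K := by
    intro k hk k' hk'
    refine ⟨(1/2 : ℝ) • k + (1/2 : ℝ) • (-k'), hconv hk (hs _ hk') (by norm_num) (by norm_num)
      (by norm_num), ?_⟩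
    simp only [smul_add, smul_smul, smul_neg]
    rw [sub_eq_add_neg]
    congr 3 <;> ring
  -- the complement part is empty
  have hZV : intLattice n ⊆ V := by
    by_contra hcon
    obtain ⟨z, hz, hzV⟩ := Set.not_subset.1 hcon
    obtain ⟨k0, hk0⟩ := hne
    have hz0 : (0 : EuclideanSpace ℝ (Fin n)) ∈ intLattice n := fun j => ⟨0, by simp⟩
    have hpre := isPreconnected_closed_iff.1
      (isPreconnected_univ (α := EuclideanSpace ℝ (Fin n)))
      (μ • K + (intLattice n ∩ V)) (μ • K + (intLattice n \ V))
      (hclosed _ Set.inter_subset_left) (hclosed _ Set.sdiff_subset)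
      (by
        intro x _
        obtain ⟨a, ha, b, hb, rfl⟩ := h x
        by_cases hbV : b ∈ V
        · exact Or.inl (Set.add_mem_add ha ⟨hb, hbV⟩)
        · exact Or.inr (Set.add_mem_add ha ⟨hb, hbV⟩))
      ⟨μ • k0 + 0, trivial, Set.add_mem_add (Set.smul_mem_smul_set hk0) ⟨hz0, V.zero_mem⟩⟩
      ⟨μ • k0 + z, trivial, Set.add_mem_add (Set.smul_mem_smul_set hk0) ⟨hz, hzV⟩⟩
    obtain ⟨x, -, ⟨a, ⟨k, hk, rfl⟩, b, ⟨hb, hbV⟩, hab⟩, ⟨a', ⟨k', hk', rfl⟩, b', ⟨hb', hbV'⟩, hab'⟩⟩ := hpre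
    apply hbV'
    have e : b' - b = μ • k - μ • k' := by
      simp only at hab hab'
      rw [sub_eq_sub_iff_add_eq_add, add_comm, hab', hab]
    have : b' - b ∈ V := Submodule.subset_span ⟨hsub0 _ _ hb' hb, e ▸ hdiff k hk k' hk'⟩
    have := V.add_mem this hbV
    simpa using this
  have := (EuclideanSpace.basisFun (Fin n) ℝ).toBasis.span_eq
  rw [← this]
  rw [Submodule.span_le]
  rintro _ ⟨j, rfl⟩
  apply hZV
  intro l
  by_cases hjl : l = j
  · exact ⟨1, by simp [hjl]⟩
  · exact ⟨0, by simp [hjl]⟩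

theorem prod_volume_bound (i m : ℕ) (hi : 1 ≤ i) (K : Set ((Fin i → ℝ) × (Fin m → ℝ)))
    (hc : IsCompact K) (hconv : Convex ℝ K) (h0 : K ∈ nhds 0) (hs : ∀ x ∈ K, -x ∈ K)
    (μ : ℝ) (hμ : 0 < μ) (hz : ∀ z, gauge K (0, z) ≤ 2 * μ * ∑ j, |z j|) :
    (i.factorial : ENNReal) * volume (Prod.fst '' K) * ENNReal.ofReal (μ⁻¹ ^ m) ≤
      ((i + m).factorial : ENNReal) * volume K := by
  have : Nonempty (Fin i) := ⟨⟨0, hi⟩⟩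
  have hhaar : (volume : Measure ((Fin i → ℝ) × (Fin m → ℝ))).IsAddHaarMeasure := by
    rw [Measure.volume_eq_prod]; apply Measure.prod.instIsAddHaarMeasure
  have habs : Absorbent ℝ K := absorbent_nhds_zero h0
  set P := Prod.fst '' K with hP
  have hPc : IsCompact P := hc.image continuous_fst
  have hPconv : Convex ℝ P := hconv.linear_image (LinearMap.fst ℝ (Fin i → ℝ) (Fin m → ℝ))
  have hP0 : P ∈ nhds 0 := by
    have := (isOpenMap_fst (X := Fin i → ℝ) (Y := Fin m → ℝ)).image_mem_nhds h0
    exact this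
  have hPs : ∀ x ∈ P, -x ∈ P := by
    rintro _ ⟨x, hx, rfl⟩
    exact ⟨-x, hs x hx, rfl⟩
  have eK := lintegral_exp_gauge volume K hc hconv h0 hs
  have eP := lintegral_exp_gauge volume P hPc hPconv hP0 hPs
  have f1 : Module.finrank ℝ ((Fin i → ℝ) × (Fin m → ℝ)) = i + m := by simp
  have f2 : Module.finrank ℝ (Fin i → ℝ) = i := by simp
  rw [f1] at eK
  rw [f2] at eP
  rw [← eK, ← eP, Measure.volume_eq_prod]
  have hcont : Continuous (gauge K) := continuous_gauge hconv h0
  have hcontP : Continuous (gauge P) := continuous_gauge hPconv hP0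
  rw [lintegral_prod _ (by fun_prop)]
  rw [← lintegral_mul_const _ (by fun_prop)]
  apply lintegral_mono
  intro p
  have hlift : ∃ ζ : Fin m → ℝ, gauge K (p, ζ) ≤ gauge P p := by
    rcases (gauge_nonneg (s := P) p).eq_or_lt with h | h
    · have : p = 0 := (gauge_eq_zero (absorbent_nhds_zero hP0) (hPc.isVonNBounded ℝ)).1 h.symm
      refine ⟨0, ?_⟩
      rw [this]
      have : ((0, 0) : (Fin i → ℝ) × (Fin m → ℝ)) = 0 := rfl
      rw [this, gauge_zero]
      exact gauge_nonneg _
    · have : (gauge P p)⁻¹ • p ∈ P := by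
        have h2 : (gauge P p)⁻¹ • p ∈ closure P := by
          rw [← gauge_le_one_iff_mem_closure hPconv hP0,
            gauge_smul_of_nonneg (inv_nonneg.2 h.le), smul_eq_mul, inv_mul_cancel₀ h.ne']
        rwa [hPc.isClosed.closure_eq] at h2
      obtain ⟨⟨p', ζ⟩, hk, hk'⟩ := this
      refine ⟨gauge P p • ζ, gauge_le_of_mem h.le ⟨(p', ζ), hk, ?_⟩⟩
      simp only at hk'
      simp [hk', smul_smul, mul_inv_cancel₀ h.ne']
  obtain ⟨ζ, hζ⟩ := hlift
  have key : ∀ z, gauge K (p, z) ≤ gauge P p + 2 * μ * ∑ j, |(z - ζ) j| := by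
    intro z
    have : ((p, z) : (Fin i → ℝ) × (Fin m → ℝ)) = (p, ζ) + (0, z - ζ) := by simp
    rw [this]
    exact (gauge_add_le hconv habs _ _).trans (add_le_add hζ (hz _))
  calc ENNReal.ofReal (Real.exp (-gauge P p)) * ENNReal.ofReal (μ⁻¹ ^ m)
      = ENNReal.ofReal (Real.exp (-gauge P p)) *
        ∫⁻ z : Fin m → ℝ, ENNReal.ofReal (Real.exp (- (2 * μ * ∑ j, |(z - ζ) j|))) := by
        rw [lintegral_sub_right_eq_self
          (fun z : Fin m → ℝ => ENNReal.ofReal (Real.exp (- (2 * μ * ∑ j, |z j|)))) ζ,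
          lintegral_exp_l1 m μ hμ]
    _ = ∫⁻ z : Fin m → ℝ, ENNReal.ofReal (Real.exp (-gauge P p)) *
          ENNReal.ofReal (Real.exp (- (2 * μ * ∑ j, |(z - ζ) j|))) := by
        rw [lintegral_const_mul]
        simp only [Pi.sub_apply]
        fun_prop
    _ ≤ _ := by
        apply lintegral_mono
        intro z
        simp only
        rw [← ENNReal.ofReal_mul (Real.exp_pos _).le, ← Real.exp_add]
        apply ENNReal.ofReal_le_ofReal
        apply Real.exp_le_exp.2
        linarith [key z]

theorem core_bound (n i m : ℕ) (hi : 1 ≤ i) (hn : n = i + m) (K : Set (EuclideanSpace ℝ (Fin n)))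
    (hc : IsCompact K) (hconv : Convex ℝ K) (h0 : K ∈ nhds 0) (hs : ∀ x ∈ K, -x ∈ K)
    (μ : ℝ) (hμ : 0 < μ) (a : ℝ) (ha : 0 < a)
    (T : EuclideanSpace ℝ (Fin n) ≃L[ℝ] (Fin i → ℝ) × (Fin m → ℝ))
    (hT : ∀ j, T.symm (0, Pi.single j 1) ∈ intLattice n ∩ (2 * μ) • K)
    (hcov : ∀ L : AffineSubspace ℝ (EuclideanSpace ℝ (Fin n)),
      (L : Set (EuclideanSpace ℝ (Fin n))).Nonempty →
      Module.finrank ℝ L.direction = m →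
      ((a • K + intLattice n) ∩ (L : Set (EuclideanSpace ℝ (Fin n)))).Nonempty) :
    (i.factorial : ENNReal) * ENNReal.ofReal (μ⁻¹ ^ m) ≤
      ENNReal.ofReal (a ^ i) * (n.factorial * volume K) := by
  set K' : Set ((Fin i → ℝ) × (Fin m → ℝ)) := T '' K with hK'
  have hc' : IsCompact K' := hc.image T.continuous
  have hconv' : Convex ℝ K' := hconv.linear_image T.toLinearEquiv.toLinearMap
  have h0' : K' ∈ nhds 0 := by
    have := T.toHomeomorph.isOpenMap.image_mem_nhds h0
    simpa using this
  have hs' : ∀ x ∈ K', -x ∈ K' := by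
    rintro _ ⟨x, hx, rfl⟩
    exact ⟨-x, hs x hx, by simp⟩
  have hdecomp : ∀ z : Fin m → ℝ, ((0, z) : (Fin i → ℝ) × (Fin m → ℝ)) =
      ∑ j, z j • ((0, Pi.single j 1) : (Fin i → ℝ) × (Fin m → ℝ)) := by
    intro z
    ext k
    · simp [Prod.fst_sum]
    · simp [Prod.snd_sum, Finset.sum_apply, Pi.single_apply]
  have hz' : ∀ z, gauge K' (0, z) ≤ 2 * μ * ∑ j, |z j| := by
    intro z
    rw [hdecomp z]
    refine (gauge_sum_le hconv' (absorbent_nhds_zero h0') _ _).trans ?_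
    rw [Finset.mul_sum]
    apply Finset.sum_le_sum
    intro j _
    refine (gauge_smul_le_abs K' hs' _ _).trans ?_
    rw [mul_comm]
    refine mul_le_mul_of_nonneg_right ?_ (abs_nonneg _)
    apply gauge_le_of_mem (by positivity)
    obtain ⟨k, hk, hk'⟩ := (hT j).2
    refine ⟨T k, ⟨k, hk, rfl⟩, ?_⟩
    simp only at hk'
    change (2 * μ) • T k = _
    rw [← map_smul, hk', ContinuousLinearEquiv.apply_symm_apply]
  have hlat : ∀ f : Fin m → ℤ, T.symm (0, fun j => (f j : ℝ)) ∈ intLattice n := by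
    intro f l
    rw [hdecomp, map_sum]
    choose g hg using fun j => (hT j).1 l
    refine ⟨∑ j, f j * g j, ?_⟩
    simp only [map_smul, WithLp.ofLp_sum, Finset.sum_apply, PiLp.smul_apply, hg, smul_eq_mul]
    push_cast
    rfl
  have hbound := prod_volume_bound i m hi K' hc' hconv' h0' hs' μ hμ hz'
  have hhaar : (volume : Measure ((Fin i → ℝ) × (Fin m → ℝ))).IsAddHaarMeasure := by
    rw [Measure.volume_eq_prod]; apply Measure.prod.instIsAddHaarMeasure
  obtain ⟨c, hcν⟩ : ∃ c : NNReal, (volume : Measure (EuclideanSpace ℝ (Fin n))).map T = c • volume :=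
    ⟨_, Measure.isAddLeftInvariant_eq_smul _ _⟩
  have hmap : ∀ S, volume (T ⁻¹' S) = c * volume S := by
    intro S
    have e := T.toHomeomorph.toMeasurableEquiv.map_apply (μ := volume) S
    have e2 : (volume : Measure (EuclideanSpace ℝ (Fin n))).map T.toHomeomorph.toMeasurableEquiv
      = c • volume := hcν
    rw [e2] at e
    exact e.symm
  have hvK : volume K = c * volume K' := by
    rw [← hmap, hK', Set.preimage_image_eq _ T.injective]
  set P := Prod.fst '' K' with hP
  have hcover : 1 ≤ c * (ENNReal.ofReal (a ^ i) * volume P) := by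
    have h1 := one_le_volume_of_cover n
      (T ⁻¹' ((a • P) ×ˢ (Set.pi Set.univ fun _ : Fin m => Set.Ico (0:ℝ) 1))) ?_
    · rw [hmap, Measure.volume_eq_prod, Measure.prod_prod, volume_pi_pi,
        Measure.addHaar_smul] at h1
      simpa [abs_of_pos ha] using h1
    · intro x
      let φ : EuclideanSpace ℝ (Fin n) →ₗ[ℝ] (Fin i → ℝ) :=
        LinearMap.fst ℝ (Fin i → ℝ) (Fin m → ℝ) ∘ₗ T.toLinearEquiv.toLinearMap
      have hφ : ∀ y, φ y = (T y).1 := fun y => rfl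
      have hsurj : LinearMap.range φ = ⊤ := by
        rw [LinearMap.range_eq_top]
        intro p
        exact ⟨T.symm (p, 0), by simp [hφ]⟩
      have hker : Module.finrank ℝ (LinearMap.ker φ) = m := by
        have := LinearMap.finrank_range_add_finrank_ker φ
        rw [hsurj] at this
        simp at this
        omega
      obtain ⟨y, ⟨_, ⟨k, hk, rfl⟩, z, hz, rfl⟩, hyL⟩ :=
        hcov (AffineSubspace.mk' x (LinearMap.ker φ)) ⟨x, AffineSubspace.self_mem_mk' _ _⟩
          (by rw [AffineSubspace.direction_mk', hker])
      have hy : φ (a • k + z) = φ x := by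
        have : (a • k + z) -ᵥ x ∈ LinearMap.ker φ := by
          simpa using hyL
        rw [LinearMap.mem_ker, vsub_eq_sub, map_sub, sub_eq_zero] at this
        exact this
      let f : Fin m → ℤ := fun j => ⌊(T (x - z)).2 j⌋
      refine ⟨z + T.symm (0, fun j => (f j : ℝ)), ?_, ?_, ?_⟩
      · intro j
        obtain ⟨u, hu⟩ := hz j
        obtain ⟨v, hv⟩ := hlat f j
        exact ⟨u + v, by simp [hu, hv]⟩
      · refine ⟨(T k).1, ⟨T k, ⟨k, hk, rfl⟩, rfl⟩, ?_⟩
        have : a • (T k).1 + (T z).1 = (T x).1 := by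
          rw [← hφ, ← hφ, ← hφ, ← hy]; simp
        simp [← this]
      · intro j _
        have e : (T (x - (z + T.symm (0, fun j => (f j : ℝ))))).2 j = (T (x - z)).2 j - f j := by
          rw [← sub_sub, map_sub T (x - z)]
          simp
        rw [e]
        exact ⟨sub_nonneg.2 (Int.floor_le _), by linarith [Int.lt_floor_add_one ((T (x - z)).2 j)]⟩
  calc (i.factorial : ENNReal) * ENNReal.ofReal (μ⁻¹ ^ m)
      = 1 * ((i.factorial : ENNReal) * ENNReal.ofReal (μ⁻¹ ^ m)) := (one_mul _).symm
    _ ≤ (c * (ENNReal.ofReal (a ^ i) * volume P)) *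
        ((i.factorial : ENNReal) * ENNReal.ofReal (μ⁻¹ ^ m)) := by gcongr
    _ = ENNReal.ofReal (a ^ i) * c *
        ((i.factorial : ENNReal) * volume P * ENNReal.ofReal (μ⁻¹ ^ m)) := by ring
    _ ≤ ENNReal.ofReal (a ^ i) * c * (((i + m).factorial : ENNReal) * volume K') := by gcongr
    _ = _ := by rw [hvK, hn]; ring

/-- The set of admissible dilation factors in the definition of `covMin`. -/
def covSet (n i : ℕ) (K : Set (EuclideanSpace ℝ (Fin n))) : Set ℝ :=
  {μ : ℝ | 0 < μ ∧ ∀ L : AffineSubspace ℝ (EuclideanSpace ℝ (Fin n)),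
    (L : Set (EuclideanSpace ℝ (Fin n))).Nonempty →
    Module.finrank ℝ L.direction = n - i →
    ((μ • K + intLattice n) ∩ (L : Set (EuclideanSpace ℝ (Fin n)))).Nonempty}

theorem covSet_cover (n : ℕ) (K : Set (EuclideanSpace ℝ (Fin n))) (μ : ℝ)
    (h : μ ∈ covSet n n K) (x : EuclideanSpace ℝ (Fin n)) : x ∈ μ • K + intLattice n := by
  obtain ⟨y, hy, hyL⟩ := h.2 (AffineSubspace.mk' x ⊥) ⟨x, AffineSubspace.self_mem_mk' _ _⟩
    (by rw [AffineSubspace.direction_mk']; simp)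
  have : y - x = 0 := by simpa using hyL
  rw [sub_eq_zero] at this
  rwa [← this]

theorem covSet_mono (n i : ℕ) (K : Set (EuclideanSpace ℝ (Fin n))) (hconv : Convex ℝ K)
    (h0 : (0 : EuclideanSpace ℝ (Fin n)) ∈ K) {μ ν : ℝ} (h : μ ∈ covSet n i K) (hμν : μ ≤ ν) :
    ν ∈ covSet n i K := by
  refine ⟨h.1.trans_le hμν, fun L hL hd => (h.2 L hL hd).mono ?_⟩
  refine Set.inter_subset_inter_left _ (Set.add_subset_add_right ?_)
  rintro _ ⟨k, hk, rfl⟩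
  have hν : 0 < ν := h.1.trans_le hμν
  refine ⟨(μ / ν) • k, hconv.smul_mem_of_zero_mem h0 hk
    ⟨(div_pos h.1 hν).le, (div_le_one hν).2 hμν⟩, ?_⟩
  simp only [smul_smul]
  rw [mul_div_cancel₀ _ hν.ne']

theorem covSet_n_sub (n i : ℕ) (K : Set (EuclideanSpace ℝ (Fin n))) :
    covSet n n K ⊆ covSet n i K := by
  intro μ h
  refine ⟨h.1, fun L ⟨x, hx⟩ _ => ⟨x, covSet_cover n K μ h x, hx⟩⟩

theorem covSet_sub_one (n i : ℕ) (hi : 1 ≤ i) (K : Set (EuclideanSpace ℝ (Fin n))) :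
    covSet n i K ⊆ covSet n 1 K := by
  intro μ h
  refine ⟨h.1, fun L ⟨x, hx⟩ hd => ?_⟩
  obtain ⟨W, hW, hWd⟩ : ∃ W : Submodule ℝ (EuclideanSpace ℝ (Fin n)), W ≤ L.direction ∧
      Module.finrank ℝ W = n - i := by
    obtain ⟨f, hf⟩ := exists_linearIndependent_of_le_finrank (R := ℝ) (M := L.direction)
      (n := n - i) (by omega)
    have hf' := hf.map' L.direction.subtype (Submodule.ker_subtype _)
    refine ⟨Submodule.span ℝ (Set.range (L.direction.subtype ∘ f)), ?_, ?_⟩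
    · rw [Submodule.span_le]
      rintro _ ⟨j, rfl⟩
      exact (f j).2
    · rw [finrank_span_eq_card hf']
      simp
  obtain ⟨y, hy, hyL⟩ := h.2 (AffineSubspace.mk' x W) ⟨x, AffineSubspace.self_mem_mk' _ _⟩
    (by rw [AffineSubspace.direction_mk', hWd])
  refine ⟨y, hy, ?_⟩
  have h1 : y -ᵥ x ∈ W := by simpa using hyL
  have := AffineSubspace.vadd_mem_of_mem_direction (hW h1) hx
  simpa using this

theorem covSet_nonempty (n : ℕ) (K : Set (EuclideanSpace ℝ (Fin n))) 
    (h0 : K ∈ nhds (0 : EuclideanSpace ℝ (Fin n))) : (covSet n n K).Nonempty := by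
  obtain ⟨r, hr, hrK⟩ := Metric.mem_nhds_iff.1 h0
  refine ⟨(n + 1) / r, by positivity, ?_⟩
  rintro L ⟨x, hx⟩ -
  refine ⟨x, ?_, hx⟩
  let z : EuclideanSpace ℝ (Fin n) := WithLp.toLp 2 (fun j => (⌊x j⌋ : ℝ))
  have hz : z ∈ intLattice n := fun j => ⟨⌊x j⌋, rfl⟩
  have hnorm : ‖x - z‖ ≤ n := by
    have e : x - z = ∑ j, (x - z) j • EuclideanSpace.single j (1 : ℝ) := by
      ext k
      simp [Pi.single_apply]
    rw [e]
    refine (norm_sum_le _ _).trans ?_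
    have : ∀ j ∈ Finset.univ, ‖(x - z) j • EuclideanSpace.single j (1 : ℝ)‖ ≤ (1 : ℝ) := by
      intro j _
      rw [norm_smul]
      simp only [PiLp.norm_single, norm_one, mul_one, PiLp.sub_apply, z]
      rw [Real.norm_eq_abs, abs_of_nonneg (sub_nonneg.2 (Int.floor_le _))]
      linarith [Int.lt_floor_add_one (x j)]
    refine (Finset.sum_le_sum this).trans ?_
    simp
  have hp : (0 : ℝ) < (n + 1) / r := by positivity
  refine ⟨x - z, ?_, z, hz, by simp⟩
  rw [Set.mem_smul_set_iff_inv_smul_mem₀ hp.ne']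
  apply hrK
  rw [mem_ball_zero_iff, norm_smul, Real.norm_of_nonneg (by positivity), inv_div,
    div_mul_eq_mul_div, div_lt_iff₀ (by positivity)]
  nlinarith

theorem covSet_bound (n i : ℕ) (hi : 1 ≤ i) (hi2 : i ≤ n) (K : Set (EuclideanSpace ℝ (Fin n)))
    (hc : IsCompact K) (hconv : Convex ℝ K) (h0 : K ∈ nhds 0) (hs : ∀ x ∈ K, -x ∈ K)
    (μ a : ℝ) (hμ : μ ∈ covSet n n K) (ha : a ∈ covSet n i K) :
    (i.factorial : ℝ) ≤ a ^ i * μ ^ (n - i) * (n.factorial * (volume K).toReal) := by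
  have hspan := span_lattice n K hc hconv hs ⟨0, mem_of_mem_nhds h0⟩ μ (covSet_cover n K μ hμ)
  let b0 := Module.Basis.ofSpan hspan
  have hb0 : ∀ k, b0 k ∈ intLattice n ∩ (2 * μ) • K :=
    fun k => Module.Basis.ofSpan_subset hspan ⟨k, rfl⟩
  have hfin : Finite ((linearIndepOn_empty ℝ id).extend
      (Set.empty_subset (intLattice n ∩ (2 * μ) • K))) :=
    Module.Finite.finite_basis b0
  have := Fintype.ofFinite ((linearIndepOn_empty ℝ id).extend
      (Set.empty_subset (intLattice n ∩ (2 * μ) • K)))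
  have hcard := Module.finrank_eq_card_basis b0
  have e : ((linearIndepOn_empty ℝ id).extend
      (Set.empty_subset (intLattice n ∩ (2 * μ) • K))) ≃ Fin i ⊕ Fin (n - i) := by
    apply Fintype.equivOfCardEq
    rw [← hcard]
    simp
    omega
  let b := b0.reindex e
  let T := (b.equivFun.trans
    (LinearEquiv.sumArrowLequivProdArrow (Fin i) (Fin (n - i)) ℝ ℝ)).toContinuousLinearEquiv
  have hT : ∀ j, T.symm (0, Pi.single j 1) ∈ intLattice n ∩ (2 * μ) • K := by
    intro j
    have : T.symm (0, Pi.single j 1) = b0 (e.symm (Sum.inr j)) := by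
      rw [ContinuousLinearEquiv.symm_apply_eq]
      have hb : b0 (e.symm (Sum.inr j)) = b (Sum.inr j) := by simp [b]
      rw [hb]
      change _ = (LinearEquiv.sumArrowLequivProdArrow (Fin i) (Fin (n - i)) ℝ ℝ)
        (b.equivFun (b (Sum.inr j)))
      ext k
      · simp
      · simp [Finsupp.single_apply, Pi.single_apply, eq_comm]
    rw [this]
    exact hb0 _
  have hcore := core_bound n i (n - i) hi (by omega) K hc hconv h0 hs μ hμ.1 a ha.1 T hT ha.2
  have hfinK : volume K ≠ ⊤ := hc.measure_lt_top.ne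
  have h2 := ENNReal.toReal_mono (by finiteness) hcore
  have hμ0 := hμ.1
  have ha0 := ha.1
  simp only [ENNReal.toReal_mul, ENNReal.toReal_natCast] at h2
  rw [ENNReal.toReal_ofReal (by positivity), ENNReal.toReal_ofReal (by positivity)] at h2
  rw [inv_pow, ← div_eq_mul_inv, div_le_iff₀ (by positivity)] at h2
  linarith

/-- If `K` is an `o`-symmetric convex body in `ℝⁿ`, `1 ≤ i ≤ n`, and `F > 0` is a constant
with `μ_n(K) ≤ F·μ_1(K)`, then `μ_i(K)ⁿ·vol(K) ≥ (i!/n!)·F^{-(n-i)}`. -/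
theorem covMin_pow_mul_volume_ge (n : ℕ) (hn : 1 ≤ n) (K : Set (EuclideanSpace ℝ (Fin n)))
    (hKcpt : IsCompact K) (hKconv : Convex ℝ K) (hKint : (interior K).Nonempty)
    (hKsym : K = -K) (i : ℕ) (hi1 : 1 ≤ i) (hi2 : i ≤ n)
    (F : ℝ) (hF : 0 < F) (hflat : covMin n n K ≤ F * covMin n 1 K) :
    covMin n i K ^ n * (volume K).toReal ≥
      (Nat.factorial i : ℝ) / (Nat.factorial n : ℝ) / F ^ (n - i) := by
  have hs : ∀ x ∈ K, -x ∈ K := by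
    intro x hx
    rw [hKsym]
    simpa using hx
  have h0 : K ∈ nhds (0 : EuclideanSpace ℝ (Fin n)) := by
    obtain ⟨x, hx⟩ := hKint
    have hx' : -x ∈ K := hs x (interior_subset hx)
    have := hKconv.combo_interior_self_mem_interior hx hx' (a := 1/2) (b := 1/2)
      (by norm_num) (by norm_num) (by norm_num)
    rw [smul_neg, add_neg_cancel] at this
    exact mem_interior_iff_mem_nhds.1 this
  have h00 : (0 : EuclideanSpace ℝ (Fin n)) ∈ K := mem_of_mem_nhds h0
  have hbdd : ∀ j, BddBelow (covSet n j K) := fun j => ⟨0, fun μ hμ => hμ.1.le⟩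
  have hnen := covSet_nonempty n K h0
  have hnei : (covSet n i K).Nonempty := hnen.mono (covSet_n_sub n i K)
  have hmem : ∀ j, (covSet n j K).Nonempty → ∀ a, covMin n j K < a → a ∈ covSet n j K := by
    intro j hne a ha
    obtain ⟨b, hb, hba⟩ := exists_lt_of_csInf_lt hne ha
    exact covSet_mono n j K hKconv h00 hb hba.le
  set V := (volume K).toReal with hV
  have key : ∀ a, covMin n i K < a → (i.factorial : ℝ) ≤
      a ^ i * (F * a) ^ (n - i) * (n.factorial * V) := by
    intro a ha
    have haS := hmem i hnei a ha
    have ha1 : covMin n 1 K ≤ a := csInf_le (hbdd 1) (covSet_sub_one n i hi1 K haS)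
    have haF : covMin n n K ≤ F * a := hflat.trans (mul_le_mul_of_nonneg_left ha1 hF.le)
    have ht : ∀ s, F * a < s →
        (i.factorial : ℝ) ≤ a ^ i * s ^ (n - i) * (n.factorial * V) := fun s hs' =>
      covSet_bound n i hi1 hi2 K hKcpt hKconv h0 hs s a (hmem n hnen s (haF.trans_lt hs')) haS
    have hcont : Continuous fun s : ℝ => a ^ i * s ^ (n - i) * (n.factorial * V) := by fun_prop
    exact ge_of_tendsto ((hcont.tendsto (F * a)).mono_left (nhdsWithin_le_nhds (s := Set.Ioi (F * a))))
      (Filter.eventually_of_mem self_mem_nhdsWithin ht)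
  have hcont : Continuous fun a : ℝ => a ^ i * (F * a) ^ (n - i) * (n.factorial * V) := by fun_prop
  have hfin : (i.factorial : ℝ) ≤
      covMin n i K ^ i * (F * covMin n i K) ^ (n - i) * (n.factorial * V) :=
    ge_of_tendsto ((hcont.tendsto _).mono_left (nhdsWithin_le_nhds (s := Set.Ioi (covMin n i K))))
      (Filter.eventually_of_mem self_mem_nhdsWithin key)
  have hpow : covMin n i K ^ n = covMin n i K ^ i * covMin n i K ^ (n - i) := by
    rw [← pow_add]; congr 1; omega
  have hnf : (0 : ℝ) < n.factorial := by positivity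
  have hFp : (0 : ℝ) < F ^ (n - i) := by positivity
  rw [ge_iff_le, div_div, div_le_iff₀ (by positivity), hpow]
  rw [mul_pow] at hfin
  linarith
end

section
/- For every convex body K in ℝ^n, the covering product satisfies μ_1(K) · μ_2(K) · … · μ_n(K) · vol(K) ≥ 1/n!. -/
open MeasureTheory Pointwise

/-- A nonzero integer vector is a multiple of a member of a lattice basis. -/
lemma cp_basis {n : ℕ} (v : Fin n → ℤ) (hv : v ≠ 0) :
    ∃ (b : Module.Basis (Fin n) ℤ (Fin n → ℤ)) (j : Fin n) (a : ℤ), a ≠ 0 ∧ v = a • b j := by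
  obtain ⟨k, s⟩ := Submodule.smithNormalForm (Pi.basisFun ℤ (Fin n)) (Submodule.span ℤ {v})
  have hk : k = 1 := by
    have h1 := Module.finrank_eq_card_basis s.bN
    rw [← (LinearEquiv.toSpanNonzeroSingleton ℤ (Fin n → ℤ) v hv).finrank_eq,
      Module.finrank_self] at h1
    simpa using h1.symm
  subst hk
  have hmem : v ∈ Submodule.span ℤ {v} := Submodule.mem_span_singleton_self v
  have h2 := s.bN.sum_repr ⟨v, hmem⟩
  have h3 := congrArg Subtype.val h2
  simp only [Finset.univ_unique, Finset.sum_singleton, Submodule.coe_smul, s.snf, smul_smul] at h3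
  refine ⟨s.bM, _, _, ?_, h3.symm⟩
  intro h0
  rw [h0, zero_smul] at h3
  exact hv h3.symm

lemma cp_split (n : ℕ) (v : Fin (n + 1) → ℤ) (hv : v ≠ 0) :
    ∃ (A : EuclideanSpace ℝ (Fin (n + 1)) →ₗ[ℝ] ℝ × EuclideanSpace ℝ (Fin n)) (a : ℤ),
      a ≠ 0 ∧ A (WithLp.toLp 2 fun i => (v i : ℝ)) = ((a : ℝ), 0) ∧ MeasurePreserving A ∧
      Function.Bijective A ∧ ∀ z ∈ intLattice (n + 1), (A z).2 ∈ intLattice n := by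
  obtain ⟨b, j, a, ha, hva⟩ := cp_basis v hv
  let P : Matrix (Fin (n + 1)) (Fin (n + 1)) ℤ := LinearMap.toMatrix' b.equivFun.toLinearMap
  have hP : IsUnit P.det := by
    have := LinearEquiv.isUnit_det' b.equivFun
    rwa [← LinearMap.det_toMatrix'] at this
  let Q : Matrix (Fin (n + 1)) (Fin (n + 1)) ℝ := P.map (Int.castRingHom ℝ)
  have hQdet : Q.det = ((P.det : ℤ) : ℝ) := by
    have := (Int.castRingHom ℝ).map_det P
    exact this.symm
  have hQabs : |Q.det| = 1 := by
    rw [hQdet]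
    rcases Int.isUnit_iff.1 hP with h | h <;> simp [h]
  have hQ0 : Q.det ≠ 0 := by
    intro h; rw [h] at hQabs; simp at hQabs
  have hQint : ∀ w : Fin (n + 1) → ℤ, Q.mulVec (fun i => (w i : ℝ)) =
      fun i => ((b.equivFun w i : ℤ) : ℝ) := by
    intro w
    have h1 : P.mulVec w = b.equivFun w := by
      have := LinearMap.toMatrix'_mulVec b.equivFun.toLinearMap w
      simpa [P] using this
    rw [← h1]
    ext i
    simp [Matrix.mulVec, dotProduct, Q]
  let S : (Fin (n + 1) → ℝ) →ₗ[ℝ] ℝ × EuclideanSpace ℝ (Fin n) :=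
    { toFun := fun x => (x j, WithLp.toLp 2 fun i => x (j.succAbove i))
      map_add' := fun x y => rfl
      map_smul' := fun c x => rfl }
  have hS1 : ∀ x, (S x).1 = x j := fun x => rfl
  have hS2 : ∀ x i, (S x).2 i = x (j.succAbove i) := fun x i => rfl
  let A : EuclideanSpace ℝ (Fin (n + 1)) →ₗ[ℝ] ℝ × EuclideanSpace ℝ (Fin n) :=
    S ∘ₗ Matrix.toLin' Q ∘ₗ (WithLp.linearEquiv 2 ℝ (Fin (n + 1) → ℝ)).toLinearMap
  have hA : ∀ x, A x = S (Q.mulVec x.ofLp) := fun x => rfl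
  have hSmp : MeasurePreserving S := by
    have h1 := volume_preserving_piFinSuccAbove (fun _ : Fin (n + 1) => ℝ) j
    have h2 : MeasurePreserving (Prod.map (id : ℝ → ℝ)
        (WithLp.toLp 2 : (Fin n → ℝ) → EuclideanSpace ℝ (Fin n))) :=
      (MeasurePreserving.id _).prod (PiLp.volume_preserving_toLp (Fin n))
    exact h2.comp h1
  have hQmp : MeasurePreserving (Matrix.toLin' Q) := by
    refine ⟨(LinearMap.continuous_of_finiteDimensional _).measurable, ?_⟩
    rw [Real.map_matrix_volume_pi_eq_smul_volume_pi hQ0, abs_inv, hQabs]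
    simp
  have hAmp : MeasurePreserving A :=
    hSmp.comp (hQmp.comp (PiLp.volume_preserving_ofLp (Fin (n + 1))))
  refine ⟨A, a, ha, ?_, hAmp, ?_, ?_⟩
  · rw [hA]
    simp only [hQint]
    have : b.equivFun v = Pi.single j a := by
      rw [hva, map_smul]
      ext i
      simp [Finsupp.single_apply, Pi.single_apply, eq_comm]
    rw [this]
    ext i <;> simp [hS1, hS2]
  · have hS : Function.Bijective S := by
      constructor
      · intro x y hxy
        have h1 := congrArg Prod.fst hxy
        have h2 := congrArg Prod.snd hxy
        ext i
        rcases Fin.eq_self_or_eq_succAbove j i with rfl | ⟨i', rfl⟩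
        · exact h1
        · exact congrFun (congrArg WithLp.ofLp h2) i'
      · rintro ⟨c, y⟩
        refine ⟨Fin.insertNth j c y.ofLp, ?_⟩
        ext i <;> simp [hS1, hS2]
    have hQb : Function.Bijective (Matrix.toLin' Q) := by
      have hu : IsUnit Q := (Matrix.isUnit_iff_isUnit_det _).2 (isUnit_iff_ne_zero.2 hQ0)
      exact ⟨Matrix.mulVec_injective_of_isUnit hu, Matrix.mulVec_surjective_iff_isUnit.2 hu⟩
    exact hS.comp (hQb.comp (WithLp.linearEquiv 2 ℝ (Fin (n + 1) → ℝ)).bijective)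
  · intro z hz
    choose w hw using hz
    have hz' : z.ofLp = fun i => (w i : ℝ) := funext hw
    intro i
    refine ⟨b.equivFun w (j.succAbove i), ?_⟩
    rw [hA, hz', hQint]
    rfl

lemma cp_integral (n : ℕ) (l : ℝ) (hl : 0 < l) :
    ∫⁻ t in Set.Ioo 0 l, ENNReal.ofReal ((1 - t / l) ^ n) = ENNReal.ofReal (l / (n + 1)) := by
  have hi : ∫ t in (0 : ℝ)..l, (1 - t / l) ^ n = l / (n + 1) := by
    have hd : ∀ t ∈ Set.uIcc 0 l,
        HasDerivAt (fun t => -(l / (n + 1)) * (1 - t / l) ^ (n + 1)) ((1 - t / l) ^ n) t := by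
      intro t _
      have h := ((((hasDerivAt_id t).div_const l).const_sub 1).pow (n + 1)).const_mul
        (-(l / ((n : ℝ) + 1)))
      refine h.congr_deriv ?_
      have : (n : ℝ) + 1 ≠ 0 := by positivity
      push_cast
      simp
      field_simp
    rw [intervalIntegral.integral_eq_sub_of_hasDerivAt hd
      (Continuous.intervalIntegrable (by fun_prop) _ _)]
    simp [hl.ne']
  rw [← hi, intervalIntegral.integral_of_le hl.le, integral_Ioc_eq_integral_Ioo,
    ofReal_integral_eq_lintegral_ofReal]
  · exact ((Continuous.integrableOn_Icc (by fun_prop)).mono_set Set.Ioo_subset_Icc_self)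
  · refine (ae_restrict_iff' measurableSet_Ioo).2 (Filter.Eventually.of_forall fun t ht => ?_)
    have : t / l ≤ 1 := (div_le_one hl).2 ht.2.le
    exact pow_nonneg (by linarith) _

lemma cp_volume {n : ℕ} (C : Set (ℝ × EuclideanSpace ℝ (Fin n))) (hc : IsCompact C)
    (hconv : Convex ℝ C) (x l : ℝ) (hl : 0 < l) (p : EuclideanSpace ℝ (Fin n))
    (h1 : (x, p) ∈ C) (h2 : (x + l, p) ∈ C) :
    ENNReal.ofReal (l / (n + 1)) * volume (Prod.snd '' C) ≤ volume C := by
  have hslice : ∀ y : EuclideanSpace ℝ (Fin n), volume ((fun x : ℝ => (x, y)) ⁻¹' C) ≠ ⊤ := by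
    intro y
    have : ((fun x : ℝ => (x, y)) ⁻¹' C) ⊆ Prod.fst '' C := fun x hx => ⟨(x, y), hx, rfl⟩
    exact ne_top_of_le_ne_top (hc.image continuous_fst).measure_lt_top.ne (measure_mono this)
  have hmeas : Measurable fun y : EuclideanSpace ℝ (Fin n) =>
      volume ((fun x : ℝ => (x, y)) ⁻¹' C) := measurable_measure_prodMk_right hc.measurableSet
  set f : EuclideanSpace ℝ (Fin n) → ℝ := fun y => (volume ((fun x : ℝ => (x, y)) ⁻¹' C)).toReal
    with hf
  have hvol : volume C = ∫⁻ y, ENNReal.ofReal (f y) := by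
    rw [Measure.volume_eq_prod, Measure.prod_apply_symm hc.measurableSet]
    refine lintegral_congr fun y => ?_
    rw [hf, ENNReal.ofReal_toReal (hslice y)]
  rw [hvol, lintegral_eq_lintegral_meas_le volume
    (Filter.Eventually.of_forall fun y => ENNReal.toReal_nonneg) hmeas.ennreal_toReal.aemeasurable,
    ← cp_integral n l hl, ← lintegral_mul_const']
  swap
  · exact (hc.image continuous_snd).measure_lt_top.ne
  refine le_trans (setLIntegral_mono' measurableSet_Ioo (g := fun t => volume {a | t ≤ f a}) ?_)
    (lintegral_mono_set Set.Ioo_subset_Ioi_self)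
  intro t ht
  have hs0 : 0 < t / l := div_pos ht.1 hl
  have hs1 : t / l < 1 := (div_lt_one hl).2 ht.2
  have hh := Measure.addHaar_image_homothety (volume : Measure (EuclideanSpace ℝ (Fin n))) p
    (1 - t / l) (Prod.snd '' C)
  rw [finrank_euclideanSpace_fin, abs_of_nonneg (pow_nonneg (by linarith) _)] at hh
  rw [← hh]
  refine measure_mono ?_
  rintro _ ⟨_, ⟨⟨w, y⟩, hwy, rfl⟩, rfl⟩
  have key : Set.Icc ((1 - t / l) * w + t / l * x) ((1 - t / l) * w + t / l * x + t) ⊆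
      (fun x : ℝ => (x, AffineMap.homothety p (1 - t / l) y)) ⁻¹' C := by
    intro u hu
    have hsl : t / l * l = t := by field_simp
    set r := (u - ((1 - t / l) * w + t / l * x)) / t with hr
    have hr0 : 0 ≤ r := div_nonneg (by linarith [hu.1]) ht.1.le
    have hr1 : r ≤ 1 := (div_le_one ht.1).2 (by linarith [hu.2])
    have hm : (x + r * l, p) ∈ C := by
      have := hconv h1 h2 (sub_nonneg.2 hr1) hr0 (by ring)
      convert this using 1
      ext
      · simp; ring
      · simp [← add_smul]
    have := hconv hwy hm (by linarith : 0 ≤ 1 - t / l) hs0.le (by ring)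
    show (u, _) ∈ C
    convert this using 1
    refine Prod.ext ?_ ?_
    · have : r * t = u - ((1 - t / l) * w + t / l * x) := by
        rw [hr]; field_simp [ht.1.ne']
      have h4 : t / l * (r * l) = r * t := by field_simp
      simp only [Prod.fst_add, Prod.smul_fst, smul_eq_mul]
      linarith
    · simp only [AffineMap.homothety_apply, vsub_eq_sub, vadd_eq_add, Prod.snd_add, Prod.smul_snd]
      module
  have h5 := measure_mono (μ := volume) key
  rw [Real.volume_Icc] at h5
  have h6 := ENNReal.toReal_mono (hslice _) h5
  rw [ENNReal.toReal_ofReal (by linarith [ht.1])] at h6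
  show t ≤ f _
  rw [hf]
  linarith

lemma cp_closed (n : ℕ) : IsClosed (intLattice n \ {0}) := by
  have h1 : intLattice n \ {0} = (⋂ j, {x | x j ∈ Set.range ((↑) : ℤ → ℝ)}) ∩
      ⋃ j, {x | 1 ≤ |x j|} := by
    ext x
    simp only [intLattice, Set.mem_sdiff, Set.mem_ofPred_eq, Set.mem_singleton_iff, Set.mem_inter_iff,
      Set.mem_iInter, Set.mem_iUnion, Set.mem_range]
    constructor
    · rintro ⟨h, h0⟩
      refine ⟨fun j => (h j).imp fun m hm => hm.symm, ?_⟩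
      by_contra! hcon
      apply h0
      ext j
      obtain ⟨m, hm⟩ := h j
      have := hcon j
      rw [hm] at this ⊢
      have h2 : |m| < 1 := by exact_mod_cast this
      simp [Int.abs_lt_one_iff.1 h2]
    · rintro ⟨h, j, hj⟩
      refine ⟨fun j => (h j).imp fun m hm => hm.symm, ?_⟩
      rintro rfl
      norm_num at hj
  rw [h1]
  have hc : ∀ j : Fin n, Continuous fun x : EuclideanSpace ℝ (Fin n) => x j := by
    intro j; fun_prop
  refine IsClosed.inter (isClosed_iInter fun j => ?_) (isClosed_iUnion_of_finite fun j => ?_)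
  · exact (Int.isClosedEmbedding_coe_real.isClosed_range).preimage (hc j)
  · exact isClosed_le continuous_const (hc j).abs

lemma cp_overlap {n : ℕ} (K : Set (EuclideanSpace ℝ (Fin (n + 1)))) (hc : IsCompact K)
    (hne : K.Nonempty) (m : ℝ) (hcov : m • K + intLattice (n + 1) = Set.univ) :
    ∃ z ∈ intLattice (n + 1), z ≠ 0 ∧ ∃ k₁ ∈ K, ∃ k₂ ∈ K, z = m • (k₁ - k₂) := by
  by_contra! hcon
  have hC : IsCompact (m • K) := hc.smul m
  have hU : IsClosed (m • K + (intLattice (n + 1) \ {0})) := by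
    have := (cp_closed (n + 1)).add_right_of_isCompact hC
    rwa [add_comm (intLattice (n + 1) \ {0})] at this
  have hcompl : m • K = (m • K + (intLattice (n + 1) \ {0}))ᶜ := by
    ext y
    constructor
    · rintro ⟨k₁, hk₁, rfl⟩ ⟨_, ⟨k₂, hk₂, rfl⟩, z, ⟨hz, hz0⟩, h⟩
      refine hcon z hz hz0 k₁ hk₁ k₂ hk₂ ?_
      simp only at h
      rw [smul_sub, ← h]
      abel
    · intro hy
      have : y ∈ m • K + intLattice (n + 1) := by rw [hcov]; trivial
      obtain ⟨c, hcc, z, hz, rfl⟩ := this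
      by_cases h0 : z = 0
      · simpa [h0] using hcc
      · exact absurd ⟨c, hcc, z, ⟨hz, h0⟩, rfl⟩ hy
  have hclopen : IsClopen (m • K) := by
    refine ⟨hC.isClosed, ?_⟩
    rw [hcompl]
    exact hU.isOpen_compl
  rcases isClopen_iff.1 hclopen with h | h
  · exact (hne.smul_set (a := m)).ne_empty h
  · rw [h] at hC
    exact noncompact_univ _ hC

lemma cp_cover {n : ℕ} (K : Set (EuclideanSpace ℝ (Fin n))) (hint : (interior K).Nonempty) :
    ∃ m : ℝ, 0 < m ∧ m • K + intLattice n = Set.univ := by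
  obtain ⟨x₀, hx₀⟩ := hint
  obtain ⟨r, hr, hb⟩ := Metric.isOpen_iff.1 isOpen_interior x₀ hx₀
  have hm : 0 < ((n : ℝ) + 1) / r := by positivity
  refine ⟨((n : ℝ) + 1) / r, hm, Set.eq_univ_of_forall fun y => ?_⟩
  set m := ((n : ℝ) + 1) / r with hmdef
  let z : EuclideanSpace ℝ (Fin n) := WithLp.toLp 2 fun j => ((⌊(y - m • x₀) j⌋ : ℤ) : ℝ)
  let f : EuclideanSpace ℝ (Fin n) := y - m • x₀ - z
  have hf : ‖f‖ < n + 1 := by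
    have hj : ∀ j, f j = Int.fract ((y - m • x₀) j) := fun j => rfl
    have h1 : ‖f‖ ^ 2 ≤ n := by
      rw [EuclideanSpace.norm_sq_eq]
      calc ∑ i, ‖f i‖ ^ 2 ≤ ∑ i : Fin n, (1 : ℝ) := by
            refine Finset.sum_le_sum fun i _ => ?_
            rw [hj, Real.norm_of_nonneg (Int.fract_nonneg _)]
            exact pow_le_one₀ (Int.fract_nonneg _) (Int.fract_lt_one _).le
        _ = n := by simp
    nlinarith [norm_nonneg f]
  refine ⟨m • (x₀ + m⁻¹ • f), ⟨_, interior_subset (hb ?_), rfl⟩, z, fun j => ⟨_, rfl⟩, ?_⟩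
  · rw [Metric.mem_ball, dist_eq_norm, add_sub_cancel_left, norm_smul, norm_inv,
      Real.norm_of_nonneg hm.le, inv_mul_lt_iff₀ hm]
    have : m * r = n + 1 := by rw [hmdef]; field_simp
    linarith
  · simp only [smul_add, smul_inv_smul₀ hm.ne']
    simp only [f]
    abel

/-- The set of admissible dilation factors in the definition of `covMin`. -/
def cpSet (n i : ℕ) (K : Set (EuclideanSpace ℝ (Fin n))) : Set ℝ :=
  {μ : ℝ | 0 < μ ∧ ∀ L : AffineSubspace ℝ (EuclideanSpace ℝ (Fin n)),
    (L : Set (EuclideanSpace ℝ (Fin n))).Nonempty →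
    Module.finrank ℝ L.direction = n - i →
    ((μ • K + intLattice n) ∩ (L : Set (EuclideanSpace ℝ (Fin n)))).Nonempty}

lemma cp_covMin (n i : ℕ) (K : Set (EuclideanSpace ℝ (Fin n))) :
    covMin n i K = sInf (cpSet n i K) := rfl

lemma cpSet_nonempty (n i : ℕ) (K : Set (EuclideanSpace ℝ (Fin n)))
    (hint : (interior K).Nonempty) : (cpSet n i K).Nonempty := by
  obtain ⟨m, hm, hcov⟩ := cp_cover K hint
  refine ⟨m, hm, fun L hL _ => ?_⟩
  rw [hcov, Set.univ_inter]
  exact hL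

lemma cpSet_bdd (n i : ℕ) (K : Set (EuclideanSpace ℝ (Fin n))) : BddBelow (cpSet n i K) :=
  ⟨0, fun _ h => h.1.le⟩

lemma cp_covMin_nonneg (n i : ℕ) (K : Set (EuclideanSpace ℝ (Fin n))) : 0 ≤ covMin n i K :=
  Real.sInf_nonneg fun _ h => h.1.le

lemma cpSet_top {n : ℕ} (K : Set (EuclideanSpace ℝ (Fin n))) (m : ℝ) (hm : m ∈ cpSet n n K) :
    m • K + intLattice n = Set.univ := by
  refine Set.eq_univ_of_forall fun y => ?_
  obtain ⟨x, hx, hxy⟩ := hm.2 (AffineSubspace.mk' y ⊥) ⟨y, AffineSubspace.self_mem_mk' _ _⟩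
    (by rw [AffineSubspace.direction_mk', finrank_bot, Nat.sub_self])
  have h2 : x -ᵥ y ∈ (⊥ : Submodule ℝ (EuclideanSpace ℝ (Fin n))) :=
    AffineSubspace.mem_mk'.1 hxy
  rw [Submodule.mem_bot, vsub_eq_sub, sub_eq_zero] at h2
  rwa [← h2]

lemma cp_finrank_comap {E F : Type*} [AddCommGroup E] [Module ℝ E] [FiniteDimensional ℝ E]
    [AddCommGroup F] [Module ℝ F] [FiniteDimensional ℝ F] (f : E →ₗ[ℝ] F)
    (hf : Function.Surjective f) (D : Submodule ℝ F) :
    Module.finrank ℝ (D.comap f) + Module.finrank ℝ F = Module.finrank ℝ D + Module.finrank ℝ E := by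
  have h1 := LinearMap.finrank_range_add_finrank_ker (D.mkQ ∘ₗ f)
  have h2 : LinearMap.range (D.mkQ ∘ₗ f) = ⊤ :=
    LinearMap.range_eq_top.2 ((Submodule.mkQ_surjective D).comp hf)
  have h3 : LinearMap.ker (D.mkQ ∘ₗ f) = D.comap f := by
    rw [LinearMap.ker_comp, Submodule.ker_mkQ]
  rw [h2, h3, finrank_top] at h1
  have h4 := D.finrank_quotient_add_finrank
  omega

lemma cpSet_proj {n : ℕ} (i : ℕ) (hi : i ≤ n) (K : Set (EuclideanSpace ℝ (Fin (n + 1))))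
    (f : EuclideanSpace ℝ (Fin (n + 1)) →ₗ[ℝ] EuclideanSpace ℝ (Fin n))
    (hf : Function.Surjective f) (hz : ∀ z ∈ intLattice (n + 1), f z ∈ intLattice n) :
    cpSet (n + 1) i K ⊆ cpSet n i (f '' K) := by
  rintro m ⟨hm, h⟩
  refine ⟨hm, fun L hL hd => ?_⟩
  obtain ⟨y, hy⟩ := hL
  obtain ⟨x, rfl⟩ := hf y
  obtain ⟨w, hw, hwL⟩ := h (AffineSubspace.mk' x (L.direction.comap f))
    ⟨x, AffineSubspace.self_mem_mk' _ _⟩ (by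
      have := cp_finrank_comap f hf L.direction
      rw [finrank_euclideanSpace_fin, finrank_euclideanSpace_fin, hd] at this
      rw [AffineSubspace.direction_mk']
      omega)
  have h2 : w -ᵥ x ∈ L.direction.comap f := AffineSubspace.mem_mk'.1 hwL
  rw [Submodule.mem_comap, vsub_eq_sub, map_sub] at h2
  refine ⟨f w, ?_, ?_⟩
  · obtain ⟨_, ⟨k, hk, rfl⟩, z, hzz, rfl⟩ := hw
    refine ⟨m • f k, ⟨f k, ⟨k, hk, rfl⟩, rfl⟩, f z, hz z hzz, ?_⟩
    simp
  · have := AffineSubspace.vadd_mem_of_mem_direction h2 hy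
    simpa using this

theorem cp_main (n : ℕ) : ∀ (K : Set (EuclideanSpace ℝ (Fin n)))
    (_ : IsCompact K) (_ : Convex ℝ K) (_ : (interior K).Nonempty),
    1 / (Nat.factorial n : ℝ) ≤ (∏ i ∈ Finset.Icc 1 n, covMin n i K) * (volume K).toReal := by
  induction n with
  | zero =>
    intro K _ _ hint
    have hK : K = Set.univ := by
      obtain ⟨x, hx⟩ := hint
      exact Set.eq_univ_of_forall fun y => (Subsingleton.elim x y) ▸ interior_subset hx
    have hv : volume (Set.univ : Set (EuclideanSpace ℝ (Fin 0))) = 1 := by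
      have := (PiLp.volume_preserving_ofLp (Fin 0)).measure_preimage
        (MeasurableSet.univ.nullMeasurableSet)
      rw [Set.preimage_univ] at this
      rw [this, volume_pi]
      simp
    rw [hK, hv]
    simp
  | succ n ih =>
    intro K hc hconv hint
    -- the estimate for each admissible factor
    have key : ∀ m ∈ cpSet (n + 1) (n + 1) K, 1 / ((n + 1).factorial : ℝ) ≤
        m * ((∏ i ∈ Finset.Icc 1 n, covMin (n + 1) i K) * (volume K).toReal) := by
      intro m hm
      have hm0 : 0 < m := hm.1
      obtain ⟨z, hz, hz0, k₁, hk₁, k₂, hk₂, hzk⟩ :=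
        cp_overlap K hc (hint.mono interior_subset) m (cpSet_top K m hm)
      choose v hv using hz
      have hzv : z = WithLp.toLp 2 fun i => (v i : ℝ) := by ext i; exact hv i
      have hv0 : v ≠ 0 := by
        rintro rfl
        apply hz0
        rw [hzv]
        ext i
        simp
      obtain ⟨A, a, ha, hAv, hAmp, hAb, hAz⟩ := cp_split n v hv0
      rw [← hzv] at hAv
      have hAc : Continuous A := A.continuous_of_finiteDimensional
      let f : EuclideanSpace ℝ (Fin (n + 1)) →ₗ[ℝ] EuclideanSpace ℝ (Fin n) :=
        LinearMap.snd ℝ ℝ (EuclideanSpace ℝ (Fin n)) ∘ₗ A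
      have hfs : Function.Surjective f := Prod.snd_surjective.comp hAb.2
      have hfK : f '' K = Prod.snd '' (A '' K) := by
        rw [Set.image_image]; rfl
      have hfc : Continuous f := f.continuous_of_finiteDimensional
      have hopen : IsOpenMap f := f.toContinuousLinearMap.isOpenMap hfs
      have hfint : (interior (f '' K)).Nonempty :=
        (hint.image f).mono (hopen.image_interior_subset K)
      have hI := ih (f '' K) (hc.image hfc) (hconv.linear_image f) hfint
      have hvolA : volume (A '' K) = volume K := by
        rw [← hAmp.measure_preimage (hc.image hAc).measurableSet.nullMeasurableSet,
          Set.preimage_image_eq _ hAb.1]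
      -- the long segment
      have hseg : ∀ c₁ ∈ K, ∀ c₂ ∈ K, ∀ b : ℤ, 1 ≤ b → A (m • (c₁ - c₂)) = ((b : ℝ), 0) →
          ENNReal.ofReal (m⁻¹ / (n + 1)) * volume (f '' K) ≤ volume K := by
        intro c₁ hc₁ c₂ hc₂ b hb hA
        have hb' : (1 : ℝ) ≤ b := by exact_mod_cast hb
        rw [map_smul, map_sub] at hA
        have e1 : m * ((A c₁).1 - (A c₂).1) = b := congrArg Prod.fst hA
        have e2 : m • ((A c₁).2 - (A c₂).2) = 0 := congrArg Prod.snd hA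
        rw [smul_eq_zero_iff_right hm0.ne', sub_eq_zero] at e2
        have e3 : (A c₁).1 = (A c₂).1 + b / m := by field_simp; linarith
        have hl : 0 < (b : ℝ) / m := div_pos (by linarith) hm0
        have := cp_volume (A '' K) (hc.image hAc) (hconv.linear_image A) (A c₂).1 (b / m) hl
          (A c₂).2 ⟨c₂, hc₂, rfl⟩ ⟨c₁, hc₁, Prod.ext e3 e2⟩
        rw [hvolA, ← hfK] at this
        refine le_trans ?_ this
        gcongr
        rw [inv_eq_one_div]
        gcongr
      have hvol : ENNReal.ofReal (m⁻¹ / (n + 1)) * volume (f '' K) ≤ volume K := by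
        rcases lt_or_gt_of_ne ha with h | h
        · refine hseg k₂ hk₂ k₁ hk₁ (-a) (by omega) ?_
          have : m • (k₂ - k₁) = -z := by rw [hzk]; module
          rw [this, map_neg, hAv]
          simp
        · exact hseg k₁ hk₁ k₂ hk₂ a (by omega) (by rw [← hzk, hAv])
      have hvol' : m⁻¹ / (n + 1) * (volume (f '' K)).toReal ≤ (volume K).toReal := by
        have := ENNReal.toReal_mono hc.measure_lt_top.ne hvol
        rwa [ENNReal.toReal_mul, ENNReal.toReal_ofReal (by positivity)] at this
      have hprod : ∏ i ∈ Finset.Icc 1 n, covMin n i (f '' K) ≤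
          ∏ i ∈ Finset.Icc 1 n, covMin (n + 1) i K := by
        refine Finset.prod_le_prod (fun i _ => cp_covMin_nonneg _ _ _) fun i hi => ?_
        rw [cp_covMin, cp_covMin]
        exact csInf_le_csInf (cpSet_bdd _ _ _) (cpSet_nonempty _ _ _ hint)
          (cpSet_proj i (Finset.mem_Icc.1 hi).2 K f hfs hAz)
      have hP0 : 0 ≤ ∏ i ∈ Finset.Icc 1 n, covMin (n + 1) i K :=
        Finset.prod_nonneg fun i _ => cp_covMin_nonneg _ _ _
      have hI2 := hI.trans (mul_le_mul_of_nonneg_right hprod ENNReal.toReal_nonneg)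
      set P := ∏ i ∈ Finset.Icc 1 n, covMin (n + 1) i K
      have hn1 : (0 : ℝ) < n + 1 := by positivity
      calc 1 / ((n + 1).factorial : ℝ) = 1 / (n + 1) * (1 / (n.factorial : ℝ)) := by
            rw [Nat.factorial_succ]; push_cast; field_simp
        _ ≤ 1 / (n + 1) * (P * (volume (f '' K)).toReal) := by gcongr
        _ = m * (P * (m⁻¹ / (n + 1) * (volume (f '' K)).toReal)) := by field_simp
        _ ≤ m * (P * (volume K).toReal) := by gcongr
    rw [Finset.prod_Icc_succ_top (by omega), mul_assoc, mul_left_comm]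
    rw [cp_covMin (n + 1) (n + 1)]
    set R := (∏ i ∈ Finset.Icc 1 n, covMin (n + 1) i K) * (volume K).toReal
    have hR : 0 < R := by
      obtain ⟨m, hm⟩ := cpSet_nonempty (n + 1) (n + 1) K hint
      have h1 := key m hm
      have h2 : 0 < 1 / ((n + 1).factorial : ℝ) := by positivity
      exact pos_of_mul_pos_right (h2.trans_le h1) hm.1.le
    have h3 : 1 / ((n + 1).factorial : ℝ) / R ≤ sInf (cpSet (n + 1) (n + 1) K) :=
      le_csInf (cpSet_nonempty _ _ _ hint) fun m hm => (div_le_iff₀ hR).2 (key m hm)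
    have h4 := (div_le_iff₀ hR).1 h3
    simp only [R] at h4
    linarith


/-- For every convex body `K` in `ℝⁿ`, the covering product satisfies
`μ_1(K)·…·μ_n(K)·vol(K) ≥ 1/n!`. -/
theorem covering_product_ge (n : ℕ) (hn : 1 ≤ n) (K : Set (EuclideanSpace ℝ (Fin n)))
    (hKcpt : IsCompact K) (hKconv : Convex ℝ K) (hKint : (interior K).Nonempty) :
    (∏ i ∈ Finset.Icc 1 n, covMin n i K) * (volume K).toReal ≥
      1 / (Nat.factorial n : ℝ) :=
  cp_main n K hKcpt hKconv hKint
end
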